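/- Atomic splitting: let G be a graph and a an atom. If G ⅋ a is provable in GS (where a denotes the single-vertex graph labelled a), then there exists a context C[·]_R such that there is a GS derivation from C[ā]_R to G and the graph C (that is, C[∅]_R) is provable in GS. -/

import Mathlib

namespace GSP

/-- Atoms: a propositional variable (coded by a natural number) with a polarity. -/
abbrev Atom := ℕ × Bool

/-- The dual atom. -/
def dualAtom (a : Atom) : Atom := (a.1, !a.2)

/-- A finite, simple, undirected graph whose vertices are labelled by atoms. -/
structure LGraph where
  V : Type
  [fintype : Fintype V]
  adj : V → V → Prop
  symm : ∀ {v w : V}, adj v w → adj w v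
  irrefl : ∀ v : V, ¬ adj v v
  label : V → Atom

attribute [instance] LGraph.fintype

namespace LGraph

/-- An isomorphism of labelled graphs: a vertex bijection preserving labels and
preserving and reflecting edges. -/
structure Iso (G H : LGraph) where
  toEquiv : G.V ≃ H.V
  adj_iff : ∀ v w : G.V, G.adj v w ↔ H.adj (toEquiv v) (toEquiv w)
  label_eq : ∀ v : G.V, H.label (toEquiv v) = G.label v

/-- `G ≅ H` : the graphs `G` and `H` are isomorphic. -/
def iso (G H : LGraph) : Prop := Nonempty (Iso G H)

/-- The empty graph. -/
def empty : LGraph where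
  V := Empty
  adj _ _ := False
  symm h := h.elim
  irrefl v := v.elim
  label v := v.elim

/-- The single-vertex graph labelled by the atom `a`. -/
def single (a : Atom) : LGraph where
  V := Unit
  adj _ _ := False
  symm h := h.elim
  irrefl _ h := h
  label _ := a

def parAdj (G H : LGraph) : G.V ⊕ H.V → G.V ⊕ H.V → Prop
  | .inl a, .inl b => G.adj a b
  | .inr a, .inr b => H.adj a b
  | _, _ => False

/-- The par `G ⅋ H` : disjoint union of `G` and `H`. -/
def par (G H : LGraph) : LGraph where
  V := G.V ⊕ H.V
  adj := parAdj G H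
  symm := by
    rintro (a | a) (b | b) h
    · exact G.symm h
    · exact h.elim
    · exact h.elim
    · exact H.symm h
  irrefl := by
    rintro (a | a) h
    · exact G.irrefl a h
    · exact H.irrefl a h
  label := Sum.elim G.label H.label

def tensorAdj (G H : LGraph) : G.V ⊕ H.V → G.V ⊕ H.V → Prop
  | .inl a, .inl b => G.adj a b
  | .inr a, .inr b => H.adj a b
  | .inl _, .inr _ => True
  | .inr _, .inl _ => True

/-- The tensor `G ⊗ H` : join of `G` and `H` (disjoint union plus all edges in between). -/
def tensor (G H : LGraph) : LGraph where
  V := G.V ⊕ H.V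
  adj := tensorAdj G H
  symm := by
    rintro (a | a) (b | b) h
    · exact G.symm h
    · exact trivial
    · exact trivial
    · exact H.symm h
  irrefl := by
    rintro (a | a) h
    · exact G.irrefl a h
    · exact H.irrefl a h
  label := Sum.elim G.label H.label

/-- The dual graph `Ḡ` : same vertices, complemented edges, dualized labels. -/
def dual (G : LGraph) : LGraph where
  V := G.V
  adj v w := v ≠ w ∧ ¬ G.adj v w
  symm h := ⟨fun e => h.1 e.symm, fun h' => h.2 (G.symm h')⟩
  irrefl _ h := h.1 rfl
  label v := dualAtom (G.label v)

def plugAdj (C : LGraph) (R : Set C.V) (X : LGraph) : C.V ⊕ X.V → C.V ⊕ X.V → Prop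
  | .inl a, .inl b => C.adj a b
  | .inr a, .inr b => X.adj a b
  | .inl a, .inr _ => a ∈ R
  | .inr _, .inl b => b ∈ R

/-- `C[X]_R` : the graph obtained from the context `C[·]_R` by inserting the graph `X`
as a module whose vertices are adjacent exactly to the vertices in `R`. -/
def plug (C : LGraph) (R : Set C.V) (X : LGraph) : LGraph where
  V := C.V ⊕ X.V
  adj := plugAdj C R X
  symm := by
    rintro (a | a) (b | b) h
    · exact C.symm h
    · exact h
    · exact h
    · exact X.symm h
  irrefl := by
    rintro (a | a) h
    · exact C.irrefl a h
    · exact X.irrefl a h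
  label := Sum.elim C.label X.label

def compAdj (G : LGraph) (H : G.V → LGraph) :
    (Σ v : G.V, (H v).V) → (Σ v : G.V, (H v).V) → Prop := fun x y =>
  (∃ (v : G.V) (a b : (H v).V), x = ⟨v, a⟩ ∧ y = ⟨v, b⟩ ∧ (H v).adj a b) ∨
    (x.1 ≠ y.1 ∧ G.adj x.1 y.1)

/-- The composition `G⟨H v₁, …, H vₙ⟩` of the family `H` via the graph `G`:
replace each vertex `v` of `G` by the graph `H v`. -/
def comp (G : LGraph) (H : G.V → LGraph) : LGraph where
  V := Σ v : G.V, (H v).V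
  adj := compAdj G H
  symm := by
    rintro x y (⟨v, a, b, hx, hy, hab⟩ | ⟨hne, hadj⟩)
    · exact Or.inl ⟨v, b, a, hy, hx, (H v).symm hab⟩
    · exact Or.inr ⟨hne.symm, G.symm hadj⟩
  irrefl := by
    rintro ⟨v, a⟩ (⟨w, x, y, hx, hy, hxy⟩ | ⟨hne, _⟩)
    · have h := hx.symm.trans hy
      obtain rfl : x = y := by simpa using h
      exact (H w).irrefl x hxy
    · exact hne rfl
  label x := (H x.1).label x.2

/-- A module of `G` : a set `M` of vertices such that every vertex outside `M`
is adjacent either to all vertices of `M` or to none of them. -/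
def IsModule (G : LGraph) (M : Set G.V) : Prop :=
  ∀ v ∉ M, ∀ x ∈ M, ∀ y ∈ M, (G.adj v x ↔ G.adj v y)

/-- A prime graph: at least 2 vertices and only trivial modules. -/
def Prime (G : LGraph) : Prop :=
  2 ≤ Fintype.card G.V ∧
    ∀ M : Set G.V, G.IsModule M → M = ∅ ∨ (∃ v, M = {v}) ∨ M = Set.univ

/-- `G` is `P₄`-free: no four distinct vertices induce a path on 4 vertices. -/
def P4Free (G : LGraph) : Prop :=
  ¬ ∃ v₁ v₂ v₃ v₄ : G.V,
      v₁ ≠ v₂ ∧ v₁ ≠ v₃ ∧ v₁ ≠ v₄ ∧ v₂ ≠ v₃ ∧ v₂ ≠ v₄ ∧ v₃ ≠ v₄ ∧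
      G.adj v₁ v₂ ∧ G.adj v₂ v₃ ∧ G.adj v₃ v₄ ∧
      ¬ G.adj v₁ v₃ ∧ ¬ G.adj v₁ v₄ ∧ ¬ G.adj v₂ v₄

end LGraph

open LGraph

/-- The `n`-fold tensor `X₁ ⊗ ⋯ ⊗ Xₙ`. -/
def bigTensor : (n : ℕ) → (Fin n → LGraph) → LGraph
  | 0, _ => LGraph.empty
  | n + 1, F => (F 0).tensor (bigTensor n fun i => F i.succ)

/-- The `n`-fold par `X₁ ⅋ ⋯ ⅋ Xₙ`. -/
def bigPar : (n : ℕ) → (Fin n → LGraph) → LGraph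
  | 0, _ => LGraph.empty
  | n + 1, F => (F 0).par (bigPar n fun i => F i.succ)

/-- The inference rules of system GS (premise, conclusion). -/
inductive GSRule : LGraph → LGraph → Prop
  /-- ai↓ : premise `∅`, conclusion `ā ⅋ a`. -/
  | ai (a : Atom) : GSRule LGraph.empty ((single (dualAtom a)).par (single a))
  /-- ss↓ : premise `B[A]_S`, conclusion `B ⅋ A`, for `A ≠ ∅` and `S ≠ ∅`. -/
  | ss (A B : LGraph) (S : Set B.V) :
      Nonempty A.V → S ≠ ∅ → GSRule (B.plug S A) (B.par A)
  /-- p↓ : premise `(M₁ ⅋ N₁) ⊗ ⋯ ⊗ (Mₙ ⅋ Nₙ)`, conclusion `P̄⟨M₁,…,Mₙ⟩ ⅋ P⟨N₁,…,Nₙ⟩`,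
  for `P` prime with `n = |V(P)| ≥ 4` and all `Mᵢ ≠ ∅`. -/
  | p (n : ℕ) (P : LGraph) (e : P.V ≃ Fin n) (M N : Fin n → LGraph) :
      P.Prime → 4 ≤ n → (∀ i, Nonempty (M i).V) →
      GSRule (bigTensor n fun i => (M i).par (N i))
        ((P.dual.comp fun v => M (e v)).par (P.comp fun v => N (e v)))

/-- The "up" rules ai↑, ss↑, p↑ (premise, conclusion). -/
inductive UpRule : LGraph → LGraph → Prop
  /-- ai↑ : premise `a ⊗ ā`, conclusion `∅`. -/
  | ai (a : Atom) : UpRule ((single a).tensor (single (dualAtom a))) LGraph.empty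
  /-- ss↑ : premise `B ⊗ A`, conclusion `B[A]_S`, for `A ≠ ∅` and `S ≠ V(B)`. -/
  | ss (A B : LGraph) (S : Set B.V) :
      Nonempty A.V → S ≠ Set.univ → UpRule (B.tensor A) (B.plug S A)
  /-- p↑ : premise `P⟨M₁,…,Mₙ⟩ ⊗ P̄⟨N₁,…,Nₙ⟩`, conclusion `(M₁ ⊗ N₁) ⅋ ⋯ ⅋ (Mₙ ⊗ Nₙ)`,
  for `P` prime with `n = |V(P)| ≥ 4` and all `Mᵢ ≠ ∅`. -/
  | p (n : ℕ) (P : LGraph) (e : P.V ≃ Fin n) (M N : Fin n → LGraph) :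
      P.Prime → 4 ≤ n → (∀ i, Nonempty (M i).V) →
      UpRule ((P.comp fun v => M (e v)).tensor (P.dual.comp fun v => N (e v)))
        (bigPar n fun i => (M i).tensor (N i))

/-- The rules of system SGS : the rules of GS together with their duals. -/
def SGSRule (G H : LGraph) : Prop := GSRule G H ∨ UpRule G H

/-- A single inference step in a system: inside some context, replace a module
isomorphic to the premise of a rule by the corresponding conclusion. -/
def Step (Rules : LGraph → LGraph → Prop) (G H : LGraph) : Prop :=
  ∃ (C : LGraph) (R : Set C.V) (p c : LGraph),
    Rules p c ∧ G.iso (C.plug R p) ∧ H.iso (C.plug R c)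

/-- A derivation in a system from `G` to `H` : a finite sequence of inference steps
and isomorphisms leading from `G` to `H`. -/
def Deriv (Rules : LGraph → LGraph → Prop) (G H : LGraph) : Prop :=
  Relation.ReflTransGen (fun X Y => X.iso Y ∨ Step Rules X Y) G H

/-- A graph is provable in a system if there is a derivation from `∅` to it. -/
def Provable (Rules : LGraph → LGraph → Prop) (G : LGraph) : Prop :=
  Deriv Rules LGraph.empty G

/-- Formulas: unit, positive and negative atoms, par and tensor. -/
inductive Formula where
  | unit : Formula
  | pos (a : ℕ) : Formula
  | neg (a : ℕ) : Formula
  | par (φ ψ : Formula) : Formula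
  | tens (φ ψ : Formula) : Formula

/-- The graph `[φ]` of a formula `φ`. -/
def Formula.graph : Formula → LGraph
  | .unit => LGraph.empty
  | .pos a => single (a, true)
  | .neg a => single (a, false)
  | .par φ ψ => φ.graph.par ψ.graph
  | .tens φ ψ => φ.graph.tensor ψ.graph

/-- Structural equivalence of formulas: the smallest congruence making `⅋` and `⊗`
associative and commutative with unit `∘`. -/
inductive Formula.equiv : Formula → Formula → Prop
  | refl (φ) : Formula.equiv φ φ
  | symm {φ ψ} : Formula.equiv φ ψ → Formula.equiv ψ φ
  | trans {φ ψ χ} : Formula.equiv φ ψ → Formula.equiv ψ χ → Formula.equiv φ χ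
  | parComm (φ ψ) : Formula.equiv (.par φ ψ) (.par ψ φ)
  | parAssoc (φ ψ χ) : Formula.equiv (.par φ (.par ψ χ)) (.par (.par φ ψ) χ)
  | parUnit (φ) : Formula.equiv (.par φ .unit) φ
  | tensComm (φ ψ) : Formula.equiv (.tens φ ψ) (.tens ψ φ)
  | tensAssoc (φ ψ χ) : Formula.equiv (.tens φ (.tens ψ χ)) (.tens (.tens φ ψ) χ)
  | tensUnit (φ) : Formula.equiv (.tens φ .unit) φ
  | parCongr {φ φ' ψ ψ'} : Formula.equiv φ φ' → Formula.equiv ψ ψ' →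
      Formula.equiv (.par φ ψ) (.par φ' ψ')
  | tensCongr {φ φ' ψ ψ'} : Formula.equiv φ φ' → Formula.equiv ψ ψ' →
      Formula.equiv (.tens φ ψ) (.tens φ' ψ')

/-- A formula is unit-free if it contains no occurrence of the unit `∘`. -/
def Formula.UnitFree : Formula → Prop
  | .unit => False
  | .pos _ => True
  | .neg _ => True
  | .par φ ψ => φ.UnitFree ∧ ψ.UnitFree
  | .tens φ ψ => φ.UnitFree ∧ ψ.UnitFree

/-- The sequent calculus MLL° (multiplicative linear logic with mix) on multisets
of formulas. -/
inductive MLL : Multiset Formula → Prop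
  | ax (a : ℕ) : MLL {Formula.pos a, Formula.neg a}
  | tens {Γ Δ : Multiset Formula} (φ ψ : Formula) :
      MLL (φ ::ₘ Γ) → MLL (ψ ::ₘ Δ) → MLL (Formula.tens φ ψ ::ₘ (Γ + Δ))
  | par {Γ : Multiset Formula} (φ ψ : Formula) :
      MLL (φ ::ₘ ψ ::ₘ Γ) → MLL (Formula.par φ ψ ::ₘ Γ)
  | mix {Γ Δ : Multiset Formula} : MLL Γ → MLL Δ → MLL (Γ + Δ)

end GSP

namespace GSP

/-! ## Concrete graphs inside a fixed universe of labelled points -/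

abbrev Pt := ℕ × Atom

structure CG where
  V : Pt → Prop
  E : Pt → Pt → Prop
  fin : {x | V x}.Finite
  supp : ∀ x y, E x y → V x
  symm : ∀ x y, E x y → E y x
  irr : ∀ x, ¬ E x x

namespace CG

theorem supp2 (H : CG) (x y) (h : H.E x y) : H.V y := H.supp _ _ (H.symm _ _ h)

theorem ext' {G H : CG} (hV : ∀ x, G.V x ↔ H.V x) (hE : ∀ x y, G.E x y ↔ H.E x y) : G = H := by
  obtain ⟨V, E, _, _, _, _⟩ := G
  obtain ⟨V', E', _, _, _, _⟩ := H
  obtain rfl : V = V' := funext fun x => propext (hV x)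
  obtain rfl : E = E' := funext fun x => funext fun y => propext (hE x y)
  rfl

def res (H : CG) (S : Pt → Prop) : CG where
  V x := H.V x ∧ S x
  E x y := H.E x y ∧ S x ∧ S y
  fin := H.fin.subset fun _ h => h.1
  supp x y h := ⟨H.supp _ _ h.1, h.2.1⟩
  symm x y h := ⟨H.symm _ _ h.1, h.2.2, h.2.1⟩
  irr x h := H.irr x h.1

def par (G H : CG) : CG where
  V x := G.V x ∨ H.V x
  E x y := G.E x y ∨ H.E x y
  fin := G.fin.union H.fin
  supp x y h := h.imp (G.supp _ _) (H.supp _ _)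
  symm x y h := h.imp (G.symm _ _) (H.symm _ _)
  irr x h := h.elim (G.irr x) (H.irr x)

def tens (G H : CG) : CG where
  V x := G.V x ∨ H.V x
  E x y := G.E x y ∨ H.E x y ∨ (x ≠ y ∧ ((G.V x ∧ H.V y) ∨ (H.V x ∧ G.V y)))
  fin := G.fin.union H.fin
  supp x y h := by
    have := G.supp x y; have := H.supp x y; grind
  symm x y h := by
    have := G.symm x y; have := H.symm x y; grind
  irr x h := by
    have := G.irr x; have := H.irr x; grind

def cut (H : CG) (S T : Pt → Prop) : CG where
  V := H.V
  E x y := H.E x y ∧ ¬ (S x ∧ T y) ∧ ¬ (T x ∧ S y)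
  fin := H.fin
  supp x y h := H.supp _ _ h.1
  symm x y h := by
    have := H.symm x y; grind
  irr x h := H.irr x h.1

/-- replace the part `T` of `H` by `Y`, attached as the point `t` was. -/
def sub (H : CG) (T : Pt → Prop) (t : Pt) (Y : CG) : CG where
  V x := (H.V x ∧ ¬ T x) ∨ Y.V x
  E x y := x ≠ y ∧ ((H.E x y ∧ ¬ T x ∧ ¬ T y) ∨ Y.E x y ∨ (Y.V x ∧ ¬ T y ∧ H.E t y) ∨
    (Y.V y ∧ ¬ T x ∧ H.E t x))
  fin := (H.fin.subset (fun _ h => h.1)).union Y.fin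
  supp x y h := by
    have := H.supp x y; have := Y.supp x y; have := H.supp2 t x; grind
  symm x y h := by
    have := H.symm x y; have := Y.symm x y; grind
  irr x h := by grind

def nil : CG where
  V _ := False
  E _ _ := False
  fin := by simp
  supp := by simp
  symm := by simp
  irr := by simp

noncomputable def sz (H : CG) : ℕ := {x | H.V x}.ncard

def Mod (H : CG) (S : Pt → Prop) : Prop :=
  (∀ x, S x → H.V x) ∧ ∀ v x y, H.V v → ¬ S v → S x → S y → H.E v x → H.E v y

end CG

def PrimeOn (I : Finset ℕ) (p : ℕ → ℕ → Prop) : Prop :=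
  4 ≤ I.card ∧ ∀ J ⊆ I, (∀ k ∈ I, k ∉ J → ∀ i ∈ J, ∀ j ∈ J, p k i → p k j) →
    J.card ≤ 1 ∨ J = I

/-- `H` is the par of the `p`-composition of the blocks inside `L` and of the
co-`p`-composition of the blocks outside `L`. -/
structure Compo (H : CG) (I : Finset ℕ) (p : ℕ → ℕ → Prop) (β : Pt → ℕ) (L : Pt → Prop) :
    Prop where
  symm : ∀ i j, p i j → p j i
  mem : ∀ x, H.V x → β x ∈ I
  left : ∀ x y, H.V x → H.V y → β x ≠ β y → L x → L y → (H.E x y ↔ p (β x) (β y))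
  right : ∀ x y, H.V x → H.V y → β x ≠ β y → ¬ L x → ¬ L y → (H.E x y ↔ ¬ p (β x) (β y))
  cross : ∀ x y, L x → ¬ L y → ¬ H.E x y

open CG

inductive Pr : CG → Prop
  | empty (H : CG) : (∀ x, ¬ H.V x) → Pr H
  | ai (H : CG) (x y : Pt) : x ≠ y → y.2 = dualAtom x.2 → (∀ z, H.V z ↔ z = x ∨ z = y) →
      (∀ z w, ¬ H.E z w) → Pr H
  | s (H H' : CG) (X W D : Pt → Prop) : H'.Mod D → H'.Mod (fun x => X x ∨ W x) →
      (∀ x, X x → ¬ W x) → (∀ x, X x → D x) → (∀ x, W x → D x) →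
      (∃ x, X x) → (∃ x, W x) → (∀ x y, X x → W y → ¬ H'.E x y) →
      (∀ x, H.V x ↔ H'.V x) →
      (∀ x y, H.E x y ↔ H'.E x y ∧ ¬ (W x ∧ D y ∧ ¬ X y ∧ ¬ W y) ∧
        ¬ (W y ∧ D x ∧ ¬ X x ∧ ¬ W x)) →
      Pr H' → Pr H
  | ins (H : CG) (Q : Pt → Prop) : H.Mod Q → Pr (H.res fun x => ¬ Q x) → Pr (H.res Q) → Pr H
  | pr (H : CG) (I : Finset ℕ) (p : ℕ → ℕ → Prop) (β : Pt → ℕ) (L : Pt → Prop) :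
      PrimeOn I p → Compo H I p β L →
      (∀ i ∈ I, ∃ x, H.V x ∧ β x = i ∧ L x) → (∀ i ∈ I, ∃ x, H.V x ∧ β x = i ∧ ¬ L x) →
      (∀ i ∈ I, Pr (H.res fun x => β x = i)) → Pr H

theorem Pr.congr {G H : CG} (h : Pr G) (hV : ∀ x, G.V x ↔ H.V x)
    (hE : ∀ x y, G.E x y ↔ H.E x y) : Pr H := CG.ext' hV hE ▸ h

namespace CG
variable (G H K : CG)
theorem par_comm : G.par H = H.par G := ext' (fun _ => or_comm) fun _ _ => or_comm
theorem par_assoc : (G.par H).par K = G.par (H.par K) := ext' (fun _ => or_assoc) fun _ _ => or_assoc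
theorem par_left_comm : G.par (H.par K) = H.par (G.par K) := ext' (fun _ => or_left_comm) fun _ _ => or_left_comm
theorem par_nil : G.par nil = G := ext' (fun _ => by simp [par, nil]) fun _ _ => by simp [par, nil]

theorem sz_par (h : ∀ x, G.V x → ¬ H.V x) : (G.par H).sz = G.sz + H.sz := by
  unfold sz
  rw [← Set.ncard_union_eq _ G.fin H.fin]
  · rfl
  · rw [Set.disjoint_left]; exact h

theorem sz_tens (h : ∀ x, G.V x → ¬ H.V x) : (G.tens H).sz = G.sz + H.sz := by
  rw [← sz_par G H h]; rfl

variable {G H K}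
theorem sz_congr (h : ∀ x, G.V x ↔ H.V x) : G.sz = H.sz := by
  unfold sz; congr 1; ext x; exact h x

theorem sz_mono (h : ∀ x, G.V x → H.V x) : G.sz ≤ H.sz :=
  Set.ncard_le_ncard h H.fin

theorem sz_pos (h : ∃ x, G.V x) : 0 < G.sz := by
  obtain ⟨x, hx⟩ := h
  exact (Set.ncard_pos G.fin).2 ⟨x, hx⟩

theorem sz_split (S : Pt → Prop) : H.sz = (H.res S).sz + (H.res fun x => ¬ S x).sz := by
  rw [← sz_par]
  · apply sz_congr; intro x; simp only [res, par]; tauto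
  · intro x hx hx'; exact hx'.2 hx.2
theorem sz_nil : nil.sz = 0 := by simp [sz, nil]
end CG

/-- s without the non-emptiness condition on `W`. -/
theorem Pr.s' {H H' : CG} (h : Pr H') (X W D : Pt → Prop) (h1 : H'.Mod D)
    (h2 : H'.Mod (fun x => X x ∨ W x)) (h3 : ∀ x, X x → ¬ W x) (h4 : ∀ x, X x → D x)
    (h5 : ∀ x, W x → D x) (h6 : ∃ x, X x) (h7 : ∀ x y, X x → W y → ¬ H'.E x y)
    (h8 : ∀ x, H.V x ↔ H'.V x)
    (h9 : ∀ x y, H.E x y ↔ H'.E x y ∧ ¬ (W x ∧ D y ∧ ¬ X y ∧ ¬ W y) ∧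
        ¬ (W y ∧ D x ∧ ¬ X x ∧ ¬ W x)) : Pr H := by
  by_cases hW : ∃ x, W x
  · exact Pr.s H H' X W D h1 h2 h3 h4 h5 h6 hW h7 h8 h9 h
  · refine h.congr (fun x => (h8 x).symm) fun x y => ?_
    have := h9 x y
    have a : ¬ W x := fun h => hW ⟨_, h⟩
    have b : ¬ W y := fun h => hW ⟨_, h⟩
    tauto

/-- mix -/
theorem Pr.par {G H : CG} (hd : ∀ x, G.V x → ¬ H.V x) (hG : Pr G) (hH : Pr H) : Pr (G.par H) := by
  have g1 := G.supp; have g2 := H.supp; have g3 := G.supp2; have g4 := H.supp2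
  refine Pr.ins _ H.V ⟨fun x h => Or.inr h, ?_⟩ (hG.congr ?_ ?_) (hH.congr ?_ ?_)
  · intro v x y; simp only [CG.par]; grind
  all_goals simp only [CG.par, CG.res]; grind

theorem Pr.tens {G H : CG} (hd : ∀ x, G.V x → ¬ H.V x) (hG : Pr G) (hH : Pr H) :
    Pr (G.tens H) := by
  have g1 := G.supp; have g2 := H.supp; have g3 := G.supp2; have g4 := H.supp2
  refine Pr.ins _ H.V ⟨fun x h => Or.inr h, ?_⟩ (hG.congr ?_ ?_) (hH.congr ?_ ?_)
  · intro v x y; simp only [CG.tens]; grind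
  all_goals simp only [CG.tens, CG.res]; grind

end GSP

set_option linter.unusedVariables false
namespace GSP
open CG

theorem Compo.swap {H : CG} {I p β L} (h : Compo H I p β L) :
    Compo H I (fun i j => ¬ p i j) β (fun x => ¬ L x) where
  symm i j hp hq := hp (h.symm _ _ hq)
  mem := h.mem
  left x y hx hy hn hl hr := h.right x y hx hy hn hl hr
  right x y hx hy hn hl hr := by
    have := h.left x y hx hy hn (not_not.1 hl) (not_not.1 hr); tauto
  cross x y hx hy he := h.cross y x (not_not.1 hy) hx (H.symm _ _ he)

theorem gen_two {H : CG} {I : Finset ℕ} {p : ℕ → ℕ → Prop} {β : Pt → ℕ} {L : Pt → Prop}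
    (h : Compo H I p β L) (i j : ℕ) (hij : i ≠ j) (hI : I = {i, j}) (hp : p i j)
    (hL : ∀ i ∈ I, ∃ x, H.V x ∧ β x = i ∧ L x)
    (hi : Pr (H.res fun x => β x = i)) (hj : Pr (H.res fun x => β x = j)) : Pr H := by
  have h0 := Pr.tens (by simp only [res]; grind) hi hj
  have a1 := H.supp; have a2 := H.supp2; have a3 := H.symm
  have hmem : ∀ x, H.V x → β x = i ∨ β x = j := fun x hx => by
    have := h.mem x hx; simpa [hI] using this
  have l := h.left; have r := h.right; have c := h.cross; have sy := h.symm
  obtain ⟨xi, hxi⟩ := hL i (by simp [hI])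
  obtain ⟨xj, hxj⟩ := hL j (by simp [hI])
  set T := (H.res fun x => β x = i).tens (H.res fun x => β x = j) with hT
  have TV : ∀ x, T.V x ↔ H.V x := by intro x; have := hmem x; simp only [hT, tens, res]; grind
  have TE : ∀ x y, T.E x y ↔ H.V x ∧ H.V y ∧ ((β x = β y ∧ H.E x y) ∨ (β x ≠ β y)) := by
    intro x y; have := hmem x; have := hmem y; simp only [hT, tens, res]; grind
  clear_value T
  have h1 : Pr (T.cut (fun x => β x = i ∧ ¬ L x) (fun x => β x = j)) := by
    refine h0.s' (fun x => H.V x ∧ β x = i ∧ L x) (fun x => H.V x ∧ β x = i ∧ ¬ L x) H.V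
      ⟨fun x hx => (TV x).2 hx, ?_⟩ ⟨?_, ?_⟩ ?_ ?_ ?_ ⟨xi, hxi⟩ ?_ ?_ ?_
    all_goals try simp only [cut]
    all_goals grind
  refine h1.s' (fun x => H.V x ∧ β x = j ∧ L x) (fun x => H.V x ∧ β x = j ∧ ¬ L x) H.V
      ⟨fun x hx => (TV x).2 hx, ?_⟩ ⟨?_, ?_⟩ ?_ ?_ ?_ ⟨xj, hxj⟩ ?_ ?_ ?_
  all_goals try simp only [cut]
  all_goals grind

theorem three_mod (I : Finset ℕ) (p : ℕ → ℕ → Prop) (hs : ∀ i j, p i j → p j i)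
    (h3 : I.card = 3) : ∃ J ⊆ I, J.card = 2 ∧
      ∀ k ∈ I, k ∉ J → ∀ i ∈ J, ∀ j ∈ J, p k i → p k j := by
  obtain ⟨a, b, c, hab, hac, hbc, rfl⟩ := Finset.card_eq_three.1 h3
  by_cases h1 : p a b ↔ p a c
  · exact ⟨{b, c}, by simp, by simp [hbc], by simp; grind⟩
  by_cases h2 : p b a ↔ p b c
  · exact ⟨{a, c}, by intro; simp; tauto, by simp [hac], by simp; grind⟩
  · exact ⟨{a, b}, by intro; simp; tauto, by simp [hab], by simp; grind⟩

theorem gen_aux : ∀ (n : ℕ) (I : Finset ℕ), I.card ≤ n → ∀ (H : CG) (p : ℕ → ℕ → Prop)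
    (β : Pt → ℕ) (L : Pt → Prop), Compo H I p β L →
    (∀ i ∈ I, Pr (H.res fun x => β x = i)) → Pr H := by
  intro n
  induction n with
  | zero =>
    intro I hI H p β L h _
    refine Pr.empty _ fun x hx => ?_
    have := h.mem x hx
    have : I = ∅ := by simpa using hI
    simp_all
  | succ n ih =>
    intro I hI H p β L h hb
    have a1 := H.supp; have a2 := H.supp2; have a3 := H.symm
    have l := h.left; have r := h.right; have c := h.cross; have sy := h.symm; have mem := h.mem
    by_cases hne : ∃ i ∈ I, (¬ ∃ x, H.V x ∧ β x = i ∧ L x) ∨ (¬ ∃ x, H.V x ∧ β x = i ∧ ¬ L x)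
    · obtain ⟨i, hi, hside⟩ := hne
      refine Pr.ins H (fun x => H.V x ∧ β x = i) ⟨fun x hx => hx.1, ?_⟩ ?_ ?_
      · intro v x y hv hnv hx hy hE
        by_cases hLv : L v <;> by_cases hLx : L x <;> by_cases hLy : L y <;> grind
      · refine ih (I.erase i) (by rw [Finset.card_erase_of_mem hi]; omega) _ p β L ⟨sy, ?_, ?_, ?_, ?_⟩ ?_
        · intro x hx; simp only [res] at hx; rw [Finset.mem_erase]; grind
        · intro x y; simp only [res]; grind
        · intro x y; simp only [res]; grind
        · intro x y; simp only [res]; grind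
        · intro j hj
          rw [Finset.mem_erase] at hj
          refine (hb j hj.2).congr ?_ ?_ <;> simp only [res] <;> grind
      · refine (hb i hi).congr ?_ ?_ <;> simp only [res] <;> grind
    push Not at hne
    by_cases hm : ∃ J ⊆ I, 2 ≤ J.card ∧ J ≠ I ∧
      ∀ k ∈ I, k ∉ J → ∀ i ∈ J, ∀ j ∈ J, p k i → p k j
    · obtain ⟨J, hJI, hJ2, hJne, hJ⟩ := hm
      have hlt : J.card < I.card := Finset.card_lt_card (hJI.ssubset_of_ne hJne)
      obtain ⟨j0, hj0⟩ : J.Nonempty := Finset.card_pos.1 (by omega)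
      classical
      set β' : Pt → ℕ := fun x => if β x ∈ J then j0 else β x with hβ'
      have b1 : ∀ x, β x ∈ J → β' x = j0 := fun x hx => by simp [hβ', hx]
      have b2 : ∀ x, β x ∉ J → β' x = β x := fun x hx => by simp [hβ', hx]
      clear_value β'
      refine ih (insert j0 (I \ J)) ?_ H p β' L ⟨sy, ?_, ?_, ?_, c⟩ ?_
      · have := Finset.card_insert_le j0 (I \ J)
        rw [Finset.card_sdiff_of_subset hJI] at this; omega
      · intro x hx; rw [Finset.mem_insert, Finset.mem_sdiff]; have := mem x hx; grind
      · intro x y hx hy; have := mem x hx; have := mem y hy; grind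
      · intro x y hx hy; have := mem x hx; have := mem y hy; grind
      · intro j hj
        rw [Finset.mem_insert, Finset.mem_sdiff] at hj
        by_cases hjj : j = j0
        · subst hjj
          have := ih J (by omega) (H.res fun x => β x ∈ J) p β L
            ⟨sy, fun x hx => hx.2, ?_, ?_, ?_⟩ ?_
          · refine this.congr ?_ ?_ <;> simp only [res] <;> grind
          · intro x y; simp only [res]; grind
          · intro x y; simp only [res]; grind
          · intro x y; simp only [res]; grind
          · intro i hi
            refine (hb i (hJI hi)).congr ?_ ?_ <;> simp only [res] <;> grind
        · refine (hb j (by grind)).congr ?_ ?_ <;> simp only [res] <;> grind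
    push Not at hm
    rcases Nat.lt_or_ge I.card 4 with h4 | h4
    · have : I.card = 0 ∨ I.card = 1 ∨ I.card = 2 ∨ I.card = 3 := by omega
      rcases this with h0 | h1 | h2 | h3
      · exact ih I (by omega) H p β L h hb
      · obtain ⟨i, rfl⟩ := Finset.card_eq_one.1 h1
        have : ∀ x, H.V x → β x = i := by simpa using mem
        refine (hb i (by simp)).congr ?_ ?_ <;> simp only [res] <;> grind
      · obtain ⟨i, j, hij, hI2⟩ := Finset.card_eq_two.1 h2
        by_cases hp : p i j
        · exact gen_two h i j hij hI2 hp (fun i hi => (hne i hi).1) (hb i (by simp [hI2]))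
            (hb j (by simp [hI2]))
        · exact gen_two h.swap i j hij hI2 hp (fun i hi => (hne i hi).2) (hb i (by simp [hI2]))
            (hb j (by simp [hI2]))
      · obtain ⟨J, hJ1, hJ2, hJ3⟩ := three_mod I p sy h3
        obtain ⟨k, hk, hkJ, i, hi, j, hj, q1, q2⟩ := hm J hJ1 hJ2.ge (by rintro rfl; omega)
        exact absurd (hJ3 k hk hkJ i hi j hj q1) q2
    · refine Pr.pr H I p β L ⟨h4, fun J hJ hmod => ?_⟩ h (fun i hi => (hne i hi).1)
        (fun i hi => (hne i hi).2) hb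
      by_contra hcon
      push Not at hcon
      obtain ⟨k, hk, hkJ, i, hi, j, hj, q1, q2⟩ := hm J hJ (by omega) hcon.2
      exact q2 (hmod k hk hkJ i hi j hj q1)

theorem Pr.gen {H : CG} {I p β L} (h : Compo H I p β L)
    (hb : ∀ i ∈ I, Pr (H.res fun x => β x = i)) : Pr H :=
  gen_aux _ I le_rfl H p β L h hb

end GSP

set_option linter.unusedVariables false
namespace GSP
open CG

/-- two-block composition -/
theorem Pr.tp {P Q K L : CG} (h1 : ∀ x, P.V x → ¬ Q.V x ∧ ¬ K.V x ∧ ¬ L.V x)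
    (h2 : ∀ x, Q.V x → ¬ K.V x ∧ ¬ L.V x) (h3 : ∀ x, K.V x → ¬ L.V x)
    (hP : Pr (P.par K)) (hQ : Pr (Q.par L)) : Pr ((P.tens Q).par (K.par L)) := by
  classical
  have a1 := P.supp; have a2 := P.supp2; have b1 := Q.supp; have b2 := Q.supp2
  have c1 := K.supp; have c2 := K.supp2; have d1 := L.supp; have d2 := L.supp2
  obtain ⟨β, hβ⟩ : ∃ β : Pt → ℕ, ∀ x, (P.V x ∨ K.V x → β x = 0) ∧ (¬ (P.V x ∨ K.V x) → β x = 1) :=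
    ⟨fun x => if P.V x ∨ K.V x then 0 else 1, by intro x; simp; tauto⟩
  have e0 : ∀ x, P.V x → β x = 0 := fun x h => (hβ x).1 (Or.inl h)
  have e1 : ∀ x, K.V x → β x = 0 := fun x h => (hβ x).1 (Or.inr h)
  have e2 : ∀ x, Q.V x → β x = 1 := by grind
  have e3 : ∀ x, L.V x → β x = 1 := by grind
  clear hβ
  refine Pr.gen (I := {0, 1}) (p := fun _ _ => True) (β := β) (L := fun x => P.V x ∨ Q.V x)
    ⟨by simp, ?_, ?_, ?_, ?_⟩ ?_
  · intro x; simp only [CG.par, CG.tens, Finset.mem_insert, Finset.mem_singleton]; grind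
  · intro x y; simp only [CG.par, CG.tens]; grind
  · intro x y; simp only [CG.par, CG.tens]; grind
  · intro x y; simp only [CG.par, CG.tens]; grind
  · intro i hi
    simp only [Finset.mem_insert, Finset.mem_singleton] at hi
    rcases hi with rfl | rfl
    · refine hP.congr ?_ ?_ <;> simp only [CG.par, CG.tens, res] <;> grind
    · refine hQ.congr ?_ ?_ <;> simp only [CG.par, CG.tens, res] <;> grind

def Tau (m : ℕ) (GA GB Y : CG) (N : Pt → Prop) : Prop :=
  ∀ KA KB : CG, (∀ x, KA.V x → ¬ N x) → (∀ x, KB.V x → ¬ N x) → (∀ x, KA.V x → ¬ KB.V x) →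
    GA.sz + GB.sz + KA.sz + KB.sz ≤ m → Pr (GA.par KA) → Pr (GB.par KB) →
    Pr (Y.par (KA.par KB))

theorem Tau.swap {m GA GB Y N} (h : Tau m GA GB Y N) : Tau m GB GA Y N := by
  intro KA KB h1 h2 h3 h4 h5 h6
  rw [par_comm KA KB]
  exact h KB KA h2 h1 (fun x a b => h3 x b a) (by omega) h6 h5

structure Cfg (m : ℕ) (H : CG) (A B T : Pt → Prop) (Y : CG) (N : Pt → Prop) (t : Pt) : Prop where
  hm : H.sz ≤ m
  hT : ∀ x, T x ↔ A x ∨ B x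
  dis : ∀ x, A x → ¬ B x
  mod : H.Mod T
  ht : T t
  AB : ∀ x y, A x → B y → H.E x y
  Yne : ∃ x, Y.V x
  hN : ∀ x, H.V x → ¬ T x → ¬ N x
  TN : ∀ x, T x → N x
  YN : ∀ x, Y.V x → N x
  tau : Tau m (H.res A) (H.res B) Y N

theorem Cfg.swap {m H A B T Y N t} (h : Cfg m H A B T Y N t) : Cfg m H B A T Y N t :=
  ⟨h.hm, fun x => (h.hT x).trans or_comm, fun x a b => h.dis x b a, h.mod, h.ht,
    fun x y a b => H.symm _ _ (h.AB _ _ b a), h.Yne, h.hN, h.TN, h.YN, h.tau.swap⟩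

def StH (m : ℕ) (H : CG) : Prop := ∀ A B T Y N t, Cfg m H A B T Y N t → Pr (H.sub T t Y)
def St (m : ℕ) : Prop := ∀ H, Pr H → StH m H

theorem TS {m : ℕ} (hS : St m) {GA GB Y Z : CG} {N : Pt → Prop}
    (hsz : GA.sz + GB.sz + Z.sz ≤ m)
    (hAB : ∀ x, GA.V x → ¬ GB.V x) (hne : ∃ x, GA.V x ∨ GB.V x) (Yne : ∃ x, Y.V x)
    (hA : ∀ x, GA.V x → N x) (hB : ∀ x, GB.V x → N x) (hY : ∀ x, Y.V x → N x)
    (hZ : ∀ x, Z.V x → ¬ N x) (hP : Pr ((GA.tens GB).par Z))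
    (tau : Tau m GA GB Y N) : Pr (Y.par Z) := by
  obtain ⟨t, ht⟩ := hne
  have a1 := GA.supp; have a2 := GA.supp2; have b1 := GB.supp; have b2 := GB.supp2
  have c1 := Y.supp; have c2 := Y.supp2; have d1 := Z.supp; have d2 := Z.supp2
  have z1 := GA.irr; have z2 := GB.irr; have z3 := Y.irr; have z4 := Z.irr
  have := hS _ hP GA.V GB.V (fun x => GA.V x ∨ GB.V x) Y N t
    ⟨?_, fun _ => Iff.rfl, hAB, ⟨?_, ?_⟩, ht, ?_, Yne, ?_, ?_, hY, ?_⟩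
  · refine this.congr ?_ ?_ <;> simp only [CG.par, CG.tens, sub] <;> grind
  · rw [sz_par, sz_tens _ _ hAB]
    · exact hsz
    · simp only [CG.tens]; grind
  · simp only [CG.par, CG.tens]; grind
  · intro v x y; simp only [CG.par, CG.tens]; grind
  · intro x y; simp only [CG.par, CG.tens]; grind
  · simp only [CG.par, CG.tens]; grind
  · grind
  · have e1 : ((GA.tens GB).par Z).res GA.V = GA := by
      apply ext' <;> simp only [CG.par, CG.tens, res] <;> grind
    have e2 : ((GA.tens GB).par Z).res GB.V = GB := by
      apply ext' <;> simp only [CG.par, CG.tens, res] <;> grind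
    rw [e1, e2]; exact tau

theorem combine {m : ℕ} (ih : ∀ k < m, St k) {A1 A2 B1 B2 X3 Y K M : CG} {N : Pt → Prop}
    (tau : Tau m (A1.tens A2) (B1.tens B2) Y N)
    (hsz : A1.sz + A2.sz + B1.sz + B2.sz + X3.sz + K.sz + M.sz ≤ m)
    (n1 : ∀ x, A1.V x → N x) (n2 : ∀ x, A2.V x → N x) (n3 : ∀ x, B1.V x → N x)
    (n4 : ∀ x, B2.V x → N x) (n5 : ∀ x, Y.V x → N x)
    (m1 : ∀ x, X3.V x → ¬ N x) (m2 : ∀ x, K.V x → ¬ N x ∧ ¬ X3.V x)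
    (m3 : ∀ x, M.V x → ¬ N x ∧ ¬ X3.V x ∧ ¬ K.V x)
    (d1 : ∀ x, A1.V x → ¬ A2.V x ∧ ¬ B1.V x ∧ ¬ B2.V x)
    (d2 : ∀ x, A2.V x → ¬ B1.V x ∧ ¬ B2.V x) (d3 : ∀ x, B1.V x → ¬ B2.V x)
    (ne1 : ∃ x, A1.V x ∨ B1.V x) (ne2 : ∃ x, A2.V x ∨ B2.V x) (Yne : ∃ x, Y.V x)
    (hK : Pr ((A2.tens B2).par K)) (hM : Pr (((A1.tens B1).tens X3).par M)) :
    Pr ((Y.tens X3).par (K.par M)) := by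
  have p1 : 0 < A1.sz + B1.sz := by
    obtain ⟨x, h | h⟩ := ne1
    · have := sz_pos ⟨x, h⟩; omega
    · have := sz_pos ⟨x, h⟩; omega
  have p2 : 0 < A2.sz + B2.sz := by
    obtain ⟨x, h | h⟩ := ne2
    · have := sz_pos ⟨x, h⟩; omega
    · have := sz_pos ⟨x, h⟩; omega
  obtain ⟨y0, hy0⟩ := Yne
  have e1 : (A1.tens B1).sz = A1.sz + B1.sz := sz_tens _ _ (by grind)
  have e2 : (A1.tens A2).sz = A1.sz + A2.sz := sz_tens _ _ (by grind)
  have e3 : (B1.tens B2).sz = B1.sz + B2.sz := sz_tens _ _ (by grind)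
  have goal1 : Pr (((Y.tens X3).par M).par K) := by
    refine TS (ih (A2.sz + B2.sz + K.sz) (by omega)) (N := fun x => N x ∨ X3.V x ∨ M.V x)
      le_rfl (by grind) ne2 ⟨y0, Or.inl (Or.inl hy0)⟩ (by grind) (by grind)
      (by simp only [CG.par, CG.tens]; grind) (by grind) hK ?_
    intro KA2 KB2 k1 k2 k3 ks kA2 kB2
    have goal2 : Pr (((Y.tens X3).par (KA2.par KB2)).par M) := by
      refine TS (ih (A1.sz + B1.sz + X3.sz + M.sz) (by omega))
        (N := fun x => N x ∨ X3.V x ∨ KA2.V x ∨ KB2.V x)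
        (by omega) (by simp only [CG.tens]; grind) ?_ ⟨y0, Or.inl (Or.inl hy0)⟩
        (by simp only [CG.tens]; grind) (by grind)
        (by simp only [CG.par, CG.tens]; grind) (by grind) hM ?_
      · obtain ⟨x, h⟩ := ne1; exact ⟨x, Or.inl h⟩
      intro K1 K3 q1 q2 q3 qs qK1 qK3
      have goal3 : Pr ((((Y.tens X3).par (KA2.par KB2)).par K3).par K1) := by
        refine TS (ih (A1.sz + B1.sz + K1.sz) (by omega))
          (N := fun x => N x ∨ X3.V x ∨ KA2.V x ∨ KB2.V x ∨ K3.V x)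
          le_rfl (by grind) ne1 ⟨y0, Or.inl (Or.inl (Or.inl hy0))⟩
          (by grind) (by grind)
          (by simp only [CG.par, CG.tens]; grind) (by grind) qK1 ?_
        intro KA1 KB1 r1 r2 r3 rs rA1 rB1
        have s1 : (KA1.par KA2).sz = KA1.sz + KA2.sz := sz_par _ _ (by grind)
        have s2 : (KB1.par KB2).sz = KB1.sz + KB2.sz := sz_par _ _ (by grind)
        have u1 := Pr.tp (by grind) (by grind) (by grind) rA1 kA2
        have u2 := Pr.tp (by grind) (by grind) (by grind) rB1 kB2
        have u3 := tau (KA1.par KA2) (KB1.par KB2) (by simp only [CG.par]; grind)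
          (by simp only [CG.par]; grind) (by simp only [CG.par]; grind) (by omega) u1 u2
        have u4 := Pr.tp (by simp only [CG.par]; grind) (by simp only [CG.par]; grind)
          (by simp only [CG.par]; grind) u3 qK3
        refine u4.congr ?_ ?_ <;> simp only [CG.par, CG.tens] <;> grind
      refine goal3.congr ?_ ?_ <;> simp only [CG.par, CG.tens] <;> grind
    refine goal2.congr ?_ ?_ <;> simp only [CG.par, CG.tens] <;> grind
  refine goal1.congr ?_ ?_ <;> simp only [CG.par, CG.tens] <;> grind

end GSP

set_option linter.unusedVariables false
set_option maxHeartbeats 4000000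
namespace GSP
open CG

theorem Cfg.triv {m H A B T Y N t} (h : Cfg m H A B T Y N t) (hP : Pr H) (hB : ∀ x, ¬ B x)
    (hno : ∀ x y, T x → ¬ T y → ¬ H.E x y) : Pr (H.sub T t Y) := by
  obtain ⟨hm, hT, dis, ⟨mod1, mod2⟩, ht, AB, Yne, hN, TN, YN, tau⟩ := h
  have a1 := H.supp; have a2 := H.supp2; have a3 := H.symm
  have y1 := Y.supp; have y2 := Y.supp2; have y3 := Y.irr; have y4 := H.irr
  have := tau (H.res fun x => ¬ T x) nil (by simp only [res]; grind) (by simp only [nil]; grind)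
    (by simp only [nil]; grind) ?_ ?_ ?_
  · refine this.congr ?_ ?_ <;> simp only [CG.par, sub, res, nil] <;> grind
  · have e1 : (H.res B).sz = nil.sz := sz_congr (by simp only [res, nil]; grind)
    have e2 : (H.res A).sz = (H.res T).sz := sz_congr (by simp only [res]; grind)
    rw [e1, sz_nil, e2]
    have := sz_split (H := H) T
    omega
  · refine hP.congr ?_ ?_ <;> simp only [CG.par, res] <;> grind
  · refine Pr.empty _ ?_; simp only [CG.par, res, nil]; grind

theorem Cfg.triv' {m H A B T Y N t} (h : Cfg m H A B T Y N t) (hP : Pr H)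
    (hB : (∀ x, ¬ A x) ∨ (∀ x, ¬ B x))
    (hno : ∀ x y, T x → ¬ T y → ¬ H.E x y) : Pr (H.sub T t Y) := by
  rcases hB with hA | hB
  · exact h.swap.triv hP hA hno
  · exact h.triv hP hB hno

theorem Cfg.enlarge {m H A B T Y N t} (h : Cfg m H A B T Y N t) (hB : ∀ x, ¬ B x)
    (Z : Pt → Prop) (hZT : ∀ x, Z x → ¬ T x)
    (hmod : H.Mod fun x => T x ∨ Z x)
    (hno : ∀ x y, T x → Z y → ¬ H.E x y) :
    Cfg m H (fun x => A x ∨ Z x) B (fun x => T x ∨ Z x) (Y.par (H.res Z)) (fun x => N x ∨ Z x) t ∧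
    H.sub (fun x => T x ∨ Z x) t (Y.par (H.res Z)) = H.sub T t Y := by
  obtain ⟨hm, hT, dis, ⟨mod1, mod2⟩, ht, AB, ⟨y0, hy0⟩, hN, TN, YN, tau⟩ := h
  have a1 := H.supp; have a2 := H.supp2; have a3 := H.symm
  have y1 := Y.supp; have y2 := Y.supp2; have y3 := Y.irr; have y4 := H.irr
  obtain ⟨mo1, mo2⟩ := hmod
  constructor
  · refine ⟨hm, by grind, by grind, ⟨mo1, mo2⟩, by grind, by grind, ⟨y0, Or.inl hy0⟩, by grind,
      by grind, by simp only [CG.par, res]; grind, ?_⟩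
    intro KA KB k1 k2 k3 ks kA kB
    have e1 : (H.res fun x => A x ∨ Z x) = (H.res A).par (H.res Z) := by
      apply ext' <;> simp only [CG.par, res] <;> grind
    have e2 := sz_par (H.res A) (H.res Z) (by simp only [res]; grind)
    have e3 := sz_par (H.res Z) KA (by simp only [res]; grind)
    rw [e1] at ks kA
    have := tau ((H.res Z).par KA) KB (by simp only [CG.par, res]; grind) (by grind)
      (by simp only [CG.par, res]; grind) (by omega) (by rwa [← par_assoc]) kB
    rwa [par_assoc] at this ⊢
  · apply ext' <;> simp only [CG.par, res, sub]
    · grind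
    · intro x y
      by_cases h1 : x = y
      · grind
      · grind

/-- uniform position of `T` with respect to an `s` step -/
theorem Cfg.s_unif {m H A B T Y N t} (h : Cfg m H A B T Y N t) {H' : CG} {X W D : Pt → Prop}
    (s1 : H'.Mod D) (s2 : H'.Mod (fun x => X x ∨ W x))
    (s3 : ∀ x, X x → ¬ W x) (s4 : ∀ x, X x → D x) (s5 : ∀ x, W x → D x)
    (s6 : ∃ x, X x) (s8 : ∀ x y, X x → W y → ¬ H'.E x y)
    (s9 : ∀ x, H.V x ↔ H'.V x)
    (s10 : ∀ x y, H.E x y ↔ H'.E x y ∧ ¬ (W x ∧ D y ∧ ¬ X y ∧ ¬ W y) ∧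
        ¬ (W y ∧ D x ∧ ¬ X x ∧ ¬ W x))
    (ih : StH m H')
    (u1 : ∀ x, T x → (X x ↔ X t)) (u2 : ∀ x, T x → (W x ↔ W t)) (u3 : ∀ x, T x → (D x ↔ D t)) :
    Pr (H.sub T t Y) := by
  have key : Pr (H'.sub T t Y) := by
    obtain ⟨hm, hT, dis, ⟨mod1, mod2⟩, ht, AB, ⟨y0, hy0⟩, hN, TN, YN, tau⟩ := h
    have a1 := H'.supp; have a2 := H'.supp2; have a3 := H'.symm
    obtain ⟨s11, s12⟩ := s1; obtain ⟨s21, s22⟩ := s2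
    refine ih A B T Y N t ⟨?_, hT, dis, ⟨?_, ?_⟩, ht, ?_, ⟨y0, hy0⟩, ?_, TN, YN, ?_⟩
    · rwa [← sz_congr s9]
    · grind
    · intro v x y; have := mod2 v x y; have := mod2 v y x; grind
    · grind
    · grind
    · have e1 : H'.res A = H.res A := by apply ext' <;> simp only [res] <;> grind
      have e2 : H'.res B = H.res B := by apply ext' <;> simp only [res] <;> grind
      rwa [e1, e2]
  obtain ⟨hm, hT, dis, ⟨mod1, mod2⟩, ht, AB, ⟨y0, hy0⟩, hN, TN, YN, tau⟩ := h
  have a1 := H'.supp; have a2 := H'.supp2; have a3 := H'.symm; have a4 := H'.irr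
  have y1 := Y.supp; have y2 := Y.supp2; have y3 := Y.irr; have y4 := Y.symm
  obtain ⟨s11, s12⟩ := s1; obtain ⟨s21, s22⟩ := s2
  obtain ⟨x0, hx0⟩ := s6
  have f : ∀ x, (H'.V x ∧ ¬ T x) → ¬ Y.V x := by grind
  have g : ∀ x, T x → H'.V x := by grind
  clear hN TN YN tau hm AB mod1 mod2 hT dis ih
  refine key.s' (fun x => (X x ∧ ¬ T x) ∨ (Y.V x ∧ X t)) (fun x => (W x ∧ ¬ T x) ∨ (Y.V x ∧ W t))
    (fun x => (D x ∧ ¬ T x) ∨ (Y.V x ∧ D t)) ⟨?_, ?_⟩ ⟨?_, ?_⟩ ?_ ?_ ?_ ?_ ?_ ?_ ?_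
  · simp only [sub]; grind
  · intro v x y; simp only [sub]
    by_cases hv : Y.V v <;> by_cases hx : Y.V x <;> by_cases hy : Y.V y <;> grind
  · simp only [sub]; grind
  · intro v x y; simp only [sub]
    by_cases hv : Y.V v <;> by_cases hx : Y.V x <;> by_cases hy : Y.V y <;> grind
  · grind
  · grind
  · grind
  · by_cases hX : X t
    · exact ⟨y0, Or.inr ⟨hy0, hX⟩⟩
    · refine ⟨x0, Or.inl ⟨hx0, ?_⟩⟩; grind
  · intro x y; simp only [sub]
    by_cases hx : Y.V x <;> by_cases hy : Y.V y <;> grind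
  · simp only [sub]; grind
  · intro x y; simp only [sub]
    by_cases hx : Y.V x <;> by_cases hy : Y.V y <;> grind

end GSP

set_option linter.unusedVariables false
set_option maxHeartbeats 4000000
namespace GSP
open CG

structure SStep (H H' : CG) (X W D : Pt → Prop) : Prop where
  s1 : H'.Mod D
  s2 : H'.Mod (fun x => X x ∨ W x)
  s3 : ∀ x, X x → ¬ W x
  s4 : ∀ x, X x → D x
  s5 : ∀ x, W x → D x
  s6 : ∃ x, X x
  s7 : ∃ x, W x
  s8 : ∀ x y, X x → W y → ¬ H'.E x y
  s9 : ∀ x, H.V x ↔ H'.V x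
  s10 : ∀ x y, H.E x y ↔ H'.E x y ∧ ¬ (W x ∧ D y ∧ ¬ X y ∧ ¬ W y) ∧
        ¬ (W y ∧ D x ∧ ¬ X x ∧ ¬ W x)

theorem disc {H : CG} {A B T S : Pt → Prop} (hT : ∀ x, T x ↔ A x ∨ B x)
    (AB : ∀ x y, A x → B y → H.E x y) {p r : Pt} (hp : T p) (hr : T r) (sp : S p) (sr : ¬ S r)
    (no : ∀ x y, T x → T y → S x → ¬ S y → ¬ H.E x y) : (∀ x, ¬ A x) ∨ (∀ x, ¬ B x) := by
  by_contra hc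
  push Not at hc
  obtain ⟨⟨a, ha⟩, ⟨b, hb⟩⟩ := hc
  have same : ∀ x y, A x → B y → (S x ↔ S y) := by
    intro x y hx hy
    have e := AB x y hx hy
    have e' := H.symm _ _ e
    have := no x y ((hT x).2 (Or.inl hx)) ((hT y).2 (Or.inr hy))
    have := no y x ((hT y).2 (Or.inr hy)) ((hT x).2 (Or.inl hx))
    tauto
  have := same a b ha hb
  have := same p b; have := same r b; have := same a p ha; have := same a r ha
  have := (hT p).1 hp; have := (hT r).1 hr
  tauto

/-- `D` inside `A` -/
theorem Cfg.s_in {m H A B T Y N t} (h : Cfg m H A B T Y N t) {H' : CG} {X W D : Pt → Prop}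
    (s : SStep H H' X W D) (ih : StH m H') (u : ∀ x, D x → A x) : Pr (H.sub T t Y) := by
  obtain ⟨⟨s11, s12⟩, ⟨s21, s22⟩, s3, s4, s5, s6, s7, s8, s9, s10⟩ := s
  obtain ⟨hm, hT, dis, ⟨mod1, mod2⟩, ht, AB, ⟨y0, hy0⟩, hN, TN, YN, tau⟩ := h
  have a1 := H'.supp; have a2 := H'.supp2; have a3 := H'.symm; have a4 := H'.irr
  have key : Pr (H'.sub T t Y) := by
    refine ih A B T Y N t ⟨?_, hT, dis, ⟨?_, ?_⟩, ht, ?_, ⟨y0, hy0⟩, ?_, TN, YN, ?_⟩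
    · rwa [← sz_congr s9]
    · grind
    · intro v x y; have := mod2 v x y; grind
    · grind
    · grind
    · intro KA KB k1 k2 k3 ks kA kB
      have e1 : (H'.res A).sz = (H.res A).sz := by apply sz_congr; simp only [res]; grind
      have e2 : H'.res B = H.res B := by apply ext' <;> simp only [res] <;> grind
      rw [e2] at ks kB
      refine tau KA KB k1 k2 k3 (by omega) ?_ kB
      have c1 := KA.supp; have c2 := KA.supp2
      have kk : ∀ x, KA.V x → ¬ A x := by grind
      refine kA.s' X W D ⟨?_, ?_⟩ ⟨?_, ?_⟩ s3 s4 s5 s6 ?_ ?_ ?_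
      · simp only [CG.par, res]; grind
      · intro v x y; simp only [CG.par, res]; grind
      · simp only [CG.par, res]; grind
      · intro v x y; simp only [CG.par, res]; grind
      · intro x y; simp only [CG.par, res]; grind
      · simp only [CG.par, res]; grind
      · intro x y; simp only [CG.par, res]; grind
  refine key.congr ?_ ?_ <;> simp only [sub] <;> grind

theorem Cfg.s_sup {m H A B T Y N t} (h : Cfg m H A B T Y N t) {H' : CG} {X W D : Pt → Prop}
    (s : SStep H H' X W D) (ih : StH m H') (u : ∀ x, D x → T x) : Pr (H.sub T t Y) := by
  have hh : (∀ x, D x → A x) ∨ (∀ x, D x → B x) := by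
    obtain ⟨⟨s11, s12⟩, ⟨s21, s22⟩, s3, s4, s5, ⟨x0, hx0⟩, ⟨w0, hw0⟩, s8, s9, s10⟩ := s
    obtain ⟨hm, hT, dis, ⟨mod1, mod2⟩, ht, AB, ⟨y0, hy0⟩, hN, TN, YN, tau⟩ := h
    have a3 := H'.symm
    have no : ∀ x y, W x → D y → ¬ W y → ¬ H.E x y ∧ ¬ H.E y x := by grind
    have a3 := H.symm
    clear s10 s8 tau
    by_cases hw : A w0 <;> grind
  rcases hh with hA | hB
  · exact h.s_in s ih hA
  · exact h.swap.s_in s ih hB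

theorem Cfg.s_over {m H A B T Y N t} (h : Cfg m H A B T Y N t) {H' : CG} {X W D : Pt → Prop}
    (s : SStep H H' X W D) (ih : StH m H')
    (o1 : ∃ x, T x ∧ D x)
    (o3 : (∃ x, T x ∧ ¬ D x) ∨ ((∃ x, T x ∧ W x) ∧ (∃ x, T x ∧ D x ∧ ¬ W x))) :
    Pr (H.sub T t Y) := by
  by_cases o2 : ∃ x, D x ∧ ¬ T x
  case neg => exact h.s_sup s ih (by grind)
  have hh : ((∀ x, ¬ A x) ∨ (∀ x, ¬ B x)) ∧ (∀ x y, T x → D y → ¬ T y → ¬ H.E x y) ∧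
      H.Mod (fun x => T x ∨ (D x ∧ ¬ T x)) := by
    obtain ⟨⟨s11, s12⟩, ⟨s21, s22⟩, s3, s4, s5, ⟨x0, hx0⟩, ⟨w0, hw0⟩, s8, s9, s10⟩ := s
    obtain ⟨hm, hT, dis, ⟨mod1, mod2⟩, ht, AB, ⟨y0, hy0⟩, hN, TN, YN, tau⟩ := h
    have a3 := H'.symm
    have no : ∀ x y, W x → D y → ¬ W y → ¬ H.E x y ∧ ¬ H.E y x := by grind
    have D1 : ∀ x, D x → H.V x := by grind
    have D2 : ∀ v x y, H.V v → ¬ D v → D x → D y → H.E v x → H.E v y := by grind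
    have b3 := H.symm
    clear s10 s8 tau ih s21 s22 a3 s9 hN s11 s12
    obtain ⟨p, hp⟩ := o1
    obtain ⟨q, hq⟩ := o2
    have nx : ¬ W x0 := s3 _ hx0
    have no1 : ∀ x y, T x → D y → ¬ T y → ¬ H.E x y := by
      rcases o3 with ⟨r, hr⟩ | ⟨⟨r1, h1⟩, ⟨r2, h2⟩⟩
      · by_contra hc
        push Not at hc
        obtain ⟨x, y, hx, hy, hy2, he⟩ := hc
        have j1 : ∀ x, T x → H.E x y := by grind
        have j2 : ∀ x z, T x → ¬ D x → D z → H.E x z := fun x z h1 h2 h3 =>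
          D2 x y z (mod1 x h1) h2 hy h3 (j1 x h1)
        have j3 : ∀ x z, T x → D z → ¬ T z → H.E x z := fun x z h1 h2 h3 =>
          b3 _ _ (mod2 z r x (D1 z h2) h3 hr.1 h1 (b3 _ _ (j2 r z hr.1 hr.2 h2)))
        have j4 : ∀ x z, T x → D x → D z → ¬ T z → (W x ↔ W z) := by
          intro x z h1 h2 h3 h4
          have e := j3 x z h1 h3 h4
          have := no x z; have := no z x
          tauto
        have := j4 p q; have := j4 x0 q; have := j4 w0 q
        have := j4 p x0; have := j4 p w0
        have := s4 _ hx0; have := s5 _ hw0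
        clear j1 j2 j3 no mod2 D2 AB
        tauto
      · intro x y hx hy hy2 he
        by_cases hw : W y <;> grind
    refine ⟨?_, no1, ?_, ?_⟩
    · by_cases o4 : ∃ r, T r ∧ ¬ D r
      · obtain ⟨r, hr⟩ := o4
        have no2 : ∀ x y, T x → D x → T y → ¬ D y → ¬ H.E x y := by
          intro x y hx hx2 hy hy2 he
          have := no1 y q hy hq.1 hq.2
          have := D2 y x q (by grind) hy2 hx2 hq.1 (b3 _ _ he)
          grind
        exact disc (S := D) hT AB hp.1 hr.1 hp.2 hr.2 (by grind)
      · obtain ⟨⟨r1, h1⟩, ⟨r2, h2⟩⟩ := o3.resolve_left o4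
        exact disc (S := W) hT AB h1.1 h2.1 h1.2 h2.2.2 (by
          intro x y hx hy h3 h4
          exact (no x y h3 (by grind) h4).1)
    · grind
    · intro v x y hv hv2 hx hy he
      have : H.E v p := by grind
      grind
  obtain ⟨hAB, hno, hmod⟩ := hh
  rcases hAB with hA | hB
  · obtain ⟨c, e⟩ := h.swap.enlarge hA (fun x => D x ∧ ¬ T x) (by grind) hmod (by grind)
    rw [← e]
    exact c.s_sup s ih (by grind)
  · obtain ⟨c, e⟩ := h.enlarge hB (fun x => D x ∧ ¬ T x) (by grind) hmod (by grind)
    rw [← e]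
    exact c.s_sup s ih (by grind)

end GSP

set_option linter.unusedVariables false
set_option maxHeartbeats 4000000
namespace GSP
open CG

theorem Cfg.s_a {m H A B T Y N t} (h : Cfg m H A B T Y N t) {H' : CG} {X W D : Pt → Prop}
    (s : SStep H H' X W D) (ih : StH m H') (u : ∀ x, T x → D x ∧ ¬ W x) (v : ∀ x, X x → A x) :
    Pr (H.sub T t Y) := by
  obtain ⟨⟨s11, s12⟩, ⟨s21, s22⟩, s3, s4, s5, s6, s7, s8, s9, s10⟩ := s
  obtain ⟨hm, hT, dis, ⟨mod1, mod2⟩, ht, AB, ⟨y0, hy0⟩, hN, TN, YN, tau⟩ := h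
  have a1 := H'.supp; have a2 := H'.supp2; have a3 := H'.symm; have a4 := H'.irr
  have y1 := Y.supp; have y2 := Y.supp2; have y3 := Y.irr; have y4 := Y.symm
  have b3 := H.symm
  obtain ⟨x0, hx0⟩ := s6
  have key : Pr (H'.sub (fun x => T x ∨ W x) t (Y.par (H.res W))) := by
    refine ih (fun x => A x ∨ W x) B _ _ (fun x => N x ∨ W x) t
      ⟨?_, by grind, ?_, ⟨?_, ?_⟩, Or.inl ht, ?_, ⟨y0, Or.inl hy0⟩, ?_, ?_, ?_, ?_⟩
    · rwa [← sz_congr s9]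
    · grind
    · grind
    · intro v x y hv hv2 hx hy he
      by_cases hd : D v
      · have q : ∀ z, T z → (H'.E v z ↔ H'.E v x0) := by
          intro z hz
          have := mod2 v z x0; have := mod2 v x0 z
          grind
        have q2 : ∀ z, W z → (H'.E v z ↔ H'.E v x0) := by
          intro z hz
          have := s22 v z x0; have := s22 v x0 z
          grind
        grind
      · have := s12 v x y; grind
    · intro x y hx hy
      have e := AB x0 y (v _ hx0) hy
      by_cases hw : W x
      · have := s22 y x0 x
        grind
      · have := AB x y; grind
    · grind
    · grind
    · simp only [CG.par, res]; grind
    · intro KA KB k1 k2 k3 ks kA kB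
      have e2 : H'.res B = H.res B := by apply ext' <;> simp only [res] <;> grind
      have e3 : (H'.res fun x => A x ∨ W x).sz = ((H.res A).par (H.res W)).sz := by
        apply sz_congr; simp only [CG.par, res]; grind
      have e4 := sz_par (H.res A) (H.res W) (by simp only [res]; grind)
      have e5 := sz_par (H.res W) KA (by simp only [res]; grind)
      rw [e2] at ks kB
      have c1 := KA.supp; have c2 := KA.supp2
      have kk : ∀ x, KA.V x → ¬ A x ∧ ¬ W x := by grind
      have := tau ((H.res W).par KA) KB (by simp only [CG.par, res]; grind) (by grind)
        (by simp only [CG.par, res]; grind) (by omega) ?_ kB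
      · rwa [par_assoc] at this ⊢
      refine kA.s' X W (fun x => A x ∨ W x) ⟨?_, ?_⟩ ⟨?_, ?_⟩ s3 (by grind) (by grind) ⟨x0, hx0⟩ ?_ ?_ ?_
      · simp only [CG.par, res]; grind
      · intro v x y; simp only [CG.par, res]; grind
      · simp only [CG.par, res]; grind
      · intro v x y; simp only [CG.par, res]; grind
      · intro x y; simp only [CG.par, res]; grind
      · simp only [CG.par, res]; grind
      · intro x y; simp only [CG.par, res]; grind
  have f : ∀ x, (H'.V x ∧ ¬ T x) → ¬ Y.V x := by grind
  have g : ∀ x, T x → H'.V x := by grind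
  have td := u t ht
  have tw : ∀ z, W z → ¬ H.E t z := by grind
  have tw2 : ∀ z, D z → ¬ T z → ¬ W z → (H'.E t z ↔ H'.E x0 z) := by
    intro z h1 h2 h3
    have := mod2 z t x0; have := mod2 z x0 t; grind
  have q2 : ∀ z v, W z → D v → ¬ X v → ¬ W v → (H'.E v z ↔ H'.E v x0) := by
    intro z v hz
    have := s22 v z x0; have := s22 v x0 z
    grind
  have q3 : ∀ z v, ¬ D v → D z → (H'.E t v ↔ H'.E z v) := by
    intro z v hz
    have := s12 v z t; have := s12 v t z
    grind
  have vx : ∀ x, X x → T x := by grind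
  clear hN TN YN tau hm AB hT dis ih
  refine key.s' Y.V W (fun x => (D x ∧ ¬ T x) ∨ Y.V x) ⟨?_, ?_⟩ ⟨?_, ?_⟩ ?_ ?_ ?_ ⟨y0, hy0⟩ ?_ ?_ ?_
  · simp only [CG.par, res, sub]; grind
  · intro v x y; simp only [sub, CG.par, res]
    by_cases hv : Y.V v <;> by_cases hx : Y.V x <;> by_cases hy : Y.V y <;> grind
  · simp only [sub, CG.par, res]; grind
  · intro v x y; simp only [sub, CG.par, res]
    by_cases hv : Y.V v <;> by_cases hx : Y.V x <;> by_cases hy : Y.V y <;> grind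
  · grind
  · grind
  · grind
  · intro x y; simp only [sub, CG.par, res]
    grind
  · simp only [sub, CG.par, res]; grind
  · intro x y; simp only [sub, CG.par, res]
    by_cases hx : Y.V x <;> by_cases hy : Y.V y <;> by_cases hx2 : W x <;> by_cases hy2 : W y <;> grind

theorem Cfg.s_b {m H A B T Y N t} (h : Cfg m H A B T Y N t) {H' : CG} {X W D : Pt → Prop}
    (s : SStep H H' X W D) (ih : StH m H') (u : ∀ x, T x → D x ∧ ¬ W x)
    (v : ∃ x, X x ∧ ¬ T x) (w : ∀ x y, X x → ¬ T x → T y → ¬ H.E x y) :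
    Pr (H.sub T t Y) := by
  obtain ⟨⟨s11, s12⟩, ⟨s21, s22⟩, s3, s4, s5, s6, s7, s8, s9, s10⟩ := s
  obtain ⟨hm, hT, dis, ⟨mod1, mod2⟩, ht, AB, ⟨y0, hy0⟩, hN, TN, YN, tau⟩ := h
  have a1 := H'.supp; have a2 := H'.supp2; have a3 := H'.symm; have a4 := H'.irr
  have y1 := Y.supp; have y2 := Y.supp2; have y3 := Y.irr; have y4 := Y.symm
  obtain ⟨x0, hx0, hx1⟩ := v
  have w1 : ∀ x y, X x → ¬ T x → T y → ¬ H'.E x y := by grind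
  have w2 : ∀ x y, W x → T y → ¬ H'.E x y := by
    intro x y hx hy he
    have := s22 y x x0
    have := w1 x0 y
    grind
  have key : Pr (H'.sub T t Y) := by
    refine ih A B T Y N t ⟨?_, hT, dis, ⟨?_, ?_⟩, ht, ?_, ⟨y0, hy0⟩, ?_, TN, YN, ?_⟩
    · rwa [← sz_congr s9]
    · grind
    · intro v x y; have := mod2 v x y; grind
    · grind
    · grind
    · have e1 : H'.res A = H.res A := by apply ext' <;> simp only [res] <;> grind
      have e2 : H'.res B = H.res B := by apply ext' <;> simp only [res] <;> grind
      rwa [e1, e2]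
  have f : ∀ x, (H'.V x ∧ ¬ T x) → ¬ Y.V x := by grind
  have g : ∀ x, T x → H'.V x := by grind
  have td := u t ht
  have tw : ∀ z, W z → ¬ H'.E t z ∧ ¬ H'.E z t := by grind
  have tw1 : ∀ z, X z → ¬ T z → ¬ H'.E t z ∧ ¬ H'.E z t := by grind
  clear hN TN YN tau hm AB hT dis ih w w1 w2
  refine key.s' (fun x => X x ∧ ¬ T x) W (fun x => (D x ∧ ¬ T x) ∨ Y.V x) ⟨?_, ?_⟩ ⟨?_, ?_⟩
    ?_ ?_ ?_ ⟨x0, hx0, hx1⟩ ?_ ?_ ?_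
  · simp only [sub]; grind
  · intro v x y; simp only [sub]
    have q3 : ∀ z v, ¬ D v → D z → (H'.E t v ↔ H'.E z v) := by
      intro z v hz
      have := s12 v z t; have := s12 v t z
      grind
    by_cases hv : Y.V v <;> by_cases hx : Y.V x <;> by_cases hy : Y.V y <;> grind
  · simp only [sub]; grind
  · intro v x y; simp only [sub]
    by_cases hv : Y.V v <;> grind
  · grind
  · grind
  · grind
  · intro x y; simp only [sub]
    grind
  · simp only [sub]; grind
  · intro x y; simp only [sub]
    by_cases hx : Y.V x <;> by_cases hy : Y.V y <;> grind

end GSP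

set_option linter.unusedVariables false
set_option maxHeartbeats 4000000
namespace GSP
open CG

theorem Cfg.s_c {m H A B T Y N t} (h : Cfg m H A B T Y N t) {H' : CG} {X W D : Pt → Prop}
    (s : SStep H H' X W D) (ih : StH m H') (ihm : ∀ k < m, St k) (u : ∀ x, T x → D x ∧ ¬ W x)
    (v1 : ∃ x, X x ∧ T x) (v2 : ∃ x, T x ∧ ¬ X x)
    (w1 : ∀ x y, X x → T y → ¬ X y → H.E x y)
    (w2 : ∀ x y, X x → ¬ T x → X y → T y → H.E x y) :
    Pr (H.sub T t Y) := by
  obtain ⟨⟨s11, s12⟩, ⟨s21, s22⟩, s3, s4, s5, s6, s7, s8, s9, s10⟩ := s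
  obtain ⟨hm, hT, dis, ⟨mod1, mod2⟩, ht, AB, ⟨y0, hy0⟩, hN, TN, YN, tau⟩ := h
  have a1 := H'.supp; have a2 := H'.supp2; have a3 := H'.symm; have a4 := H'.irr
  have y1 := Y.supp; have y2 := Y.supp2; have y3 := Y.irr; have y4 := Y.symm
  have b3 := H.symm; have b4 := H.irr
  obtain ⟨x0, hx0, hx1⟩ := v1
  obtain ⟨z0, hz0, hz1⟩ := v2
  have w3 : ∀ x y, W x → T y → ¬ X y → H'.E x y := by
    intro x y hx hy hy2
    have := s22 y x0 x
    have := w1 x0 y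
    grind
  have key : Pr (H'.sub (fun x => T x ∨ X x ∨ W x) t
      ((Y.tens (H.res fun x => X x ∧ ¬ T x)).par (H.res W))) := by
    refine ih (fun x => T x ∧ ¬ X x) (fun x => X x ∨ W x) _ _
      (fun x => N x ∨ (X x ∧ ¬ T x) ∨ W x) t
      ⟨?_, by grind, ?_, ⟨?_, ?_⟩, Or.inl ht, ?_, ⟨y0, Or.inl (Or.inl hy0)⟩, ?_, ?_, ?_, ?_⟩
    · rwa [← sz_congr s9]
    · grind
    · grind
    · intro v x y hv hv2 hx hy he
      by_cases hd : D v
      · have q : ∀ z, T z → (H'.E v z ↔ H'.E v x0) := by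
          intro z hz
          have := mod2 v z x0; have := mod2 v x0 z
          grind
        have q2 : ∀ z, X z ∨ W z → (H'.E v z ↔ H'.E v x0) := by
          intro z hz
          have := s22 v z x0; have := s22 v x0 z
          grind
        grind
      · have := s12 v x y; grind
    · intro x y; have := w1 y x; have := w3 y x; grind
    · grind
    · grind
    · simp only [CG.par, CG.tens, res]; grind
    · intro K L k1 k2 k3 ks kK kL
      have e1 : H'.res (fun x => T x ∧ ¬ X x) =
          (H.res fun x => A x ∧ ¬ X x).tens (H.res fun x => B x ∧ ¬ X x) := by
        apply ext' <;> simp only [res, CG.tens] <;> grind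
      have e2 : H'.res (fun x => X x ∨ W x) =
          (((H.res fun x => A x ∧ X x).tens (H.res fun x => B x ∧ X x)).tens
            (H.res fun x => X x ∧ ¬ T x)).par (H.res W) := by
        apply ext' <;> simp only [res, CG.tens, CG.par] <;> grind
      have f1 : H.res A = (H.res fun x => A x ∧ X x).tens (H.res fun x => A x ∧ ¬ X x) := by
        apply ext' <;> simp only [res, CG.tens] <;> grind
      have f2 : H.res B = (H.res fun x => B x ∧ X x).tens (H.res fun x => B x ∧ ¬ X x) := by
        apply ext' <;> simp only [res, CG.tens] <;> grind
      rw [f1, f2] at tau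
      rw [e1] at ks kK
      rw [e2] at ks kL
      rw [sz_tens _ _ (by simp only [res]; grind), sz_par _ _ (by simp only [res, CG.tens]; grind),
        sz_tens _ _ (by simp only [res, CG.tens]; grind), sz_tens _ _ (by simp only [res]; grind)] at ks
      have g1 := sz_par (H.res W) L (by simp only [res]; grind)
      rw [par_assoc] at kL
      have c1 : ∀ x, K.V x → ¬ W x ∧ ¬ N x ∧ ¬ (X x ∧ ¬ T x) ∧ ¬ L.V x := by grind
      have c2 : ∀ x, L.V x → ¬ W x ∧ ¬ N x ∧ ¬ (X x ∧ ¬ T x) := by grind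
      have c3 : ∀ x, H.V x → X x → ¬ T x → ¬ N x := by grind
      have c4 : ∀ x, H.V x → W x → ¬ N x := by grind
      have c5 : ∀ x, A x → N x := by grind
      have c6 : ∀ x, B x → N x := by grind
      have := combine (K := K) (M := (H.res W).par L) ihm tau (by omega)
        (by simp only [res]; grind) (by simp only [res]; grind) (by simp only [res]; grind)
        (by simp only [res]; grind) YN (X3 := H.res fun x => X x ∧ ¬ T x)
        (by simp only [res]; grind) (by simp only [res]; grind)
        (by simp only [res, CG.par]; grind) (by simp only [res]; grind)
        (by simp only [res]; grind) (by simp only [res]; grind)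
        ⟨x0, by simp only [res]; grind⟩ ⟨z0, by simp only [res]; grind⟩ ⟨y0, hy0⟩ kK kL
      rw [par_left_comm K (H.res W) L] at this
      rwa [par_assoc]
  have f : ∀ x, (H'.V x ∧ ¬ T x) → ¬ Y.V x := by grind
  have g : ∀ x, T x → H'.V x := by grind
  have td := u t ht
  have tw : ∀ z, W z → ¬ H.E t z := by grind
  have tx : ∀ z, X z → ¬ T z → H'.E t z := by grind
  have tw2 : ∀ z, D z → ¬ T z → ¬ W z → (H'.E t z ↔ H'.E x0 z) := by
    intro z h1 h2 h3
    have := mod2 z t x0; have := mod2 z x0 t; grind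
  have q2 : ∀ z v, X z ∨ W z → D v → ¬ X v → ¬ W v → (H'.E v z ↔ H'.E v x0) := by
    intro z v hz
    have := s22 v z x0; have := s22 v x0 z
    grind
  have q3 : ∀ z v, ¬ D v → D z → (H'.E t v ↔ H'.E z v) := by
    intro z v hz
    have := s12 v z t; have := s12 v t z
    grind
  clear hN TN YN tau hm AB hT dis ih w1 w2 w3
  refine key.s' (fun x => Y.V x ∨ (X x ∧ ¬ T x)) W (fun x => (D x ∧ ¬ T x) ∨ Y.V x)
    ⟨?_, ?_⟩ ⟨?_, ?_⟩ ?_ ?_ ?_ ⟨y0, Or.inl hy0⟩ ?_ ?_ ?_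
  · simp only [CG.par, CG.tens, res, sub]; grind
  · intro v x y; simp only [sub, CG.par, CG.tens, res]
    by_cases hv : Y.V v <;> by_cases hx : Y.V x <;> by_cases hy : Y.V y <;> grind
  · simp only [sub, CG.par, CG.tens, res]; grind
  · intro v x y; simp only [sub, CG.par, CG.tens, res]
    by_cases hv : Y.V v <;> by_cases hx : Y.V x <;> by_cases hy : Y.V y <;> grind
  · grind
  · grind
  · grind
  · intro x y; simp only [sub, CG.par, CG.tens, res]
    grind
  · simp only [sub, CG.par, CG.tens, res]; grind
  · intro x y; simp only [sub, CG.par, CG.tens, res]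
    by_cases hx : Y.V x <;> by_cases hy : Y.V y <;> by_cases hx2 : W x <;> by_cases hy2 : W y <;>
      by_cases hx3 : X x <;> by_cases hy3 : X y <;> grind

end GSP

set_option linter.unusedVariables false
set_option maxHeartbeats 4000000
namespace GSP
open CG

theorem overlap {H : CG} {X T : Pt → Prop} (hX : H.Mod X) (hT : H.Mod T)
    (h1 : ∃ x, X x ∧ T x) (h2 : ∃ x, X x ∧ ¬ T x) (h3 : ∃ x, T x ∧ ¬ X x) :
    ((∀ x y, X x → ¬ T x → T y → ¬ H.E x y) ∧ (∀ x y, T x → ¬ X x → X y → ¬ H.E x y)) ∨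
    ((∀ x y, X x → ¬ T x → T y → H.E x y) ∧ (∀ x y, T x → ¬ X x → X y → H.E x y)) := by
  obtain ⟨p, hp⟩ := h1
  obtain ⟨q, hq⟩ := h2
  obtain ⟨r, hr⟩ := h3
  obtain ⟨m1, m2⟩ := hX
  obtain ⟨n1, n2⟩ := hT
  have sy := H.symm
  have e1 : ∀ x y, X x → ¬ T x → T y → (H.E x y ↔ H.E q r) := by
    intro x y hx hx2 hy
    have i1 : H.E x y ↔ H.E x r :=
      ⟨n2 x y r (m1 x hx) hx2 hy hr.1, n2 x r y (m1 x hx) hx2 hr.1 hy⟩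
    have i2 : H.E r x ↔ H.E r q :=
      ⟨m2 r x q (n1 r hr.1) hr.2 hx hq.1, m2 r q x (n1 r hr.1) hr.2 hq.1 hx⟩
    have := sy x r; have := sy r x; have := sy r q; have := sy q r
    tauto
  have e2 : ∀ x y, T x → ¬ X x → X y → (H.E x y ↔ H.E q r) := by
    intro x y hx hx2 hy
    have i1 : H.E x y ↔ H.E x q :=
      ⟨m2 x y q (n1 x hx) hx2 hy hq.1, m2 x q y (n1 x hx) hx2 hq.1 hy⟩
    have := e1 q x hq.1 hq.2 hx
    have := sy x q; have := sy q x
    tauto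
  by_cases he : H.E q r
  · right; exact ⟨fun x y a b c => (e1 x y a b c).2 he, fun x y a b c => (e2 x y a b c).2 he⟩
  · left; exact ⟨fun x y a b c => fun h => he ((e1 x y a b c).1 h),
      fun x y a b c => fun h => he ((e2 x y a b c).1 h)⟩

theorem SStep.modX {H H' : CG} {X W D} (s : SStep H H' X W D) : H.Mod X := by
  obtain ⟨⟨s11, s12⟩, ⟨s21, s22⟩, s3, s4, s5, s6, s7, s8, s9, s10⟩ := s
  have a3 := H'.symm
  constructor
  · grind
  · intro v x y; have := s22 v x y; grind

theorem SStep.modW {H H' : CG} {X W D} (s : SStep H H' X W D) : H.Mod W := by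
  obtain ⟨⟨s11, s12⟩, ⟨s21, s22⟩, s3, s4, s5, s6, s7, s8, s9, s10⟩ := s
  have a3 := H'.symm
  constructor
  · grind
  · intro v x y; have := s22 v x y; grind

theorem SStep.modD {H H' : CG} {X W D} (s : SStep H H' X W D) : H.Mod D := by
  obtain ⟨⟨s11, s12⟩, ⟨s21, s22⟩, s3, s4, s5, s6, s7, s8, s9, s10⟩ := s
  constructor
  · grind
  · intro v x y; have := s12 v x y; grind

theorem SStep.modDW {H H' : CG} {X W D} (s : SStep H H' X W D) :
    H.Mod (fun x => D x ∧ ¬ W x) := by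
  obtain ⟨⟨s11, s12⟩, ⟨s21, s22⟩, s3, s4, s5, s6, s7, s8, s9, s10⟩ := s
  have a3 := H'.symm
  constructor
  · grind
  · intro v x y; have := s12 v x y; grind

theorem Cfg.s_all {m H A B T Y N t} (h : Cfg m H A B T Y N t) {H' : CG} {X W D : Pt → Prop}
    (s : SStep H H' X W D) (ih : StH m H') (ihm : ∀ k < m, St k) : Pr (H.sub T t Y) := by
  have hs := s
  obtain ⟨s1, s2, s3, s4, s5, s6, s7, s8, s9, s10⟩ := hs
  have ht := h.ht
  by_cases c1 : ∃ x, T x ∧ D x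
  case neg =>
    refine h.s_unif s1 s2 s3 s4 s5 s6 s8 s9 s10 ih ?_ ?_ ?_
    all_goals clear s8 s10; grind
  by_cases c2 : ∃ x, T x ∧ ¬ D x
  · exact h.s_over s ih c1 (Or.inl c2)
  push Not at c2
  by_cases c3 : (∃ x, T x ∧ W x)
  · by_cases c4 : ∃ x, T x ∧ D x ∧ ¬ W x
    · exact h.s_over s ih c1 (Or.inr ⟨c3, c4⟩)
    · refine h.s_unif s1 s2 s3 s4 s5 s6 s8 s9 s10 ih ?_ ?_ ?_
      all_goals clear s8 s10; grind
  by_cases c5 : ∃ x, X x ∧ T x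
  case neg =>
    refine h.s_unif s1 s2 s3 s4 s5 s6 s8 s9 s10 ih ?_ ?_ ?_
    all_goals clear s8 s10; grind
  by_cases c6 : ∃ x, T x ∧ ¬ X x
  case neg =>
    refine h.s_unif s1 s2 s3 s4 s5 s6 s8 s9 s10 ih ?_ ?_ ?_
    all_goals clear s8 s10; grind
  have u : ∀ x, T x → D x ∧ ¬ W x := by grind
  by_cases c7 : ∃ x, X x ∧ ¬ T x
  · rcases overlap s.modX h.mod c5 c7 c6 with ⟨o1, o2⟩ | ⟨o1, o2⟩
    · exact h.s_b s ih u c7 o1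
    · exact h.s_c s ih ihm u c5 c6 (fun x y a b c => H.symm _ _ (o2 y x b c a))
        (fun x y a b c d => o1 x y a b d)
  · push Not at c7
    by_cases d1 : ∃ x, X x ∧ A x
    · by_cases d2 : ∃ x, X x ∧ B x
      · refine h.s_c s ih ihm u c5 c6 ?_ (fun x y a b => absurd (c7 x a) b)
        obtain ⟨p, p1, p2⟩ := d1
        obtain ⟨q, q1, q2⟩ := d2
        intro x y hx hy hy2
        have m := s.modX.2 y
        have vy := h.mod.1 y hy
        rcases (h.hT y).1 hy with hA | hB
        · exact H.symm _ _ (m q x vy hy2 q1 hx (h.AB y q hA q2))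
        · exact H.symm _ _ (m p x vy hy2 p1 hx (H.symm _ _ (h.AB p y p2 hB)))
      · refine h.s_a s ih u ?_
        intro x hx
        have := (h.hT x).1 (c7 x hx)
        grind
    · refine h.swap.s_a s ih u ?_
      intro x hx
      have := (h.hT x).1 (c7 x hx)
      grind

theorem sub_t {H : CG} {T Y} {t t' : Pt} (hT : H.Mod T) (h1 : T t) (h2 : T t') :
    H.sub T t Y = H.sub T t' Y := by
  have sy := H.symm; have su := H.supp; have su2 := H.supp2
  have : ∀ y, ¬ T y → (H.E t y ↔ H.E t' y) := by
    intro y hy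
    have := hT.2 y t t'; have := hT.2 y t' t
    grind
  apply ext' <;> simp only [sub]
  · grind
  · grind

theorem Cfg.ins_unif {m H A B T Y N t} (h : Cfg m H A B T Y N t) {Q : Pt → Prop}
    (hQ : H.Mod Q) (p1 : Pr (H.res fun x => ¬ Q x)) (p2 : Pr (H.res Q))
    (i1 : StH m (H.res fun x => ¬ Q x)) (i2 : StH m (H.res Q)) (u : ∀ x, T x → (Q x ↔ Q t)) :
    Pr (H.sub T t Y) := by
  obtain ⟨hm, hT, dis, ⟨mod1, mod2⟩, ht, AB, ⟨y0, hy0⟩, hN, TN, YN, tau⟩ := h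
  obtain ⟨q1, q2⟩ := hQ
  have a1 := H.supp; have a2 := H.supp2; have a3 := H.symm; have a4 := H.irr
  have y1 := Y.supp; have y2 := Y.supp2; have y3 := Y.irr; have y4 := Y.symm
  have f : ∀ x, (H.V x ∧ ¬ T x) → ¬ Y.V x := by grind
  have hmm : (H.sub T t Y).Mod (fun x => (Q x ∧ ¬ T x) ∨ (Y.V x ∧ Q t)) := by
    constructor
    · simp only [sub]; grind
    · intro v x y; simp only [sub]
      by_cases hv : Y.V v <;> by_cases hx : Y.V x <;> by_cases hy : Y.V y <;> grind
  refine Pr.ins _ _ hmm ?_ ?_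
  · by_cases hq : Q t
    · refine p1.congr ?_ ?_ <;> simp only [res, sub] <;> grind
    · have := i1 A B T Y N t ⟨?_, hT, dis, ⟨?_, ?_⟩, ht, ?_, ⟨y0, hy0⟩, ?_, TN, YN, ?_⟩
      · refine this.congr ?_ ?_ <;> simp only [res, sub] <;> grind
      · refine le_trans (sz_mono ?_) hm; simp only [res]; grind
      · simp only [res]; grind
      · simp only [res]; grind
      · simp only [res]; grind
      · simp only [res]; grind
      · have e1 : (H.res fun x => ¬ Q x).res A = H.res A := by
          apply ext' <;> simp only [res] <;> grind
        have e2 : (H.res fun x => ¬ Q x).res B = H.res B := by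
          apply ext' <;> simp only [res] <;> grind
        rwa [e1, e2]
  · by_cases hq : Q t
    · have := i2 A B T Y N t ⟨?_, hT, dis, ⟨?_, ?_⟩, ht, ?_, ⟨y0, hy0⟩, ?_, TN, YN, ?_⟩
      · refine this.congr ?_ ?_ <;> simp only [res, sub] <;> grind
      · refine le_trans (sz_mono ?_) hm; simp only [res]; grind
      · simp only [res]; grind
      · simp only [res]; grind
      · simp only [res]; grind
      · simp only [res]; grind
      · have e1 : (H.res Q).res A = H.res A := by
          apply ext' <;> simp only [res] <;> grind
        have e2 : (H.res Q).res B = H.res B := by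
          apply ext' <;> simp only [res] <;> grind
        rwa [e1, e2]
    · refine p2.congr ?_ ?_ <;> simp only [res, sub] <;> grind

theorem Cfg.ins_in {m H A B T Y N t} (h : Cfg m H A B T Y N t) {Q : Pt → Prop}
    (hQ : H.Mod Q) (p1 : Pr (H.res fun x => ¬ Q x)) (p2 : Pr (H.res Q))
    (ihm : ∀ k < m, St k) (c : ∃ x, T x ∧ ¬ Q x) (ne : ∃ x, Q x) (u : ∀ x, Q x → A x) :
    Pr (H.sub T t Y) := by
  obtain ⟨hm, hT, dis, ⟨mod1, mod2⟩, ht, AB, ⟨y0, hy0⟩, hN, TN, YN, tau⟩ := h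
  obtain ⟨q1, q2⟩ := hQ
  have a1 := H.supp; have a2 := H.supp2; have a3 := H.symm; have a4 := H.irr
  obtain ⟨t', ht', ht2⟩ := c
  rw [sub_t ⟨mod1, mod2⟩ ht ht']
  have sz1 := sz_split (H := H) Q
  obtain ⟨q0, hq0⟩ := ne
  have sz2 : 0 < (H.res Q).sz := sz_pos ⟨q0, q1 _ hq0, hq0⟩
  have key := ihm (m - (H.res Q).sz) (by omega) _ p1 (fun x => A x ∧ ¬ Q x) B
    (fun x => T x ∧ ¬ Q x) Y N t'
    ⟨by omega, by grind, by grind, ⟨?_, ?_⟩, ⟨ht', ht2⟩, ?_, ⟨y0, hy0⟩, ?_, ?_, YN, ?_⟩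
  · refine key.congr ?_ ?_ <;> simp only [res, sub] <;> grind
  · simp only [res]; grind
  · simp only [res]; grind
  · simp only [res]; grind
  · simp only [res]; grind
  · grind
  · have e1 : (H.res fun x => ¬ Q x).res (fun x => A x ∧ ¬ Q x) = H.res (fun x => A x ∧ ¬ Q x) := by
      apply ext' <;> simp only [res] <;> grind
    have e2 : (H.res fun x => ¬ Q x).res B = H.res B := by
      apply ext' <;> simp only [res] <;> grind
    rw [e1, e2]
    intro KA KB k1 k2 k3 ks kA kB
    have e3 : (H.res A).sz = (H.res fun x => A x ∧ ¬ Q x).sz + (H.res Q).sz := by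
      rw [← sz_par]
      · apply sz_congr; simp only [CG.par, res]; grind
      · simp only [res]; grind
    refine tau KA KB k1 k2 k3 (by omega) ?_ kB
    have c1 := KA.supp; have c2 := KA.supp2
    have c3 : ∀ x, KA.V x → ¬ A x := by grind
    refine Pr.ins _ Q ⟨?_, ?_⟩ (kA.congr ?_ ?_) (p2.congr ?_ ?_)
    · simp only [CG.par, res]; grind
    · intro v x y; simp only [CG.par, res]; grind
    all_goals simp only [CG.par, res]; grind

theorem Cfg.ins_join {m H A B T Y N t} (h : Cfg m H A B T Y N t) {Q : Pt → Prop}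
    (hQ : H.Mod Q) (p1 : Pr (H.res fun x => ¬ Q x)) (p2 : Pr (H.res Q))
    (ihm : ∀ k < m, St k) (v1 : ∃ x, Q x ∧ T x) (v2 : ∃ x, T x ∧ ¬ Q x)
    (w1 : ∀ x y, Q x → T y → ¬ Q y → H.E x y)
    (w2 : ∀ x y, Q x → ¬ T x → Q y → T y → H.E x y) :
    Pr (H.sub T t Y) := by
  obtain ⟨hm, hT, dis, ⟨mod1, mod2⟩, ht, AB, ⟨y0, hy0⟩, hN, TN, YN, tau⟩ := h
  obtain ⟨q1, q2⟩ := hQ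
  have a1 := H.supp; have a2 := H.supp2; have a3 := H.symm; have a4 := H.irr
  have y1 := Y.supp; have y2 := Y.supp2; have y3 := Y.irr; have y4 := Y.symm
  obtain ⟨q0, hq0, hq0T⟩ := v1
  obtain ⟨t', ht', ht2⟩ := v2
  rw [sub_t ⟨mod1, mod2⟩ ht ht']
  have sz1 := sz_split (H := H) Q
  have sz2 : 0 < (H.res Q).sz := sz_pos ⟨q0, q1 _ hq0, hq0⟩
  have f : ∀ x, (H.V x ∧ ¬ T x) → ¬ Y.V x := by grind
  have q3 : ∀ z v, H.V v → ¬ T v → ¬ Q v → (T z ∨ Q z) → (H.E z v ↔ H.E t' v) := by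
    intro z v hv h1 h2 h3
    have i1 : H.E v q0 ↔ H.E v t' := ⟨mod2 v q0 t' hv h1 hq0T ht', mod2 v t' q0 hv h1 ht' hq0T⟩
    have i2 : H.E v z ↔ H.E v q0 := by
      rcases h3 with h3 | h3
      · exact ⟨mod2 v z q0 hv h1 h3 hq0T, mod2 v q0 z hv h1 hq0T h3⟩
      · exact ⟨q2 v z q0 hv h2 h3 hq0, q2 v q0 z hv h2 hq0 h3⟩
    have := a3 v z; have := a3 z v; have := a3 v t'; have := a3 t' v
    tauto
  have tq : ∀ z, Q z → H.E t' z ∧ H.E z t' := by grind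
  have key := ihm (m - (H.res Q).sz) (by omega) _ p1 (fun x => A x ∧ ¬ Q x) (fun x => B x ∧ ¬ Q x)
    (fun x => T x ∧ ¬ Q x) (Y.tens (H.res fun x => Q x ∧ ¬ T x)) (fun x => N x ∨ (Q x ∧ ¬ T x)) t'
    ⟨by omega, by grind, by grind, ⟨?_, ?_⟩, ⟨ht', ht2⟩, ?_, ⟨y0, Or.inl hy0⟩, ?_, ?_, ?_, ?_⟩
  · clear tau hT hN TN YN AB dis
    refine key.congr ?_ ?_ <;> simp only [res, sub, CG.tens]
    · grind
    · intro x y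
      by_cases hx : Y.V x <;> by_cases hy : Y.V y <;> grind
  · simp only [res]; grind
  · simp only [res]; grind
  · simp only [res]; grind
  · simp only [res]; grind
  · grind
  · simp only [res, CG.tens]; grind
  · have e1 : (H.res fun x => ¬ Q x).res (fun x => A x ∧ ¬ Q x) = H.res (fun x => A x ∧ ¬ Q x) := by
      apply ext' <;> simp only [res] <;> grind
    have e2 : (H.res fun x => ¬ Q x).res (fun x => B x ∧ ¬ Q x) = H.res (fun x => B x ∧ ¬ Q x) := by
      apply ext' <;> simp only [res] <;> grind
    rw [e1, e2]
    intro KA KB k1 k2 k3 ks kA kB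
    have e3 : H.res Q =
          (((H.res fun x => A x ∧ Q x).tens (H.res fun x => B x ∧ Q x)).tens
            (H.res fun x => Q x ∧ ¬ T x)) := by
        apply ext' <;> simp only [res, CG.tens, CG.par] <;> grind
    have f1 : H.res A = (H.res fun x => A x ∧ Q x).tens (H.res fun x => A x ∧ ¬ Q x) := by
        apply ext' <;> simp only [res, CG.tens] <;> grind
    have f2 : H.res B = (H.res fun x => B x ∧ Q x).tens (H.res fun x => B x ∧ ¬ Q x) := by
        apply ext' <;> simp only [res, CG.tens] <;> grind
    rw [f1, f2] at tau
    have e4 : (H.res Q).sz = _ := congrArg sz e3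
    rw [sz_tens _ _ (by simp only [res, CG.tens]; grind), sz_tens _ _ (by simp only [res]; grind)] at e4
    rw [e3, ← par_nil (CG.tens _ _)] at p2
    have g1 := sz_par KA KB k3
    have c1 : ∀ x, KA.V x → ¬ KB.V x ∧ ¬ N x ∧ ¬ (Q x ∧ ¬ T x) := by grind
    have c2 : ∀ x, KB.V x → ¬ N x ∧ ¬ (Q x ∧ ¬ T x) := by grind
    have c3 : ∀ x, H.V x → Q x → ¬ T x → ¬ N x := by grind
    have c5 : ∀ x, A x → N x := by grind
    have c6 : ∀ x, B x → N x := by grind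
    have kK := Pr.tp (by simp only [res]; grind) (by simp only [res]; grind) k3 kA kB
    have := combine (K := KA.par KB) (M := nil) ihm tau (by rw [sz_nil]; omega)
        (by simp only [res]; grind) (by simp only [res]; grind) (by simp only [res]; grind)
        (by simp only [res]; grind) YN (X3 := H.res fun x => Q x ∧ ¬ T x)
        (by simp only [res]; grind) (by simp only [res, CG.par]; grind)
        (by simp only [nil]; grind) (by simp only [res]; grind)
        (by simp only [res]; grind) (by simp only [res]; grind)
        ⟨q0, by simp only [res]; grind⟩ ⟨t', by simp only [res]; grind⟩ ⟨y0, hy0⟩ kK p2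
    rwa [par_nil] at this

theorem Cfg.ins_sub {m H A B T Y N t} (h : Cfg m H A B T Y N t) {Q : Pt → Prop}
    (hQ : H.Mod Q) (p1 : Pr (H.res fun x => ¬ Q x)) (p2 : Pr (H.res Q))
    (ihm : ∀ k < m, St k) (v1 : ∃ x, Q x ∧ T x) (v2 : ∃ x, T x ∧ ¬ Q x)
    (u : ∀ x, Q x → T x) : Pr (H.sub T t Y) := by
  by_cases d1 : ∃ x, Q x ∧ A x
  · by_cases d2 : ∃ x, Q x ∧ B x
    · refine h.ins_join hQ p1 p2 ihm v1 v2 ?_ (fun x y a b => absurd (u x a) b)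
      obtain ⟨p, p1, p2⟩ := d1
      obtain ⟨q, q1, q2⟩ := d2
      intro x y hx hy hy2
      have m := hQ.2 y
      have vy := h.mod.1 y hy
      rcases (h.hT y).1 hy with hA | hB
      · exact H.symm _ _ (m q x vy hy2 q1 hx (h.AB y q hA q2))
      · exact H.symm _ _ (m p x vy hy2 p1 hx (H.symm _ _ (h.AB p y p2 hB)))
    · obtain ⟨q, q1, q2⟩ := v1
      refine h.ins_in hQ p1 p2 ihm v2 ⟨q, q1⟩ ?_
      intro x hx
      have := (h.hT x).1 (u x hx)
      grind
  · obtain ⟨q, q1, q2⟩ := v1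
    refine h.swap.ins_in hQ p1 p2 ihm v2 ⟨q, q1⟩ ?_
    intro x hx
    have := (h.hT x).1 (u x hx)
    grind

theorem Cfg.ins_all {m H A B T Y N t} (h : Cfg m H A B T Y N t) {Q : Pt → Prop}
    (hQ : H.Mod Q) (p1 : Pr (H.res fun x => ¬ Q x)) (p2 : Pr (H.res Q))
    (i1 : StH m (H.res fun x => ¬ Q x)) (i2 : StH m (H.res Q))
    (ihm : ∀ k < m, St k) : Pr (H.sub T t Y) := by
  have ht := h.ht
  by_cases v1 : ∃ x, Q x ∧ T x
  case neg => exact h.ins_unif hQ p1 p2 i1 i2 (by grind)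
  by_cases v2 : ∃ x, T x ∧ ¬ Q x
  case neg => exact h.ins_unif hQ p1 p2 i1 i2 (by grind)
  by_cases v3 : ∃ x, Q x ∧ ¬ T x
  case neg => exact h.ins_sub hQ p1 p2 ihm v1 v2 (by grind)
  rcases overlap hQ h.mod v1 v3 v2 with ⟨o1, o2⟩ | ⟨o1, o2⟩
  · have hh : (∀ x, ¬ A x) ∨ (∀ x, ¬ B x) := by
      obtain ⟨x, hx1, hx2⟩ := v1
      obtain ⟨y, hy1, hy2⟩ := v2
      exact disc (S := fun x => ¬ Q x) h.hT h.AB hy1 hx2 hy2 (not_not.2 hx1)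
        (fun a b c d e f => o2 a b c e (not_not.1 f))
    have hmod : H.Mod (fun x => T x ∨ (Q x ∧ ¬ T x)) := by
      obtain ⟨x, hx1, hx2⟩ := v1
      obtain ⟨q1, q2⟩ := hQ
      obtain ⟨r1, r2⟩ := h.mod
      constructor
      · grind
      · intro v y z hv hv2 hy hz he
        have : H.E v x := by grind
        grind
    have sy := H.symm
    rcases hh with hA | hB
    · obtain ⟨c, e⟩ := h.swap.enlarge hA (fun x => Q x ∧ ¬ T x) (by grind) hmod (by grind)
      rw [← e]
      exact c.ins_sub hQ p1 p2 ihm (by grind) (by grind) (by grind)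
    · obtain ⟨c, e⟩ := h.enlarge hB (fun x => Q x ∧ ¬ T x) (by grind) hmod (by grind)
      rw [← e]
      exact c.ins_sub hQ p1 p2 ihm (by grind) (by grind) (by grind)
  · exact h.ins_join hQ p1 p2 ihm v1 v2 (fun x y a b c => H.symm _ _ (o2 y x b c a))
        (fun x y a b c d => o1 x y a b d)

end GSP

set_option linter.unusedVariables false
set_option maxHeartbeats 4000000
namespace GSP
open CG

structure PrD (H : CG) (I : Finset ℕ) (p : ℕ → ℕ → Prop) (β : Pt → ℕ) (L : Pt → Prop) : Prop where
  prime : PrimeOn I p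
  co : Compo H I p β L
  nl : ∀ i ∈ I, ∃ x, H.V x ∧ β x = i ∧ L x
  nr : ∀ i ∈ I, ∃ x, H.V x ∧ β x = i ∧ ¬ L x

theorem PrD.swap {H I p β L} (h : PrD H I p β L) :
    PrD H I (fun i j => ¬ p i j) β (fun x => ¬ L x) where
  prime := ⟨h.prime.1, fun J hJ hm => h.prime.2 J hJ fun k hk hkJ i hi j hj hp => by
    by_contra hq; exact hm k hk hkJ j hj i hi hq hp⟩
  co := h.co.swap
  nl := h.nr
  nr i hi := by simpa using h.nl i hi

theorem PrimeOn.unif {I : Finset ℕ} {p : ℕ → ℕ → Prop} (h : PrimeOn I p) {i : ℕ}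
    (hi : i ∈ I) (hu : ∀ k ∈ I, ∀ k' ∈ I, k ≠ i → k' ≠ i → p i k → p i k') : False := by
  have h1 := h.1
  have hc := Finset.card_erase_of_mem hi
  rcases h.2 (I.erase i) (Finset.erase_subset _ _) (by
    intro k hk hkJ a ha b hb
    simp only [Finset.mem_erase] at *
    have : k = i := by tauto
    subst this
    exact hu a ha.2 b hb.2 ha.1 hb.1) with h2 | h2
  · omega
  · rw [h2] at hc; omega

theorem PrD.alt_left {H I p β L} (h : PrD H I p β L) {T : Pt → Prop} (hT : H.Mod T) {x y : Pt}
    (tx : T x) (ty : T y) (lx : L x) (ly : L y) (hxy : β x ≠ β y) :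
    ∀ z, H.V z → L z → T z := by
  classical
  obtain ⟨t1, t2⟩ := hT
  have mem := h.co.mem; have left := h.co.left; have ps := h.co.symm; have nl := h.nl
  set J := I.filter fun i => ∃ x, T x ∧ L x ∧ β x = i with hJ
  have mJ : ∀ i, i ∈ J ↔ i ∈ I ∧ ∃ x, T x ∧ L x ∧ β x = i := by intro i; simp [hJ]
  have hJI : J = I := by
    rcases h.prime.2 J (Finset.filter_subset _ _) (by
      intro k hk hkJ i hi j hj hp
      obtain ⟨v, v1, v2, v3⟩ := nl k hk
      obtain ⟨_, a, a1, a2, a3⟩ := (mJ i).1 hi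
      obtain ⟨_, b, b1, b2, b3⟩ := (mJ j).1 hj
      have vT : ¬ T v := fun hv => hkJ ((mJ k).2 ⟨hk, v, hv, v3, v2⟩)
      have ki : k ≠ i := fun e => hkJ (e ▸ hi)
      have kj : k ≠ j := fun e => hkJ (e ▸ hj)
      have e1 := left v a v1 (t1 _ a1) (by grind) v3 a2
      have e2 := left v b v1 (t1 _ b1) (by grind) v3 b2
      rw [v2, a3] at e1; rw [v2, b3] at e2
      exact e2.1 (t2 v a b v1 vT a1 b1 (e1.2 hp))) with h1 | h1
    · exfalso
      rw [Finset.card_le_one] at h1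
      exact hxy (h1 _ ((mJ _).2 ⟨mem _ (t1 _ tx), x, tx, lx, rfl⟩) _
        ((mJ _).2 ⟨mem _ (t1 _ ty), y, ty, ly, rfl⟩))
    · exact h1
  intro v v1 v2
  by_contra v3
  refine h.prime.unif (mem v v1) ?_
  intro k hk k' hk' n1 n2 hp
  rw [← hJI] at hk hk'
  obtain ⟨_, a, a1, a2, a3⟩ := (mJ k).1 hk
  obtain ⟨_, b, b1, b2, b3⟩ := (mJ k').1 hk'
  have e1 := left v a v1 (t1 _ a1) (by grind) v2 a2
  have e2 := left v b v1 (t1 _ b1) (by grind) v2 b2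
  rw [a3] at e1; rw [b3] at e2
  exact e2.1 (t2 v a b v1 v3 a1 b1 (e1.2 hp))

theorem PrD.alt_lr {H I p β L} (h : PrD H I p β L) {T : Pt → Prop} (hT : H.Mod T)
    (hL : ∀ z, H.V z → L z → T z) {y : Pt} (ty : T y) (ly : ¬ L y) :
    ∀ z, H.V z → T z := by
  classical
  obtain ⟨t1, t2⟩ := hT
  have mem := h.co.mem; have right := h.co.right; have ps := h.co.symm; have nr := h.nr
  have cross := h.co.cross
  have sy := H.symm
  obtain ⟨l, l1, l2, l3⟩ := h.nl (β y) (mem y (t1 y ty))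
  have non : ∀ v, H.V v → ¬ T v → ∀ a, T a → ¬ H.E v a := by
    intro v v1 v2 a a1 e
    have := t2 v a l v1 v2 a1 (hL l l1 l3) e
    exact cross l v l3 (fun q => v2 (hL v v1 q)) (sy _ _ this)
  set J := I.filter fun i => ∃ x, T x ∧ ¬ L x ∧ β x = i with hJ
  have mJ : ∀ i, i ∈ J ↔ i ∈ I ∧ ∃ x, T x ∧ ¬ L x ∧ β x = i := by intro i; simp [hJ]
  have key : ∀ v, H.V v → ¬ T v → ∀ i ∈ J, i ≠ β v → p (β v) i := by
    intro v v1 v2 i hi n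
    obtain ⟨_, a, a1, a2, a3⟩ := (mJ i).1 hi
    have vL : ¬ L v := fun q => v2 (hL v v1 q)
    have e1 := right v a v1 (t1 _ a1) (by grind) vL a2
    have := non v v1 v2 a a1
    rw [a3] at e1
    tauto
  have key2 : ∀ k ∈ I, k ∉ J → ∀ i ∈ J, p k i := by
    intro k hk hkJ i hi
    obtain ⟨v, v1, v2, v3⟩ := nr k hk
    have vT : ¬ T v := fun hv => hkJ ((mJ k).2 ⟨hk, v, hv, v3, v2⟩)
    have ki : i ≠ k := fun e => hkJ (e ▸ hi)
    subst v2
    exact key v v1 vT i hi ki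
  have yJ : β y ∈ J := (mJ _).2 ⟨mem _ (t1 y ty), y, ty, ly, rfl⟩
  intro v v1
  by_contra v2
  rcases h.prime.2 J (Finset.filter_subset _ _)
    (fun k hk hkJ i hi j hj hp => key2 k hk hkJ j hj) with h1 | h1
  · rw [Finset.card_le_one] at h1
    refine h.prime.unif (mem y (t1 y ty)) ?_
    intro k hk k' hk' n1 n2 hp
    refine ps _ _ (key2 k' hk' (fun q => n2 (h1 _ q _ yJ)) _ yJ)
  · refine h.prime.unif (mem v v1) ?_
    intro k hk k' hk' n1 n2 hp
    exact key v v1 v2 k' (h1 ▸ hk') n2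

theorem PrD.alt {H I p β L} (h : PrD H I p β L) {T : Pt → Prop} (hT : H.Mod T) (hne : ∃ t, T t) :
    (∃ i ∈ I, ∀ x, T x → β x = i ∧ L x) ∨ (∃ i ∈ I, ∀ x, T x → β x = i ∧ ¬ L x) ∨
    (∀ x, T x ↔ H.V x ∧ L x) ∨ (∀ x, T x ↔ H.V x ∧ ¬ L x) ∨ (∀ x, T x ↔ H.V x) := by
  have t1 := hT.1
  by_cases c1 : ∃ x y, T x ∧ T y ∧ L x ∧ L y ∧ β x ≠ β y
  · obtain ⟨x, y, tx, ty, lx, ly, hxy⟩ := c1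
    have := h.alt_left hT tx ty lx ly hxy
    by_cases c2 : ∃ y, T y ∧ ¬ L y
    · obtain ⟨y, ty, ly⟩ := c2
      have := h.alt_lr hT this ty ly
      grind
    · grind
  by_cases c2 : ∃ x y, T x ∧ T y ∧ ¬ L x ∧ ¬ L y ∧ β x ≠ β y
  · obtain ⟨x, y, tx, ty, lx, ly, hxy⟩ := c2
    have := h.swap.alt_left hT tx ty lx ly hxy
    by_cases c2 : ∃ y, T y ∧ L y
    · obtain ⟨y, ty, ly⟩ := c2
      have := h.swap.alt_lr hT this ty (not_not.2 ly)
      grind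
    · grind
  have mem := h.co.mem
  by_cases c3 : ∃ x y, T x ∧ T y ∧ L x ∧ ¬ L y
  · exfalso
    obtain ⟨x, y, tx, ty, lx, ly⟩ := c3
    have key : ∀ k ∈ I, k ≠ β x → ¬ p k (β x) := by
      intro k hk n
      obtain ⟨v, v1, v2, v3⟩ := h.nl k hk
      have vT : ¬ T v := by grind
      have := h.co.cross v y v3 ly
      have := hT.2 v x y v1 vT tx ty
      have := h.co.left v x v1 (t1 x tx) (by grind) v3 lx
      grind
    refine h.prime.unif (mem x (t1 x tx)) ?_
    intro k hk k' hk' n1 n2 hp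
    exact absurd (h.co.symm _ _ hp) (key k hk n1)
  obtain ⟨t, tt⟩ := hne
  by_cases lt : L t
  · left; exact ⟨β t, mem t (t1 t tt), by grind⟩
  · right; left; exact ⟨β t, mem t (t1 t tt), by grind⟩

theorem PrD.coconn {H I p β L} (h : PrD H I p β L) {A B T : Pt → Prop}
    (hT : ∀ x, T x ↔ A x ∨ B x) (AB : ∀ x y, A x → B y → H.E x y)
    (hTL : ∀ x, T x ↔ H.V x ∧ L x) : (∀ x, ¬ A x) ∨ (∀ x, ¬ B x) := by
  classical
  by_contra hc
  push Not at hc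
  obtain ⟨⟨a, ha⟩, ⟨b, hb⟩⟩ := hc
  have mem := h.co.mem; have left := h.co.left; have ps := h.co.symm; have nl := h.nl
  -- one-sided statement
  have main : ∀ A B : Pt → Prop, (∀ x, T x ↔ A x ∨ B x) → (∀ x y, A x → B y → H.E x y) →
      (∃ a, A a) → ∀ i ∈ I, ∃ x, A x ∧ β x = i := by
    intro A B hT AB ⟨a, ha⟩
    set J := I.filter fun i => ∃ x, A x ∧ β x = i with hJ
    have mJ : ∀ i, i ∈ J ↔ i ∈ I ∧ ∃ x, A x ∧ β x = i := by intro i; simp [hJ]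
    have aJ : β a ∈ J := (mJ _).2 ⟨mem _ ((hTL a).1 ((hT a).2 (Or.inl ha))).1, a, ha, rfl⟩
    have key : ∀ k ∈ I, k ∉ J → ∀ i ∈ J, p k i := by
      intro k hk hkJ i hi
      obtain ⟨v, v1, v2, v3⟩ := nl k hk
      obtain ⟨i1, x, x1, x2⟩ := (mJ i).1 hi
      have ki : i ≠ k := fun e => hkJ (e ▸ hi)
      have vB : B v := by
        rcases (hT v).1 ((hTL v).2 ⟨v1, v3⟩) with q | q
        · exact absurd ((mJ k).2 ⟨hk, v, q, v2⟩) hkJ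
        · exact q
      have xT := (hTL x).1 ((hT x).2 (Or.inl x1))
      have := left v x v1 xT.1 (by grind) v3 xT.2
      rw [v2, x2] at this
      exact this.1 (H.symm _ _ (AB _ _ x1 vB))
    rcases h.prime.2 J (Finset.filter_subset _ _)
      (fun k hk hkJ i hi j hj hp => key k hk hkJ j hj) with h1 | h1
    · exfalso
      rw [Finset.card_le_one] at h1
      refine h.prime.unif ((mJ _).1 aJ).1 ?_
      intro k hk k' hk' n1 n2 hp
      refine ps _ _ (key k' hk' (fun q => n2 (h1 _ q _ aJ)) _ aJ)
    · intro i hi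
      rw [← h1] at hi
      exact ((mJ i).1 hi).2
  have m1 := main A B hT AB ⟨a, ha⟩
  have m2 := main B A (fun x => (hT x).trans or_comm) (fun x y p q => H.symm _ _ (AB _ _ q p)) ⟨b, hb⟩
  refine h.prime.unif (i := β a) (mem _ ((hTL a).1 ((hT a).2 (Or.inl ha))).1) ?_
  intro k hk k' hk' n1 n2 hp
  obtain ⟨y, y1, y2⟩ := m2 k' hk'
  have q1 := (hTL a).1 ((hT a).2 (Or.inl ha))
  have q2 := (hTL y).1 ((hT y).2 (Or.inr y1))
  have := left a y q1.1 q2.1 (by grind) q1.2 q2.2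
  rw [y2] at this
  exact this.1 (AB _ _ ha y1)

end GSP

set_option linter.unusedVariables false
set_option maxHeartbeats 4000000
namespace GSP
open CG

theorem Cfg.block {m H A B T Y N t} (h : Cfg m H A B T Y N t) {I p β L} (co : Compo H I p β L)
    (hb : ∀ i ∈ I, Pr (H.res fun x => β x = i)) (ih : ∀ i ∈ I, StH m (H.res fun x => β x = i))
    {i : ℕ} (hi : i ∈ I) (hT : ∀ x, T x → β x = i ∧ L x) : Pr (H.sub T t Y) := by
  classical
  obtain ⟨hm, hTT, dis, ⟨mod1, mod2⟩, ht, AB, Yne, hN, TN, YN, tau⟩ := h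
  have rA : (H.res fun x => β x = i).res A = H.res A := by
    apply ext'
    · intro x; simp only [res]; grind
    · intro x y; simp only [res]; grind
  have rB : (H.res fun x => β x = i).res B = H.res B := by
    apply ext'
    · intro x; simp only [res]; grind
    · intro x y; simp only [res]; grind
  have key : Pr ((H.res fun x => β x = i).sub T t Y) := by
    refine ih i hi A B T Y N t ⟨?_, hTT, dis, ⟨?_, ?_⟩, ht, ?_, Yne, ?_, TN, YN, ?_⟩
    · refine (sz_mono (H := H) ?_).trans hm
      intro x hx; exact hx.1
    · intro x hx; exact ⟨mod1 x hx, (hT x hx).1⟩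
    · intro v x y; simp only [res]; grind
    · intro x y hx hy; refine ⟨AB x y hx hy, ?_, ?_⟩ <;> grind
    · intro x hx; exact hN x hx.1
    · rw [rA, rB]; exact tau
  have a1 := H.supp; have a2 := H.supp2; have a3 := H.symm; have a4 := H.irr
  have b1 := Y.supp; have b2 := Y.supp2
  obtain ⟨c1, c2, c3, c4, c5⟩ := co
  clear tau ih rA rB hm
  obtain ⟨γ, g1, g2⟩ : ∃ γ : Pt → ℕ, (∀ x, Y.V x → γ x = i) ∧ (∀ x, ¬ Y.V x → γ x = β x) :=
    ⟨fun x => if Y.V x then i else β x, by intro x hx; simp [hx], by intro x hx; simp [hx]⟩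
  have dY : ∀ x, H.V x → ¬ T x → ¬ Y.V x := fun x p q r => hN x p q (YN x r)
  have et : ∀ y, H.E t y → H.V y := fun y h => a2 _ _ h
  have tt := hT t ht
  have lt := c3 t; have xt := c5 t
  have vt := mod1 t ht
  refine Pr.gen (I := I) (p := p) (β := γ) (L := fun x => Y.V x ∨ L x ∧ ¬ Y.V x) ⟨c1, ?_, ?_, ?_, ?_⟩ ?_
  · intro x; simp only [sub]; grind
  · intro x y hx hy hn; simp only [sub] at hx hy ⊢; 
    by_cases u1 : Y.V x <;> by_cases u2 : Y.V y <;> grind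
  · intro x y hx hy hn; simp only [sub] at hx hy ⊢; 
    by_cases u1 : Y.V x <;> by_cases u2 : Y.V y <;> grind
  · intro x y hx hy; simp only [sub]; 
    by_cases u1 : Y.V x <;> by_cases u2 : Y.V y <;> grind
  · intro k hk
    by_cases e : k = i
    · subst e
      refine key.congr ?_ ?_
      · intro x; simp only [sub, res]; grind
      · intro x y; simp only [sub, res]; 
        by_cases u1 : Y.V x <;> by_cases u2 : Y.V y <;> grind
    · refine (hb k hk).congr ?_ ?_
      · intro x; simp only [sub, res]; grind
      · intro x y; simp only [sub, res]; 
        by_cases u1 : Y.V x <;> by_cases u2 : Y.V y <;> grind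

theorem Cfg.pr_all {m H A B T Y N t} (h : Cfg m H A B T Y N t) {I p β L} (d : PrD H I p β L)
    (hb : ∀ i ∈ I, Pr (H.res fun x => β x = i)) (ih : ∀ i ∈ I, StH m (H.res fun x => β x = i)) :
    Pr (H.sub T t Y) := by
  have hP : Pr H := Pr.gen d.co hb
  rcases d.alt h.mod ⟨t, h.ht⟩ with ⟨i, hi, c⟩ | ⟨i, hi, c⟩ | c | c | c
  · exact h.block d.co hb ih hi c
  · exact h.block d.co.swap hb ih hi c
  · refine h.triv' hP (d.coconn h.hT h.AB c) ?_
    intro x y hx hy e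
    exact d.co.cross x y ((c x).1 hx).2 (fun q => hy ((c y).2 ⟨H.supp2 _ _ e, q⟩)) e
  · refine h.triv' hP (d.swap.coconn h.hT h.AB c) ?_
    intro x y hx hy e
    exact d.swap.co.cross x y ((c x).1 hx).2 (fun q => hy ((c y).2 ⟨H.supp2 _ _ e, q⟩)) e
  · refine h.triv' hP ?_ ?_
    · have hc := d.prime.1
      obtain ⟨i, hi⟩ : I.Nonempty := by rw [← Finset.card_pos]; omega
      obtain ⟨x, x1, x2, x3⟩ := d.nl i hi
      obtain ⟨y, y1, y2, y3⟩ := d.nr i hi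
      exact disc (S := L) h.hT h.AB ((c x).2 x1) ((c y).2 y1) x3 y3
        (fun a b _ _ la lb => d.co.cross a b la lb)
    · intro x y hx hy e
      exact hy ((c y).2 (H.supp2 _ _ e))

theorem St_all (m : ℕ) : St m := by
  induction m using Nat.strong_induction_on with
  | _ m ihm =>
  intro H hH
  induction hH with
  | empty H h0 => intro A B T Y N t h; exact absurd (h.mod.1 t h.ht) (h0 t)
  | ai H x y hxy hl hV hE =>
    intro A B T Y N t h
    refine h.triv' (Pr.ai H x y hxy hl hV hE) ?_ (fun x y _ _ => hE x y)
    by_contra hc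
    push Not at hc
    obtain ⟨⟨a, ha⟩, ⟨b, hb⟩⟩ := hc
    exact hE _ _ (h.AB a b ha hb)
  | s H H' X W D s1 s2 s3 s4 s5 s6 s7 s8 s9 s10 hP ih =>
    intro A B T Y N t h
    exact h.s_all ⟨s1, s2, s3, s4, s5, s6, s7, s8, s9, s10⟩ ih ihm
  | ins H Q hQ p1 p2 i1 i2 =>
    intro A B T Y N t h
    exact h.ins_all hQ p1 p2 i1 i2 ihm
  | pr H I p β L q1 q2 q3 q4 hb ih =>
    intro A B T Y N t h
    exact h.pr_all ⟨q1, q2, q3, q4⟩ hb ih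

/-- deep splitting, without size bounds -/
theorem Pr.deep {H : CG} (hP : Pr H) {A B T N : Pt → Prop} {Y : CG} {t : Pt}
    (hT : ∀ x, T x ↔ A x ∨ B x) (dis : ∀ x, A x → ¬ B x) (mod : H.Mod T) (ht : T t)
    (AB : ∀ x y, A x → B y → H.E x y) (Yne : ∃ x, Y.V x) (hN : ∀ x, H.V x → ¬ T x → ¬ N x)
    (TN : ∀ x, T x → N x) (YN : ∀ x, Y.V x → N x)
    (tau : ∀ KA KB : CG, (∀ x, KA.V x → ¬ N x) → (∀ x, KB.V x → ¬ N x) →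
      (∀ x, KA.V x → ¬ KB.V x) → Pr ((H.res A).par KA) → Pr ((H.res B).par KB) →
      Pr (Y.par (KA.par KB))) : Pr (H.sub T t Y) :=
  St_all H.sz H hP A B T Y N t ⟨le_rfl, hT, dis, mod, ht, AB, Yne, hN, TN, YN,
    fun KA KB h1 h2 h3 _ => tau KA KB h1 h2 h3⟩

/-- context reduction: the case of one hole -/
theorem Pr.ctx {H : CG} (hP : Pr H) {T N : Pt → Prop} {Y : CG} {t : Pt}
    (mod : H.Mod T) (ht : T t) (Yne : ∃ x, Y.V x) (hN : ∀ x, H.V x → ¬ T x → ¬ N x)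
    (TN : ∀ x, T x → N x) (YN : ∀ x, Y.V x → N x)
    (tau : ∀ K : CG, (∀ x, K.V x → ¬ N x) → Pr ((H.res T).par K) → Pr (Y.par K)) :
    Pr (H.sub T t Y) := by
  refine hP.deep (A := T) (B := fun _ => False) (N := N) (by simp) (by simp) mod ht (by simp) Yne hN TN YN ?_
  intro KA KB h1 h2 h3 p1 p2
  have e : ((H.res fun _ => False).par KB) = KB := ext' (by simp [CG.par, res]) (by simp [CG.par, res])
  rw [e] at p2
  have := tau KA h1 p1
  rw [← par_assoc]
  refine Pr.par ?_ this p2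
  intro x; simp only [CG.par]; grind
end GSP

set_option linter.unusedVariables false
set_option maxHeartbeats 4000000
namespace GSP
open CG

structure MN (H : CG) (D A : Pt → Prop) : Prop where
  mD : H.Mod D
  mA : H.Mod A
  AD : ∀ x, A x → D x
  nu : ∃ a v w, A a ∧ D v ∧ ¬ A v ∧ H.E v a ∧ D w ∧ ¬ A w ∧ ¬ H.E w a
  min : ∀ Q, H.Mod Q → (∀ x, A x → Q x) → (∀ x, Q x → D x) → (∀ x, Q x → A x) ∨ (∀ x, D x → Q x)

theorem ss_reduce {H : CG} (hP : Pr H)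
    (h : ∀ D A, MN H D A → Pr (H.cut A fun x => D x ∧ ¬ A x)) :
    ∀ (n : ℕ) (D A : Pt → Prop), (H.res D).sz ≤ n → H.Mod D → H.Mod A → (∀ x, A x → D x) →
      Pr (H.cut A fun x => D x ∧ ¬ A x) := by
  intro n
  induction n with
  | zero =>
    intro D A hn mD mA AD
    refine hP.congr (fun x => Iff.rfl) ?_
    intro x y; simp only [cut]
    have : ∀ x, ¬ D x := fun x hx => by
      have := sz_pos (G := H.res D) ⟨x, mD.1 x hx, hx⟩; omega
    grind
  | succ n ih =>
    intro D A hn mD mA AD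
    by_cases c1 : ∀ x y, A x → D y → ¬ A y → ¬ H.E x y
    · refine hP.congr (fun x => Iff.rfl) ?_
      intro x y; simp only [cut]
      have := H.symm x y
      grind
    by_cases c2 : ∀ x y, A x → D y → ¬ A y → H.E x y
    · push Not at c1
      obtain ⟨t, u, tA, uD, uA, e⟩ := c1
      have q := hP.deep (A := A) (B := fun x => D x ∧ ¬ A x) (T := D) (N := D)
        (Y := (H.res A).par (H.res fun x => D x ∧ ¬ A x)) (t := t) (by grind) (by grind) mD
        (AD _ tA) (by grind) ⟨t, Or.inl ⟨mA.1 _ tA, tA⟩⟩ (by grind) (by grind)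
        (by intro x; simp only [CG.par, res]; grind) (by
          intro KA KB h1 h2 h3 p1 p2
          have := Pr.par ?_ p1 p2
          · rw [par_assoc] at this ⊢
            rwa [par_left_comm KA] at this
          · have := AD
            clear p1 p2
            intro x; simp only [CG.par, res]; grind)
      obtain ⟨m1, m2⟩ := mD
      obtain ⟨n1, n2⟩ := mA
      have a1 := H.supp; have a2 := H.supp2; have a3 := H.symm; have a4 := H.irr
      clear ih h hP
      refine q.congr ?_ ?_
      · intro x; simp only [CG.sub, CG.par, res, cut]; grind
      · intro x y; simp only [CG.sub, CG.par, res, cut]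
        have tD := AD t tA
        by_cases u1 : D x <;> by_cases u2 : D y <;> grind
    by_cases c3 : ∃ Q, H.Mod Q ∧ (∀ x, A x → Q x) ∧ (∀ x, Q x → D x) ∧ (∃ x, Q x ∧ ¬ A x) ∧
        (∃ x, D x ∧ ¬ Q x)
    · obtain ⟨Q, mQ, AQ, QD, ⟨u, u1, u2⟩, ⟨w, w1, w2⟩⟩ := c3
      have hlt : (H.res Q).sz < (H.res D).sz := by
        refine Set.ncard_lt_ncard ⟨fun x hx => ⟨hx.1, QD x hx.2⟩, ?_⟩ (H.res D).fin
        intro hs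
        exact w2 (hs (a := w) ⟨mD.1 w w1, w1⟩).2
      have q := ih Q A (by omega) mQ mA AQ
      obtain ⟨m1, m2⟩ := mD
      obtain ⟨n1, n2⟩ := mA
      obtain ⟨l1, l2⟩ := mQ
      have a3 := H.symm
      clear ih h hP
      refine q.s' (fun x => Q x ∧ ¬ A x) A D ⟨m1, ?_⟩ ⟨?_, ?_⟩ (by grind) (by grind) (by grind)
        ⟨u, u1, u2⟩ ?_ (fun x => Iff.rfl) ?_
      · intro v x y; simp only [cut]; grind
      · simp only [cut]; grind
      · intro v x y; simp only [cut]; grind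
      · intro x y; simp only [cut]; grind
      · intro x y; simp only [cut]; grind
    · refine h D A ⟨mD, mA, AD, ?_, ?_⟩
      · push Not at c1 c2
        obtain ⟨a, v, q1, q2, q3, q4⟩ := c1
        obtain ⟨b, w, r1, r2, r3, r4⟩ := c2
        refine ⟨a, v, w, q1, q2, q3, H.symm _ _ q4, r2, r3, fun e => r4 (H.symm _ _ ?_)⟩
        exact mA.2 w a b (mD.1 w r2) r3 q1 r1 e
      · intro Q m1 m2 m3
        by_contra hc
        push Not at hc
        exact c3 ⟨Q, m1, m2, m3, hc.1, hc.2⟩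

theorem MN.alt {H : CG} {D A Q : Pt → Prop} (h : MN H D A) (hQ : H.Mod Q) :
    (∀ x, Q x → ¬ D x) ∨ (∀ x, D x → Q x) ∨ (∀ x, Q x → A x) ∨ (∀ x, Q x → D x ∧ ¬ A x) := by
  by_contra hc
  push Not at hc
  obtain ⟨⟨q, q1, q2⟩, ⟨d, d1, d2⟩, ⟨b, b1, b2⟩, ⟨c, c1, c2⟩⟩ := hc
  obtain ⟨mD, mA, AD, ⟨a, v, w, e1, e2, e3, e4, e5, e6, e7⟩, min⟩ := h
  have a3 := H.symm
  have a1 := H.supp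
  by_cases o : ∃ x, Q x ∧ ¬ D x
  · have ov := overlap hQ mD ⟨q, q1, q2⟩ o ⟨d, d1, d2⟩
    have i1 := min (fun x => D x ∧ Q x)
    have i2 := min (fun x => D x ∧ ¬ Q x)
    have f1 : H.Mod (fun x => D x ∧ Q x) := by
      obtain ⟨m1, m2⟩ := mD
      obtain ⟨l1, l2⟩ := hQ
      clear ov i1 i2 min mA
      exact ⟨by grind, by intro v x y; grind⟩
    have f2 : H.Mod (fun x => D x ∧ ¬ Q x) := by
      obtain ⟨m1, m2⟩ := mD
      obtain ⟨l1, l2⟩ := hQ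
      clear i1 i2 min mA
      refine ⟨by grind, ?_⟩
      intro v x y
      rcases ov with ⟨o1, o2⟩ | ⟨o1, o2⟩ <;> grind
    have i1 := i1 f1
    have i2 := i2 f2
    clear f1 f2 min
    obtain ⟨n1, n2⟩ := mA
    by_cases g1 : ∀ x, A x → Q x
    · rcases ov with ⟨o1, o2⟩ | ⟨o1, o2⟩ <;> grind
    by_cases g2 : ∀ x, A x → ¬ Q x
    · rcases ov with ⟨o1, o2⟩ | ⟨o1, o2⟩ <;> grind
    push Not at g1 g2
    obtain ⟨g, g3, g4⟩ := g1
    obtain ⟨k, k3, k4⟩ := g2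
    have s1 := n2 v; have s2 := n2 w
    clear i1 i2 n2
    have va := a1 v a e4
    have w1 := mD.1 w e5
    rcases ov with ⟨o1, o2⟩ | ⟨o1, o2⟩
    · by_cases z : Q v
      · have := o2 g v; have := s1 a g; grind
      · have := o2 v k; have := s1 a k; grind
    · by_cases z : Q w
      · have := o2 g w; have := s2 g a; grind
      · have := o2 w k; have := s2 k a; grind
  · by_cases m : ∃ x, Q x ∧ A x
    · obtain ⟨m, m1, m2⟩ := m
      have i1 := min (fun x => A x ∨ Q x) (by
        obtain ⟨n1, n2⟩ := mA
        obtain ⟨l1, l2⟩ := hQ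
        refine ⟨by grind, ?_⟩
        intro v x y hv hn hx hy e
        have := n2 v x m; have := l2 v x m; have := n2 v m y; have := l2 v m y
        grind) (by grind) (by grind)
      have g : ∃ x, A x ∧ ¬ Q x := by grind
      have ov := overlap hQ mA ⟨m, m1, m2⟩ ⟨b, b1, b2⟩ g
      obtain ⟨g, g1, g2⟩ := g
      have s1 := mA.2 v a g; have s2 := mA.2 w g a
      have va := a1 v a e4
      have w1 := mD.1 w e5
      rcases ov with ⟨o1, o2⟩ | ⟨o1, o2⟩
      · have := o2 g v; grind
      · have := o2 g w; grind
    · grind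
end GSP

set_option linter.unusedVariables false
set_option maxHeartbeats 4000000
namespace GSP
open CG

def SSH (H : CG) : Prop := ∀ D A : Pt → Prop, H.Mod D → H.Mod A → (∀ x, A x → D x) →
  Pr (H.cut A fun x => D x ∧ ¬ A x)

theorem SStep.ss_same {H H' : CG} {X W F D A : Pt → Prop} (s : SStep H H' X W F) (h : MN H D A)
    (ih : SSH H')
    (hc : (∀ x, F x → ¬ D x) ∨ (∀ x, F x → A x) ∨ (∀ x, F x → D x ∧ ¬ A x) ∨ (∀ x, D x → W x) ∨
      (∀ x, D x → X x) ∨ (∀ x, D x → F x ∧ ¬ X x ∧ ¬ W x)) :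
    Pr (H.cut A fun x => D x ∧ ¬ A x) := by
  obtain ⟨⟨d1, d2⟩, ⟨a1, a2⟩, AD, nu, -⟩ := h
  clear nu
  obtain ⟨⟨s11, s12⟩, ⟨s21, s22⟩, s3, s4, s5, s6, s7, s8, s9, s10⟩ := s
  have c3 := H'.symm
  have c1 := H'.supp
  have mD : H'.Mod D := by
    clear ih
    refine ⟨by grind, ?_⟩
    intro v x y hv hn hx hy e
    have := c3 v x; have := c3 v y; have := d2 v x y; have := s10 v x; have := s10 v y
    rcases hc with hc | hc | hc | hc | hc | hc <;> grind
  have mA : H'.Mod A := by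
    clear ih
    refine ⟨by grind, ?_⟩
    intro v x y hv hn hx hy e
    have := c3 v x; have := c3 v y; have := a2 v x y; have := s10 v x; have := s10 v y
    rcases hc with hc | hc | hc | hc | hc | hc <;> grind
  have q := ih D A mD mA AD
  clear ih
  refine q.s' X W F ⟨s11, ?_⟩ ⟨s21, ?_⟩ s3 s4 s5 s6 ?_ s9 ?_
  · intro v x y hv hn hx hy; simp only [cut]
    have := s12 v x y
    rcases hc with hc | hc | hc | hc | hc | hc <;> grind
  · intro v x y hv hn hx hy; simp only [cut]
    have := s22 v x y
    rcases hc with hc | hc | hc | hc | hc | hc <;> grind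
  · intro x y; simp only [cut]; grind
  · intro x y; simp only [cut]; grind

theorem SStep.ss_A {H H' : CG} {X W F D A : Pt → Prop} (s : SStep H H' X W F) (h : MN H D A)
    (ih : SSH H') (h1 : ∀ x, D x → F x) (h2 : ∀ x, D x → ¬ W x) (h3 : ∀ x, X x → A x) :
    Pr (H.cut A fun x => D x ∧ ¬ A x) := by
  obtain ⟨⟨d1, d2⟩, ⟨a1, a2⟩, AD, nu, -⟩ := h
  clear nu
  obtain ⟨⟨s11, s12⟩, ⟨s21, s22⟩, s3, s4, s5, ⟨x0, s6⟩, s7, s8, s9, s10⟩ := s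
  have c3 := H'.symm
  have c1 := H'.supp
  have c4 := H'.irr
  have mD : H'.Mod (fun x => D x ∨ W x) := by
    clear ih
    refine ⟨by grind, ?_⟩
    intro v x y hv hn hx hy e
    have := s10 v x; have := s10 v y; have := s10 v x0
    have := s22 v x x0; have := s22 v x0 y
    have := d2 v x y; have := d2 v x x0; have := d2 v x0 y
    grind
  have mA : H'.Mod (fun x => A x ∨ W x) := by
    clear ih
    refine ⟨by grind, ?_⟩
    intro v x y hv hn hx hy e
    have := s10 v x; have := s10 v y; have := s10 v x0
    have := s22 v x x0; have := s22 v x0 y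
    have := a2 v x y; have := a2 v x x0; have := a2 v x0 y
    grind
  have q := ih _ _ mD mA (by grind)
  clear ih
  refine q.s' X W F ⟨s11, ?_⟩ ⟨s21, ?_⟩ s3 s4 s5 ⟨x0, s6⟩ ?_ s9 ?_
  · intro v x y hv hn hx hy; simp only [cut]
    have := s12 v x y
    grind
  · intro v x y hv hn hx hy; simp only [cut]
    have := s22 v x y
    grind
  · intro x y; simp only [cut]; grind
  · intro x y; simp only [cut]; grind

theorem SStep.ss_B {H H' : CG} {X W F D A : Pt → Prop} (s : SStep H H' X W F) (h : MN H D A)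
    (ih : SSH H') (h1 : ∀ x, D x → F x) (h2 : ∀ x, D x → ¬ W x) (h3 : ∀ x, X x → D x ∧ ¬ A x) :
    Pr (H.cut A fun x => D x ∧ ¬ A x) := by
  obtain ⟨⟨d1, d2⟩, ⟨a1, a2⟩, AD, nu, -⟩ := h
  clear nu
  obtain ⟨⟨s11, s12⟩, ⟨s21, s22⟩, s3, s4, s5, ⟨x0, s6⟩, s7, s8, s9, s10⟩ := s
  have c3 := H'.symm
  have c1 := H'.supp
  have c4 := H'.irr
  have mD : H'.Mod (fun x => D x ∨ W x) := by
    clear ih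
    refine ⟨by grind, ?_⟩
    intro v x y hv hn hx hy e
    have := s10 v x; have := s10 v y; have := s10 v x0
    have := s22 v x x0; have := s22 v x0 y
    have := d2 v x y; have := d2 v x x0; have := d2 v x0 y
    grind
  have mA : H'.Mod A := by
    clear ih
    refine ⟨by grind, ?_⟩
    intro v x y hv hn hx hy e
    have := s10 v x; have := s10 v y; have := s10 x0 x; have := s10 x0 y
    have := s22 x x0 v; have := s22 x v x0
    have := s22 y x0 v; have := s22 y v x0
    have := a2 v x y; have := a2 x0 x y
    have := c3 v x; have := c3 y v; have := c3 x v; have := c3 x x0; have := c3 x0 x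
    have := c3 x0 y; have := c3 y x0
    grind
  have q := ih _ _ mD mA (by grind)
  clear ih
  refine q.s' X W F ⟨s11, ?_⟩ ⟨s21, ?_⟩ s3 s4 s5 ⟨x0, s6⟩ ?_ s9 ?_
  · intro v x y hv hn hx hy; simp only [cut]
    have := s12 v x y
    grind
  · intro v x y hv hn hx hy; simp only [cut]
    have := s22 v x y
    grind
  · intro x y; simp only [cut]; grind
  · intro x y; simp only [cut]; grind

theorem SStep.ss_all {H H' : CG} {X W F D A : Pt → Prop} (s : SStep H H' X W F) (h : MN H D A)
    (ih : SSH H') : Pr (H.cut A fun x => D x ∧ ¬ A x) := by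
  have hF := h.alt s.modD
  have hW := h.alt s.modW
  have hX := h.alt s.modX
  have hFW := h.alt s.modDW
  have k1 := s.ss_same h ih
  have k2 := s.ss_A h ih
  have k3 := s.ss_B h ih
  obtain ⟨mD, mA, AD, ⟨a, v, w, e1, e2, e3, e4, e5, e6, e7⟩, -⟩ := h
  obtain ⟨s1, s2, s3, s4, s5, ⟨x0, s6⟩, ⟨w0, s7⟩, s8, s9, s10⟩ := s
  have := s10 v a; have := s10 a v
  have := H'.symm v a
  by_contra hc
  simp only [hc, imp_false] at k1 k2 k3
  have hF' : ∀ x, D x → F x := by grind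
  have hW' : ∀ x, D x → ¬ W x := by
    rcases hW with q | q | q | q
    · grind
    · grind
    · rcases hFW with r | r | r | r <;> grind
    · rcases hFW with r | r | r | r <;> grind
  rcases hX with q | q | q | q
  · grind
  · grind
  · exact k2 hF' hW' q
  · exact k3 hF' hW' q
end GSP

set_option linter.unusedVariables false
set_option maxHeartbeats 4000000
namespace GSP
open CG

theorem MN.ins {H : CG} {D A Q : Pt → Prop} (h : MN H D A) (hQ : H.Mod Q)
    (p1 : Pr (H.res fun x => ¬ Q x)) (p2 : Pr (H.res Q))
    (i1 : SSH (H.res fun x => ¬ Q x)) (i2 : SSH (H.res Q)) :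
    Pr (H.cut A fun x => D x ∧ ¬ A x) := by
  have hc := h.alt hQ
  obtain ⟨⟨d1, d2⟩, ⟨a1, a2⟩, AD, nu, -⟩ := h
  obtain ⟨q1, q2⟩ := hQ
  clear nu
  have c3 := H.symm
  have c1 := H.supp
  by_cases c : ∀ x, D x → Q x
  · have q := i2 D A ⟨by simp only [res]; grind, by intro v x y; simp only [res]; grind⟩
      ⟨by simp only [res]; grind, by intro v x y; simp only [res]; grind⟩ AD
    clear i1 i2
    refine Pr.ins _ Q ⟨q1, ?_⟩ (p1.congr ?_ ?_) (q.congr ?_ ?_)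
    · intro v x y; simp only [cut]; grind
    · intro x; simp only [res, cut]
    · intro x y; simp only [res, cut]; grind
    · intro x; simp only [res, cut]
    · intro x y; simp only [res, cut]; grind
  · have q := i1 (fun x => D x ∧ ¬ Q x) (fun x => A x ∧ ¬ Q x)
      ⟨by simp only [res]; grind, by intro v x y; simp only [res]; grind⟩
      ⟨by simp only [res]; grind, by intro v x y; simp only [res]; grind⟩ (by grind)
    clear i1 i2
    refine Pr.ins _ Q ⟨q1, ?_⟩ (q.congr ?_ ?_) (p2.congr ?_ ?_)
    · intro v x y; simp only [cut]; grind
    · intro x; simp only [res, cut]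
    · intro x y; simp only [res, cut]; grind
    · intro x; simp only [res, cut]
    · intro x y; simp only [res, cut]; grind

theorem MN.block {H : CG} {D A : Pt → Prop} (h : MN H D A) {I p β L} (co : Compo H I p β L)
    (hb : ∀ i ∈ I, Pr (H.res fun x => β x = i)) (ih : ∀ i ∈ I, SSH (H.res fun x => β x = i))
    {i : ℕ} (hi : i ∈ I) (hD : ∀ x, D x → β x = i ∧ L x) :
    Pr (H.cut A fun x => D x ∧ ¬ A x) := by
  obtain ⟨⟨d1, d2⟩, ⟨a1, a2⟩, AD, nu, -⟩ := h
  clear nu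
  have q := ih i hi D A ⟨by simp only [res]; grind, by intro v x y; simp only [res]; grind⟩
      ⟨by simp only [res]; grind, by intro v x y; simp only [res]; grind⟩ AD
  clear ih
  obtain ⟨c1, c2, c3, c4, c5⟩ := co
  refine Pr.gen (I := I) (p := p) (β := β) (L := L) ⟨c1, c2, ?_, ?_, ?_⟩ ?_
  · intro x y; simp only [cut]; grind
  · intro x y; simp only [cut]; grind
  · intro x y; simp only [cut]; grind
  · intro k hk
    by_cases e : k = i
    · subst e
      refine q.congr ?_ ?_
      · intro x; simp only [cut, res]
      · intro x y; simp only [cut, res]; grind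
    · refine (hb k hk).congr ?_ ?_
      · intro x; simp only [cut, res]
      · intro x y; simp only [cut, res]; grind

theorem MN.side {H : CG} {D A : Pt → Prop} (h : MN H D A) {I p β L} (d : PrD H I p β L)
    (hb : ∀ i ∈ I, Pr (H.res fun x => β x = i)) (hD : ∀ x, D x ↔ H.V x ∧ L x) :
    Pr (H.cut A fun x => D x ∧ ¬ A x) := by
  have c3 := H.symm
  have c1 := H.supp
  have c2 := H.supp2
  obtain ⟨mD, mA, AD, ⟨a, v, w, e1, e2, e3, e4, e5, e6, e7⟩, min⟩ := h
  have hAi : ∃ i ∈ I, ∀ x, A x → β x = i ∧ L x := by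
    have := d.alt mA ⟨a, e1⟩
    grind
  obtain ⟨i, hi, hA⟩ := hAi
  obtain ⟨p1, p2, p3, p4, p5⟩ := d.co
  have hA2 : ∀ x, A x ↔ H.V x ∧ β x = i ∧ L x := by
    have := min (fun x => H.V x ∧ β x = i ∧ L x) (by
      refine ⟨by grind, ?_⟩
      intro v x y hv hn hx hy e
      have := p3 v x hv hx.1; have := p3 v y hv hy.1
      have := p5 x v
      have := c3 v x; grind) (by have := mA.1; grind) (by grind)
    have : ∃ k ∈ I, k ≠ i := by
      have := d.prime.1
      by_contra hc
      push Not at hc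
      have : I ⊆ {i} := by intro k hk; simp [hc k hk]
      have := Finset.card_le_card this
      simp at this; omega
    obtain ⟨k, hk, hki⟩ := this
    obtain ⟨z, z1, z2, z3⟩ := d.nl k hk
    have := mA.1
    grind
  -- the intermediate graph
  let G : CG :=
    { V := H.V
      E := fun x y => H.E x y ∧ ¬ (A x ∧ ¬ A y) ∧ ¬ (A y ∧ ¬ A x) ∨
        (A x ∧ H.V y ∧ ¬ L y ∧ β y ≠ i ∧ ¬ p i (β y)) ∨
        (A y ∧ H.V x ∧ ¬ L x ∧ β x ≠ i ∧ ¬ p i (β x))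
      fin := H.fin
      supp := by clear min; have := mA.1; grind
      symm := by clear min; grind
      irr := by clear min; have := H.irr; grind }
  have hG : Pr G := by
    refine Pr.gen (I := I) (p := p) (β := β) (L := fun x => L x ∧ ¬ A x) ⟨p1, p2, ?_, ?_, ?_⟩ ?_
    · intro x y; simp only [G]; grind
    · intro x y; simp only [G]; clear min; have := p1 i (β x); have := p1 (β x) i; grind
    · intro x y; simp only [G]; clear min; grind
    · intro k hk
      refine (hb k hk).congr ?_ ?_
      · intro x; simp only [G, res]
      · intro x y; simp only [G, res]; clear min; 
        have := p5 x y; have := p5 y x; have := c3 x y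
        grind
  obtain ⟨r, r1, r2, r3⟩ := d.nr i hi
  clear min
  have m1 := mA.1
  refine hG.s' (fun x => H.V x ∧ β x = i ∧ ¬ L x) A (fun x => A x ∨ H.V x ∧ ¬ L x) ⟨?_, ?_⟩ ⟨?_, ?_⟩
    (by grind) (by grind) (by grind) ⟨r, r1, r2, r3⟩ ?_ (fun x => Iff.rfl) ?_
  · intro x; simp only [G]; grind
  · intro v x y hv hn hx hy; simp only [G]
    have := p5 v x; have := c3 v x; grind
  · intro x; simp only [G]; grind
  · intro v x y hv hn hx hy; simp only [G]
    have := p4 v x hv; have := p4 v y hv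
    have := p1 i (β v); have := p1 (β v) i
    have := p5 v x; have := c3 v x; have := p5 v y
    have := c1 v x; grind
  · intro x y; simp only [G]; grind
  · intro x y; simp only [G, cut]
    have := p5 x y; have := p5 y x; have := c3 x y
    have := c1 x y; have := c2 x y
    grind

theorem MN.pr {H : CG} {D A : Pt → Prop} (h : MN H D A) {I p β L} (d : PrD H I p β L)
    (hb : ∀ i ∈ I, Pr (H.res fun x => β x = i)) (ih : ∀ i ∈ I, SSH (H.res fun x => β x = i)) :
    Pr (H.cut A fun x => D x ∧ ¬ A x) := by
  have hne : ∃ t, D t := by obtain ⟨_, v, _, _, h2, _⟩ := h.nu; exact ⟨v, h2⟩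
  rcases d.alt h.mD hne with ⟨i, hi, c⟩ | ⟨i, hi, c⟩ | c | c | c
  · exact h.block d.co hb ih hi c
  · exact h.block d.co.swap hb ih hi c
  · exact h.side d hb c
  · exact h.side d.swap hb c
  · exfalso
    have c3 := H.symm
    have p5 := d.co.cross
    have k1 := h.alt (Q := fun x => H.V x ∧ L x) ⟨by grind, by intro v x y; grind⟩
    have k2 := h.alt (Q := fun x => H.V x ∧ ¬ L x) ⟨by grind, by intro v x y; grind⟩
    have hc := d.prime.1
    obtain ⟨i, hi⟩ : I.Nonempty := by rw [← Finset.card_pos]; omega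
    obtain ⟨x, x1, x2, x3⟩ := d.nl i hi
    obtain ⟨y, y1, y2, y3⟩ := d.nr i hi
    obtain ⟨mD, mA, AD, ⟨a, v, w, e1, e2, e3, e4, e5, e6, e7⟩, min⟩ := h
    clear min
    have va := mA.1 a e1
    have := p5 v a; have := p5 a v; have := c3 v a
    grind

theorem ss_all {H : CG} (hP : Pr H) : SSH H := by
  induction hP with
  | empty H h0 =>
    intro D A mD mA AD
    exact Pr.empty _ h0
  | ai H x y hxy hl hV hE =>
    intro D A mD mA AD
    exact Pr.ai _ x y hxy hl hV (fun z w h => hE z w h.1)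
  | s H H' X W F s1 s2 s3 s4 s5 s6 s7 s8 s9 s10 hP ih =>
    intro D A mD mA AD
    refine ss_reduce (Pr.s H H' X W F s1 s2 s3 s4 s5 s6 s7 s8 s9 s10 hP) ?_ _ D A le_rfl mD mA AD
    intro D A h
    exact SStep.ss_all ⟨s1, s2, s3, s4, s5, s6, s7, s8, s9, s10⟩ h ih
  | ins H Q hQ p1 p2 i1 i2 =>
    intro D A mD mA AD
    refine ss_reduce (Pr.ins H Q hQ p1 p2) ?_ _ D A le_rfl mD mA AD
    intro D A h
    exact h.ins hQ p1 p2 i1 i2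
  | pr H I p β L q1 q2 q3 q4 hb ih =>
    intro D A mD mA AD
    refine ss_reduce (Pr.pr H I p β L q1 q2 q3 q4 hb) ?_ _ D A le_rfl mD mA AD
    intro D A h
    exact h.pr ⟨q1, q2, q3, q4⟩ hb ih
end GSP

set_option linter.unusedVariables false
set_option maxHeartbeats 4000000
namespace GSP
open CG

/-- tensor of the blocks with index in `J` -/
def TJ (Y : CG) (β : Pt → ℕ) (J : Finset ℕ) : CG where
  V x := Y.V x ∧ β x ∈ J
  E x y := Y.V x ∧ Y.V y ∧ β x ∈ J ∧ β y ∈ J ∧ (β x = β y → Y.E x y)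
  fin := Y.fin.subset fun _ h => h.1
  supp x y h := ⟨h.1, h.2.2.1⟩
  symm x y h := by have := Y.symm x y; grind
  irr x h := by have := Y.irr x; grind

theorem p_lemma : ∀ (n : ℕ) (J : Finset ℕ), J.card = n → ∀ (Y K : CG) (I : Finset ℕ)
    (p : ℕ → ℕ → Prop) (β : Pt → ℕ) (L : Pt → Prop), J ⊆ I → Compo Y I p β L →
    (∀ x, Y.V x → ¬ K.V x) → (∀ i ∈ J, ∃ x, Y.V x ∧ β x = i) →
    (∀ i ∈ I, i ∉ J → Pr (Y.res fun x => β x = i)) → Pr ((TJ Y β J).par K) → Pr (Y.par K) := by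
  classical
  intro n
  induction n with
  | zero =>
    intro J hJ Y K I p β L hJI co dis hne hb hK
    obtain rfl := Finset.card_eq_zero.1 hJ
    refine Pr.par dis (Pr.gen co fun i hi => hb i hi (by simp)) (hK.congr ?_ ?_)
    · intro x; simp [CG.par, TJ]
    · intro x y; simp [CG.par, TJ]
  | succ n ih =>
    intro J hJ Y K I p β L hJI co dis hne hb hK
    obtain ⟨i, J', hi, rfl, hc⟩ := Finset.card_eq_succ.1 hJ
    obtain ⟨t, t1, t2⟩ := hne i (by simp)
    have k1 := K.supp; have k2 := K.supp2; have k3 := K.symm; have k4 := K.irr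
    have y1 := Y.supp; have y2 := Y.supp2; have y3 := Y.symm; have y4 := Y.irr
    have q := hK.deep (A := fun x => Y.V x ∧ β x = i) (B := fun x => Y.V x ∧ β x ∈ J')
      (T := fun x => Y.V x ∧ β x ∈ insert i J') (N := Y.V) (Y := Y) (t := t)
      (by intro x; simp only [Finset.mem_insert]; grind) (by intro x; grind)
      ⟨by intro x; simp only [CG.par, TJ]; grind, by intro v x y; simp only [CG.par, TJ]; grind⟩
      ⟨t1, by simp [t2]⟩ (by intro x y; simp only [CG.par, TJ, Finset.mem_insert]; grind)
      ⟨t, t1⟩ (by intro x; simp only [CG.par, TJ]; grind) (by grind) (by grind) ?_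
    · refine q.congr ?_ ?_
      · intro x; simp only [CG.par, TJ, sub]; grind
      · intro x y; simp only [CG.par, TJ, sub]; grind
    intro KA KB h1 h2 h3 pA pB
    have a1 := KA.supp; have a2 := KA.supp2; have a3 := KA.symm; have a4 := KA.irr
    have b1 := KB.supp; have b2 := KB.supp2; have b3 := KB.symm; have b4 := KB.irr
    clear hK
    have c1 := co.symm; have c2 := co.mem; have c3 := co.left; have c4 := co.right
    have c5 := co.cross
    let Z : CG :=
      { V := fun x => Y.V x ∨ KA.V x
        E := fun x y => Y.E x y ∨ KA.E x y ∨
          (KA.V x ∧ Y.V y ∧ L y ∧ β y ≠ i ∧ p i (β y)) ∨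
          (KA.V y ∧ Y.V x ∧ L x ∧ β x ≠ i ∧ p i (β x))
        fin := Y.fin.union KA.fin
        supp := by grind
        symm := by grind
        irr := by grind }
    obtain ⟨γ, g1, g2⟩ : ∃ γ : Pt → ℕ, (∀ x, KA.V x → γ x = i) ∧ (∀ x, ¬ KA.V x → γ x = β x) :=
      ⟨fun x => if KA.V x then i else β x, by intro x hx; simp [hx], by intro x hx; simp [hx]⟩
    have hiI : i ∈ I := hJI (by simp)
    have r : Pr (Z.par KB) := by
      refine ih J' hc Z KB I p γ (fun x => KA.V x ∨ L x) (fun x hx => hJI (by simp [hx]))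
        ⟨c1, ?_, ?_, ?_, ?_⟩ ?_ ?_ ?_ (pB.congr ?_ ?_)
      · intro x; simp only [Z]; grind
      · intro x y; simp only [Z]; clear ih pA pB hb;
        by_cases u1 : KA.V x <;> by_cases u2 : KA.V y <;> grind
      · intro x y; simp only [Z]; clear ih pA pB hb;
        by_cases u1 : KA.V x <;> by_cases u2 : KA.V y <;> grind
      · intro x y; simp only [Z]; clear ih pA pB hb;
        by_cases u1 : KA.V x <;> by_cases u2 : KA.V y <;> grind
      · intro x; simp only [Z]; grind
      · intro j hj
        obtain ⟨x, hx, hx2⟩ := hne j (by simp [hj])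
        exact ⟨x, Or.inl hx, by grind⟩
      · intro j hj hjJ
        by_cases e : j = i
        · subst e
          refine pA.congr ?_ ?_
          · intro x; simp only [CG.par, res, Z, TJ, Finset.mem_insert]; clear ih pA pB hb; grind
          · intro x y; simp only [CG.par, res, Z, TJ, Finset.mem_insert]; clear ih pA pB hb;
            by_cases u1 : KA.V x <;> by_cases u2 : KA.V y <;> grind
        · refine (hb j hj (by simp [e, hjJ])).congr ?_ ?_
          · intro x; simp only [res, Z]; clear ih pA pB hb; grind
          · intro x y; simp only [res, Z]; clear ih pA pB hb;
            by_cases u1 : KA.V x <;> by_cases u2 : KA.V y <;> grind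
      · intro x; simp only [CG.par, res, Z, TJ, Finset.mem_insert]; clear ih pA pB hb; grind
      · intro x y; simp only [CG.par, res, Z, TJ, Finset.mem_insert]; clear ih pA pB hb;
        by_cases u1 : KA.V x <;> by_cases u2 : KA.V y <;> grind
    clear ih pA pB hb
    refine (ss_all r (fun x => KA.V x ∨ Y.V x ∧ L x) KA.V ⟨?_, ?_⟩ ⟨?_, ?_⟩ ?_).congr ?_ ?_
    · intro x; simp only [CG.par, Z]; grind
    · intro v x y; simp only [CG.par, Z]; grind
    · intro x; simp only [CG.par, Z]; grind
    · intro v x y; simp only [CG.par, Z]; grind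
    · grind
    · intro x; simp only [CG.par, Z, cut]; grind
    · intro x y; simp only [CG.par, Z, cut]; 
      by_cases u1 : KA.V x <;> by_cases u2 : KA.V y <;> grind

theorem Pr.p {H : CG} (hP : Pr H) {T : Pt → Prop} {t : Pt} {Y : CG} {I p β L}
    (mod : H.Mod T) (ht : T t) (hV : ∀ x, Y.V x ↔ T x) (co : Compo Y I p β L)
    (hne : ∀ i ∈ I, ∃ x, Y.V x ∧ β x = i)
    (h1 : ∀ x y, T x → T y → β x = β y → (H.E x y ↔ Y.E x y))
    (h2 : ∀ x y, T x → T y → β x ≠ β y → H.E x y) : Pr (H.sub T t Y) := by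
  refine hP.ctx (N := T) mod ht ⟨t, (hV t).2 ht⟩ (by grind) (by grind) (by grind) ?_
  intro K k1 k2
  refine p_lemma I.card I rfl Y K I p β L (Finset.Subset.refl _) co ?_ hne (by grind) (k2.congr ?_ ?_)
  · grind
  · have := co.mem; have := mod.1; intro x; simp only [CG.par, res, TJ]; grind
  · have := co.mem; have := mod.1; intro x y; simp only [CG.par, res, TJ]; grind

theorem W_lemma {H : CG} (hdual : ∀ a : Atom, dualAtom (dualAtom a) = a) (hP : Pr H) :
    ∀ v, H.V v → ∃ w, w ≠ v ∧ H.V w ∧ w.2 = dualAtom v.2 ∧ Pr (H.res fun x => x ≠ v ∧ x ≠ w) := by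
  induction hP with
  | empty H h0 => intro v hv; exact absurd hv (h0 v)
  | ai H x y hxy hl hV hE =>
    intro v hv
    rcases (hV v).1 hv with rfl | rfl
    · exact ⟨y, hxy.symm, (hV y).2 (Or.inr rfl), hl, Pr.empty _ (by simp only [res]; grind)⟩
    · exact ⟨x, hxy, (hV x).2 (Or.inl rfl), by rw [hl, hdual], Pr.empty _ (by simp only [res]; grind)⟩
  | s H H' X W F s1 s2 s3 s4 s5 s6 s7 s8 s9 s10 hP ih =>
    intro v hv
    obtain ⟨w, w1, w2, w3, w4⟩ := ih v ((s9 v).1 hv)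
    refine ⟨w, w1, (s9 w).2 w2, w3, ?_⟩
    obtain ⟨s11, s12⟩ := s1
    obtain ⟨s21, s22⟩ := s2
    clear ih hP
    by_cases c : ∃ x, X x ∧ x ≠ v ∧ x ≠ w
    · obtain ⟨x0, x1, x2, x3⟩ := c
      refine w4.s' (fun x => X x ∧ x ≠ v ∧ x ≠ w) (fun x => W x ∧ x ≠ v ∧ x ≠ w)
        (fun x => F x ∧ x ≠ v ∧ x ≠ w) ⟨?_, ?_⟩ ⟨?_, ?_⟩ (by grind) (by grind) (by grind)
        ⟨x0, x1, x2, x3⟩ ?_ ?_ ?_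
      · intro x; simp only [res]; grind
      · intro v x y; simp only [res]; grind
      · intro x; simp only [res]; grind
      · intro v x y; simp only [res]; grind
      · intro x y; simp only [res]; grind
      · intro x; simp only [res]; grind
      · intro x y; simp only [res]; grind
    · push Not at c
      refine (ss_all w4 (fun x => F x ∧ x ≠ v ∧ x ≠ w) (fun x => W x ∧ x ≠ v ∧ x ≠ w)
        ⟨?_, ?_⟩ ⟨?_, ?_⟩ (by grind)).congr ?_ ?_
      · intro x; simp only [res]; grind
      · intro v x y; simp only [res]; grind
      · intro x; simp only [res]; grind
      · intro v x y; simp only [res]; grind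
      · intro x; simp only [res, cut]; grind
      · intro x y; simp only [res, cut]; grind
  | ins H Q hQ p1 p2 i1 i2 =>
    intro v hv
    obtain ⟨q1, q2⟩ := hQ
    by_cases c : Q v
    · obtain ⟨w, w1, w2, w3, w4⟩ := i2 v ⟨hv, c⟩
      have w5 := w2.2
      refine ⟨w, w1, w2.1, w3, Pr.ins _ (fun x => Q x ∧ x ≠ v ∧ x ≠ w) ⟨?_, ?_⟩
        (p1.congr ?_ ?_) (w4.congr ?_ ?_)⟩
      · intro x; simp only [res]; grind
      · intro v x y; simp only [res]; grind
      · intro x; simp only [res]; grind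
      · intro x y; simp only [res]; grind
      · intro x; simp only [res]; grind
      · intro x y; simp only [res]; grind
    · obtain ⟨w, w1, w2, w3, w4⟩ := i1 v ⟨hv, c⟩
      have w5 := w2.2
      refine ⟨w, w1, w2.1, w3, Pr.ins _ (fun x => Q x ∧ x ≠ v ∧ x ≠ w) ⟨?_, ?_⟩
        (w4.congr ?_ ?_) (p2.congr ?_ ?_)⟩
      · intro x; simp only [res]; grind
      · intro v x y; simp only [res]; grind
      · intro x; simp only [res]; grind
      · intro x y; simp only [res]; grind
      · intro x; simp only [res]; grind
      · intro x y; simp only [res]; grind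
  | pr H I p β L q1 q2 q3 q4 hb ih =>
    intro v hv
    obtain ⟨c1, c2, c3, c4, c5⟩ := q2
    obtain ⟨w, w1, w2, w3, w4⟩ := ih (β v) (c2 v hv) v ⟨hv, rfl⟩
    have w5 := w2.2
    refine ⟨w, w1, w2.1, w3, ?_⟩
    clear ih
    refine Pr.gen (I := I) (p := p) (β := β) (L := L) ⟨c1, ?_, ?_, ?_, ?_⟩ ?_
    · intro x; simp only [res]; grind
    · intro x y; simp only [res]; grind
    · intro x y; simp only [res]; grind
    · intro x y; simp only [res]; grind
    · intro k hk
      by_cases e : k = β v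
      · subst e
        refine w4.congr ?_ ?_
        · intro x; simp only [res]; grind
        · intro x y; simp only [res]; grind
      · refine (hb k hk).congr ?_ ?_
        · intro x; simp only [res]; grind
        · intro x y; simp only [res]; grind
end GSP

set_option linter.unusedVariables false
set_option maxHeartbeats 4000000
namespace GSP
open CG

/-! ## From derivations to `Pr` -/

structure Emb (G : LGraph) (f : G.V → Pt) : Prop where
  inj : Function.Injective f
  lab : ∀ v, (f v).2 = G.label v

def im (G : LGraph) (f : G.V → Pt) (h : Emb G f) : CG where
  V x := ∃ v, f v = x
  E x y := ∃ v w, f v = x ∧ f w = y ∧ G.adj v w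
  fin := Set.finite_range f
  supp := by rintro x y ⟨v, w, h1, h2, h3⟩; exact ⟨v, h1⟩
  symm := by rintro x y ⟨v, w, h1, h2, h3⟩; exact ⟨w, v, h2, h1, G.symm h3⟩
  irr := by
    rintro x ⟨v, w, h1, h2, h3⟩
    obtain rfl := h.inj (h1.trans h2.symm)
    exact G.irrefl _ h3

def SProv (G : LGraph) : Prop := ∃ f, ∃ h : Emb G f, Pr (im G f h)

theorem im_E {G : LGraph} {f h} (v w : G.V) : (im G f h).E (f v) (f w) ↔ G.adj v w := by
  constructor
  · rintro ⟨a, b, h1, h2, h3⟩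
    rw [h.inj h1, h.inj h2] at h3; exact h3
  · intro h3; exact ⟨v, w, rfl, rfl, h3⟩

theorem im_V {G : LGraph} {f h} (v : G.V) : (im G f h).V (f v) := ⟨v, rfl⟩

theorem Pr.toSProv {G : LGraph} {H : CG} (f : G.V → Pt) (h : Emb G f) (hP : Pr H)
    (hV : ∀ x, H.V x ↔ ∃ v, f v = x) (hE : ∀ v w, H.E (f v) (f w) ↔ G.adj v w) : SProv G := by
  refine ⟨f, h, hP.congr hV ?_⟩
  intro x y
  constructor
  · intro e
    obtain ⟨v, rfl⟩ := (hV x).1 (H.supp _ _ e)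
    obtain ⟨w, rfl⟩ := (hV y).1 (H.supp2 _ _ e)
    exact (im_E v w).2 ((hE v w).1 e)
  · rintro ⟨v, w, rfl, rfl, e⟩
    exact (hE v w).2 e

theorem SProv.iso {G G' : LGraph} (e : G.iso G') (h : SProv G) : SProv G' := by
  obtain ⟨e⟩ := e
  obtain ⟨f, hf, hP⟩ := h
  refine hP.toSProv (fun v => f (e.toEquiv.symm v)) ⟨?_, ?_⟩ ?_ ?_
  · intro a b hab; exact e.toEquiv.symm.injective (hf.inj hab)
  · intro v
    have := e.label_eq (e.toEquiv.symm v)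
    rw [hf.lab]; simpa using this.symm
  · intro x
    constructor
    · rintro ⟨v, rfl⟩; exact ⟨e.toEquiv v, by simp⟩
    · rintro ⟨v, rfl⟩; exact ⟨_, rfl⟩
  · intro v w
    rw [im_E, e.adj_iff]; simp

theorem LGraph.iso_symm {G G' : LGraph} (e : G.iso G') : G'.iso G := by
  obtain ⟨e⟩ := e
  refine ⟨⟨e.toEquiv.symm, ?_, ?_⟩⟩
  · intro v w; rw [e.adj_iff]; simp
  · intro v; have := e.label_eq (e.toEquiv.symm v); simpa using this.symm

theorem LGraph.iso_trans {G G' G'' : LGraph} (e : G.iso G') (e' : G'.iso G'') : G.iso G'' := by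
  obtain ⟨e⟩ := e
  obtain ⟨e'⟩ := e'
  refine ⟨⟨e.toEquiv.trans e'.toEquiv, ?_, ?_⟩⟩
  · intro v w; rw [e.adj_iff, e'.adj_iff]; rfl
  · intro v; rw [← e.label_eq, ← e'.label_eq]; rfl

theorem SProv.ai {C : LGraph} {R : Set C.V} {a : Atom}
    (h : SProv (C.plug R LGraph.empty)) :
    SProv (C.plug R ((LGraph.single (dualAtom a)).par (LGraph.single a))) := by
  obtain ⟨f, hf, hP⟩ := h
  obtain ⟨N, hN⟩ : ∃ N, ∀ v, (f v).1 < N := by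
    obtain ⟨N, hN⟩ := (Set.finite_range fun v => (f v).1).bddAbove
    exact ⟨N + 1, fun v => Nat.lt_succ_of_le (hN ⟨v, rfl⟩)⟩
  let x : Pt := (N, dualAtom a)
  let y : Pt := (N + 1, a)
  let g : (C.plug R ((LGraph.single (dualAtom a)).par (LGraph.single a))).V → Pt := fun v =>
    match v with
    | .inl v => f (.inl v)
    | .inr (.inl _) => x
    | .inr (.inr _) => y
  have hxy : x ≠ y := by intro e; have := congrArg Prod.fst e; simp [x, y] at this
  have hx : ∀ v, f v ≠ x := by intro v e; have := hN v; rw [e] at this; simp [x] at this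
  have hy : ∀ v, f v ≠ y := by intro v e; have := hN v; rw [e] at this; simp [y] at this
  have hg : Emb _ g := by
    constructor
    · rintro (v | v | v) (w | w | w) e
      · exact congrArg _ (Sum.inl_injective (hf.inj e))
      · exact absurd e (hx _)
      · exact absurd e (hy _)
      · exact absurd e.symm (hx _)
      · rfl
      · exact absurd e hxy
      · exact absurd e.symm (hy _)
      · exact absurd e.symm hxy
      · rfl
    · rintro (v | v | v)
      · exact hf.lab (.inl v)
      · rfl
      · rfl
  refine ⟨g, hg, Pr.ins _ (fun z => z = x ∨ z = y) ⟨?_, ?_⟩ (hP.congr ?_ ?_) (Pr.ai _ y x hxy.symm rfl ?_ ?_)⟩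
  · rintro z (rfl | rfl)
    · exact ⟨.inr (.inl ()), rfl⟩
    · exact ⟨.inr (.inr ()), rfl⟩
  · rintro v z w ⟨v, rfl⟩ hv hz hw
    have hz' : ∃ u, z = g (.inr u) := by
      rcases hz with rfl | rfl
      exacts [⟨.inl (), rfl⟩, ⟨.inr (), rfl⟩]
    have hw' : ∃ u, w = g (.inr u) := by
      rcases hw with rfl | rfl
      exacts [⟨.inl (), rfl⟩, ⟨.inr (), rfl⟩]
    obtain ⟨z, rfl⟩ := hz'
    obtain ⟨w, rfl⟩ := hw'
    intro e
    have e := (im_E (h := hg) v (.inr z)).1 e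
    refine (im_E (h := hg) v (.inr w)).2 ?_
    rcases v with v | v | v
    · exact e
    · exact absurd (Or.inl rfl) hv
    · exact absurd (Or.inr rfl) hv
  · intro z
    constructor
    · rintro ⟨v | v, rfl⟩
      · exact ⟨⟨.inl v, rfl⟩, fun h => h.elim (hx _) (hy _)⟩
      · exact v.elim
    · rintro ⟨⟨v | v | v, rfl⟩, hv⟩
      · exact ⟨.inl v, rfl⟩
      · exact absurd (Or.inl rfl) hv
      · exact absurd (Or.inr rfl) hv
  · intro z w
    constructor
    · rintro ⟨v | v, w | w, rfl, rfl, e⟩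
      · exact ⟨⟨.inl v, .inl w, rfl, rfl, e⟩, fun h => h.elim (hx _) (hy _), fun h => h.elim (hx _) (hy _)⟩
      · exact w.elim
      · exact v.elim
      · exact v.elim
    · rintro ⟨⟨v | v | v, w | w | w, rfl, rfl, e⟩, hv, hw⟩
      · exact ⟨.inl v, .inl w, rfl, rfl, e⟩
      · exact absurd (Or.inl rfl) hw
      · exact absurd (Or.inr rfl) hw
      · exact absurd (Or.inl rfl) hv
      · exact absurd (Or.inl rfl) hv
      · exact absurd (Or.inl rfl) hv
      · exact absurd (Or.inr rfl) hv
      · exact absurd (Or.inr rfl) hv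
      · exact absurd (Or.inr rfl) hv
  · intro z
    constructor
    · rintro ⟨_, h⟩; exact h.symm
    · intro h
      refine ⟨?_, h.symm⟩
      rcases h with rfl | rfl
      exacts [⟨.inr (.inr ()), rfl⟩, ⟨.inr (.inl ()), rfl⟩]
  · rintro z w ⟨e, hz, hw⟩
    rcases hz with rfl | rfl <;> rcases hw with rfl | rfl
    · exact (im_E (G := C.plug R _) (h := hg) (.inr (.inl ())) (.inr (.inl ()))).1 e
    · exact (im_E (G := C.plug R _) (h := hg) (.inr (.inl ())) (.inr (.inr ()))).1 e
    · exact (im_E (G := C.plug R _) (h := hg) (.inr (.inr ())) (.inr (.inl ()))).1 e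
    · exact (im_E (G := C.plug R _) (h := hg) (.inr (.inr ())) (.inr (.inr ()))).1 e

theorem im_mod_inr {C : LGraph} {R : Set C.V} {X : LGraph} {f} (h : Emb (C.plug R X) f) :
    (im _ f h).Mod fun x => ∃ v, f (.inr v) = x := by
  refine ⟨?_, ?_⟩
  · rintro x ⟨v, rfl⟩; exact ⟨_, rfl⟩
  · rintro v x y ⟨v, rfl⟩ hv ⟨x, rfl⟩ ⟨y, rfl⟩
    intro e
    have e := (im_E (h := h) v (.inr x)).1 e
    refine (im_E (h := h) v (.inr y)).2 ?_
    rcases v with v | v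
    · exact e
    · exact absurd ⟨v, rfl⟩ hv

theorem SProv.ss {C : LGraph} {R : Set C.V} {A B : LGraph} {S : Set B.V}
    (h : SProv (C.plug R (B.plug S A))) : SProv (C.plug R (B.par A)) := by
  obtain ⟨f, hf, hP⟩ := h
  change C.V ⊕ (B.V ⊕ A.V) → Pt at f
  have inj : ∀ a b, f a = f b ↔ a = b := fun a b => hf.inj.eq_iff
  have := ss_all hP (fun x => ∃ v, f (.inr v) = x) (fun x => ∃ v, f (.inr (.inr v)) = x)
    (im_mod_inr hf) ?_ ?_
  · refine this.toSProv (G := C.plug R (B.par A)) f ⟨hf.inj, hf.lab⟩ (fun x => Iff.rfl) ?_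
    intro v w
    have hE := im_E (h := hf) v w
    change C.V ⊕ (B.V ⊕ A.V) at v w
    simp only [cut, hE, inj]
    rcases v with v | v | v <;> rcases w with w | w | w <;>
      simp [LGraph.plug, LGraph.plugAdj, LGraph.par, LGraph.parAdj]
  · refine ⟨?_, ?_⟩
    · rintro x ⟨v, rfl⟩; exact ⟨_, rfl⟩
    · rintro v x y ⟨v, rfl⟩ hv ⟨x, rfl⟩ ⟨y, rfl⟩
      intro e
      have e := (im_E (h := hf) v (.inr (.inr x))).1 e
      refine (im_E (h := hf) v (.inr (.inr y))).2 ?_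
      rcases v with v | v | v
      · exact e
      · exact e
      · exact absurd ⟨v, rfl⟩ hv
  · rintro x ⟨v, rfl⟩; exact ⟨_, rfl⟩
end GSP

set_option linter.unusedVariables false
set_option maxHeartbeats 4000000
namespace GSP
open CG

def tinj : (n : ℕ) → (F : Fin n → LGraph) → (i : Fin n) → (F i).V → (bigTensor n F).V
  | 0, _, i, _ => i.elim0
  | n + 1, F, i, a => Fin.cases (motive := fun i => (F i).V → (bigTensor (n + 1) F).V)
      (fun a => Sum.inl a) (fun j a => Sum.inr (tinj n (fun i => F i.succ) j a)) i a

theorem tinj_surj : ∀ (n : ℕ) (F : Fin n → LGraph) (u : (bigTensor n F).V), ∃ i a, tinj n F i a = u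
  | 0, _, u => u.elim
  | n + 1, F, .inl a => ⟨0, a, rfl⟩
  | n + 1, F, .inr u => by
    obtain ⟨i, a, rfl⟩ := tinj_surj n (fun i => F i.succ) u
    exact ⟨i.succ, a, rfl⟩

theorem tinj_lab : ∀ (n : ℕ) (F : Fin n → LGraph) (i : Fin n) (a : (F i).V),
    (bigTensor n F).label (tinj n F i a) = (F i).label a
  | 0, _, i, _ => i.elim0
  | n + 1, F, i, a => by
    induction i using Fin.cases with
    | zero => rfl
    | succ i => exact tinj_lab n (fun i => F i.succ) i a

theorem tinj_same : ∀ (n : ℕ) (F : Fin n → LGraph) (i : Fin n) (a b : (F i).V),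
    (bigTensor n F).adj (tinj n F i a) (tinj n F i b) ↔ (F i).adj a b
  | 0, _, i, _, _ => i.elim0
  | n + 1, F, i, a, b => by
    induction i using Fin.cases with
    | zero => exact Iff.rfl
    | succ i => exact tinj_same n (fun i => F i.succ) i a b

theorem tinj_ne : ∀ (n : ℕ) (F : Fin n → LGraph) (i j : Fin n) (a : (F i).V) (b : (F j).V),
    i ≠ j → (bigTensor n F).adj (tinj n F i a) (tinj n F j b)
  | 0, _, i, _, _, _ => i.elim0
  | n + 1, F, i, j, a, b => by
    intro h
    induction i using Fin.cases with
    | zero =>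
      induction j using Fin.cases with
      | zero => exact absurd rfl h
      | succ j => exact trivial
    | succ i =>
      induction j using Fin.cases with
      | zero => exact trivial
      | succ j => exact tinj_ne n (fun i => F i.succ) i j a b (fun e => h (congrArg _ e))

theorem tinj_inj_same : ∀ (n : ℕ) (F : Fin n → LGraph) (i : Fin n) (a b : (F i).V),
    tinj n F i a = tinj n F i b → a = b
  | 0, _, i, _, _ => i.elim0
  | n + 1, F, i, a, b => by
    intro h
    induction i using Fin.cases with
    | zero => exact Sum.inl_injective h
    | succ i => exact tinj_inj_same n (fun i => F i.succ) i a b (Sum.inr_injective h)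

theorem tinj_inj (n : ℕ) (F : Fin n → LGraph) (i j : Fin n) (a : (F i).V) (b : (F j).V)
    (h : tinj n F i a = tinj n F j b) : i = j := by
  by_contra hn
  have := tinj_ne n F i j a b hn
  rw [h] at this
  exact (bigTensor n F).irrefl _ this

theorem comp_same (P : LGraph) (H : P.V → LGraph) (v : P.V) (a b : (H v).V) :
    (P.comp H).adj ⟨v, a⟩ ⟨v, b⟩ ↔ (H v).adj a b := by
  constructor
  · rintro (⟨w, x, y, h1, h2, h3⟩ | ⟨h, _⟩)
    · cases h1; cases h2; exact h3
    · exact absurd rfl h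
  · intro h; exact Or.inl ⟨v, a, b, rfl, rfl, h⟩

theorem comp_ne (P : LGraph) (H : P.V → LGraph) (v w : P.V) (a : (H v).V) (b : (H w).V)
    (hn : v ≠ w) : (P.comp H).adj ⟨v, a⟩ ⟨w, b⟩ ↔ P.adj v w := by
  constructor
  · rintro (⟨u, x, y, h1, h2, h3⟩ | ⟨_, h⟩)
    · cases h1; cases h2; exact absurd rfl hn
    · exact h
  · intro h; exact Or.inr ⟨hn, h⟩

theorem SProv.p {C : LGraph} {R : Set C.V} (n : ℕ) (P : LGraph) (e : P.V ≃ Fin n)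
    (M N : Fin n → LGraph) (h4 : 4 ≤ n) (hM : ∀ i, Nonempty (M i).V)
    (h : SProv (C.plug R (bigTensor n fun i => (M i).par (N i)))) :
    SProv (C.plug R ((P.dual.comp fun v => M (e v)).par (P.comp fun v => N (e v)))) := by
  classical
  let F : Fin n → LGraph := fun i => (M i).par (N i)
  change SProv (C.plug R (bigTensor n F)) at h
  obtain ⟨f, hf, hP⟩ := h
  change C.V ⊕ (bigTensor n F).V → Pt at f
  let φ : (i : Fin n) → (M i).V ⊕ (N i).V → (bigTensor n F).V := tinj n F
  let c := (P.dual.comp fun v => M (e v)).par (P.comp fun v => N (e v))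
  let idx : c.V → P.V := fun z =>
    match z with
    | .inl z => z.1
    | .inr z => z.1
  let val : (z : c.V) → (M (e (idx z))).V ⊕ (N (e (idx z))).V := fun z =>
    match z with
    | .inl z => .inl z.2
    | .inr z => .inr z.2
  let k : c.V → Pt := fun z => f (.inr (φ (e (idx z)) (val z)))
  let g : (C.plug R c).V → Pt := fun v =>
    match v with
    | .inl v => f (.inl v)
    | .inr z => k z
  have kinj : Function.Injective k := by
    intro z w h
    have h := Sum.inr_injective (hf.inj h)
    have hi := tinj_inj n F _ _ _ _ h
    have hi := e.injective hi
    rcases z with ⟨v, a⟩ | ⟨v, a⟩ <;> rcases w with ⟨w, b⟩ | ⟨w, b⟩ <;>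
      (change v = w at hi; subst hi; have h' := tinj_inj_same n F _ _ _ h)
    · have := Sum.inl_injective h'
      change a = b at this
      rw [this]
    · exact absurd h' Sum.inl_ne_inr
    · exact absurd h' Sum.inr_ne_inl
    · have := Sum.inr_injective h'
      change a = b at this
      rw [this]
  have ksurj : ∀ u, ∃ z, k z = f (.inr u) := by
    intro u
    obtain ⟨i, a, rfl⟩ := tinj_surj n F u
    obtain ⟨v, rfl⟩ := e.surjective i
    rcases a with a | a
    · exact ⟨.inl ⟨v, a⟩, rfl⟩
    · exact ⟨.inr ⟨v, a⟩, rfl⟩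
  have klab : ∀ z, (k z).2 = c.label z := by
    intro z
    refine (hf.lab _).trans ((tinj_lab n F _ _).trans ?_)
    rcases z with ⟨v, a⟩ | ⟨v, a⟩ <;> rfl
  have hk : Emb c k := ⟨kinj, klab⟩
  have hg : Emb (C.plug R c) g := by
    constructor
    · rintro (v | v) (w | w) h
      · exact congrArg _ (Sum.inl_injective (hf.inj h))
      · exact absurd (hf.inj h) Sum.inl_ne_inr
      · exact absurd (hf.inj h) Sum.inr_ne_inl
      · exact congrArg _ (kinj h)
    · rintro (v | v)
      · exact hf.lab (.inl v)
      · exact klab v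
  obtain ⟨β, hβ⟩ : ∃ β : Pt → ℕ, ∀ z, β (k z) = (e (idx z) : ℕ) :=
    ⟨Function.extend k (fun z => (e (idx z) : ℕ)) (fun _ => 0), fun z => kinj.extend_apply _ _ z⟩
  let L : Pt → Prop := fun x => ∃ z, k (.inr z) = x
  have Lr : ∀ z, L (k (.inr z)) := fun z => ⟨z, rfl⟩
  have Ll : ∀ z, ¬ L (k (.inl z)) := by
    rintro z ⟨w, h⟩
    have := @kinj (.inr w) (.inl z) h
    exact absurd this Sum.inr_ne_inl
  let q : ℕ → ℕ → Prop := fun i j => ∃ v w, (e v : ℕ) = i ∧ (e w : ℕ) = j ∧ P.adj v w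
  have hq : ∀ v w, q (e v) (e w) ↔ P.adj v w := by
    intro v w
    constructor
    · rintro ⟨v', w', h1, h2, h3⟩
      rw [e.injective (Fin.ext h1), e.injective (Fin.ext h2)] at h3
      exact h3
    · intro h; exact ⟨v, w, rfl, rfl, h⟩
  have hne : ∀ v w, (e v : ℕ) ≠ (e w : ℕ) → v ≠ w := by rintro v w h rfl; exact h rfl
  have HE : ∀ z w, (im (C.plug R (bigTensor n F)) f hf).E (k z) (k w) ↔
      (bigTensor n F).adj (φ (e (idx z)) (val z)) (φ (e (idx w)) (val w)) := by
    intro z w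
    exact im_E (G := C.plug R (bigTensor n F)) (h := hf) (.inr (φ (e (idx z)) (val z))) (.inr (φ (e (idx w)) (val w)))
  have HEc : ∀ v z, (im (C.plug R (bigTensor n F)) f hf).E (f (.inl v)) (k z) ↔ v ∈ R := by
    intro v z
    exact im_E (G := C.plug R (bigTensor n F)) (h := hf) (.inl v) (.inr (φ (e (idx z)) (val z)))
  have YE := fun z w => im_E (h := hk) z w
  obtain ⟨t0⟩ := hM (e (e.symm ⟨0, by omega⟩))
  let z0 : c.V := .inl ⟨e.symm ⟨0, by omega⟩, t0⟩
  have fin := hP.p (Y := im c k hk) (I := Finset.range n) (p := q) (β := β) (L := L)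
    (im_mod_inr hf) (t := k z0) ⟨_, rfl⟩ ?_ ⟨?_, ?_, ?_, ?_, ?_⟩ ?_ ?_ ?_
  · refine fin.toSProv g hg ?_ ?_
    · intro x
      constructor
      · rintro (⟨⟨v | v, rfl⟩, hv⟩ | ⟨z, rfl⟩)
        · exact ⟨.inl v, rfl⟩
        · exact absurd ⟨v, rfl⟩ hv
        · exact ⟨.inr z, rfl⟩
      · rintro ⟨v | v, rfl⟩
        · refine Or.inl ⟨⟨.inl v, rfl⟩, ?_⟩
          rintro ⟨u, hu⟩
          exact absurd (hf.inj hu) Sum.inr_ne_inl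
        · exact Or.inr ⟨v, rfl⟩
    · have nT : ∀ v : C.V, ¬ ∃ u, f (.inr u) = f (.inl v) := by
        rintro v ⟨u, hu⟩; exact absurd (hf.inj hu) Sum.inr_ne_inl
      have yT : ∀ z, ∃ u, f (.inr u) = k z := fun z => ⟨_, rfl⟩
      have nY : ∀ v : C.V, ¬ ∃ z, k z = f (.inl v) := by
        rintro v ⟨u, hu⟩; exact absurd (hf.inj hu) Sum.inr_ne_inl
      have nYE1 : ∀ (v : C.V) x, ¬ (im c k hk).E (f (.inl v)) x :=
        fun v x h => nY v ((im c k hk).supp _ _ h)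
      have nYE2 : ∀ (v : C.V) x, ¬ (im c k hk).E x (f (.inl v)) :=
        fun v x h => nY v ((im c k hk).supp2 _ _ h)
      have ne1 : ∀ (v : C.V) z, f (.inl v) ≠ k z := fun v z h => nY v ⟨z, h.symm⟩
      rintro (v | v) (w | w)
      · have := im_E (G := C.plug R (bigTensor n F)) (h := hf) (.inl v) (.inl w)
        have irr := (im (C.plug R (bigTensor n F)) f hf).irr
        change (f (.inl v) ≠ f (.inl w) ∧ _) ↔ C.adj v w
        constructor
        · rintro ⟨_, h | h | h | h⟩
          · exact this.1 h.1
          · exact absurd h (nYE1 _ _)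
          · exact absurd h.1 (nY _)
          · exact absurd h.1 (nY _)
        · intro h
          refine ⟨fun he => ?_, Or.inl ⟨this.2 h, nT _, nT _⟩⟩
          have := this.2 h
          rw [he] at this
          exact irr _ this
      · change (f (.inl v) ≠ k w ∧ _) ↔ v ∈ R
        constructor
        · rintro ⟨_, h | h | h | h⟩
          · exact absurd (yT w) h.2.2
          · exact absurd h (nYE1 _ _)
          · exact absurd h.1 (nY _)
          · exact (HEc v z0).1 ((im (C.plug R (bigTensor n F)) f hf).symm _ _ h.2.2)
        · intro h
          exact ⟨ne1 _ _, Or.inr (Or.inr (Or.inr ⟨⟨w, rfl⟩, nT v, (im (C.plug R (bigTensor n F)) f hf).symm _ _ ((HEc v z0).2 h)⟩))⟩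
      · change (k v ≠ f (.inl w) ∧ _) ↔ w ∈ R
        constructor
        · rintro ⟨_, h | h | h | h⟩
          · exact absurd (yT v) h.2.1
          · exact absurd h (nYE2 _ _)
          · exact (HEc w z0).1 ((im (C.plug R (bigTensor n F)) f hf).symm _ _ h.2.2)
          · exact absurd h.1 (nY _)
        · intro h
          exact ⟨(ne1 _ _).symm, Or.inr (Or.inr (Or.inl ⟨⟨v, rfl⟩, nT w, (im (C.plug R (bigTensor n F)) f hf).symm _ _ ((HEc w z0).2 h)⟩))⟩
      · change (k v ≠ k w ∧ _) ↔ c.adj v w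
        constructor
        · rintro ⟨_, h | h | h | h⟩
          · exact absurd (yT v) h.2.1
          · exact (YE _ _).1 h
          · exact absurd (yT w) h.2.1
          · exact absurd (yT v) h.2.1
        · intro h
          refine ⟨fun he => ?_, Or.inr (Or.inl ((YE _ _).2 h))⟩
          obtain rfl := kinj he
          exact c.irrefl _ h
  · intro x
    constructor
    · rintro ⟨z, rfl⟩; exact ⟨_, rfl⟩
    · rintro ⟨u, rfl⟩; exact ksurj u
  · rintro i j ⟨v, w, h1, h2, h3⟩; exact ⟨w, v, h2, h1, P.symm h3⟩
  · rintro x ⟨z, rfl⟩; rw [hβ]; simp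
  · rintro x y ⟨z, rfl⟩ ⟨w, rfl⟩ hn h1 h2
    rw [hβ, hβ] at hn
    rw [YE, hβ, hβ, hq]
    rcases z with z | z
    · exact absurd h1 (Ll z)
    rcases w with w | w
    · exact absurd h2 (Ll w)
    exact comp_ne P (fun v => N (e v)) z.1 w.1 z.2 w.2 (hne _ _ hn)
  · rintro x y ⟨z, rfl⟩ ⟨w, rfl⟩ hn h1 h2
    rw [hβ, hβ] at hn
    rw [YE, hβ, hβ, hq]
    rcases z with z | z
    swap
    · exact absurd (Lr z) h1
    rcases w with w | w
    swap
    · exact absurd (Lr w) h2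
    refine (comp_ne P.dual (fun v => M (e v)) z.1 w.1 z.2 w.2 (hne _ _ hn)).trans ?_
    exact ⟨fun h => h.2, fun h => ⟨hne _ _ hn, h⟩⟩
  · rintro x y ⟨z, rfl⟩ h2 h
    obtain ⟨w, rfl⟩ := (im c k hk).supp2 _ _ h
    have h := (YE (.inr z) w).1 h
    rcases w with w | w
    · exact h
    · exact h2 (Lr w)
  · intro i hi
    obtain ⟨v, hv⟩ := e.surjective ⟨i, Finset.mem_range.1 hi⟩
    obtain ⟨a⟩ := hM (e v)
    refine ⟨_, ⟨.inl ⟨v, a⟩, rfl⟩, ?_⟩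
    refine (hβ (.inl ⟨v, a⟩)).trans ?_
    change (e v : ℕ) = i
    rw [hv]
  · rintro x y ⟨z, rfl⟩ ⟨w, rfl⟩ h
    obtain ⟨z, hz⟩ := ksurj z
    obtain ⟨w, hw⟩ := ksurj w
    rw [← hz, ← hw] at h ⊢
    rw [hβ, hβ] at h
    have h := e.injective (Fin.ext h)
    rw [HE, YE]
    rcases z with ⟨v, a⟩ | ⟨v, a⟩ <;> rcases w with ⟨w, b⟩ | ⟨w, b⟩ <;>
      (change v = w at h; subst h; refine (tinj_same n F _ _ _).trans ?_)
    · exact (comp_same P.dual (fun v => M (e v)) v a b).symm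
    · exact Iff.rfl
    · exact Iff.rfl
    · exact (comp_same P (fun v => N (e v)) v a b).symm
  · rintro x y ⟨z, rfl⟩ ⟨w, rfl⟩ h
    obtain ⟨z, hz⟩ := ksurj z
    obtain ⟨w, hw⟩ := ksurj w
    rw [← hz, ← hw] at h ⊢
    rw [hβ, hβ] at h
    rw [HE]
    exact tinj_ne n F _ _ _ _ (fun he => h (congrArg _ he))

theorem SProv.of_deriv {G G' : LGraph} (h : Deriv GSRule G G') (hG : SProv G) : SProv G' := by
  induction h with
  | refl => exact hG
  | tail _ st ih =>
    rcases st with st | ⟨C, R, p, c, hr, e1, e2⟩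
    · exact ih.iso st
    · refine SProv.iso (LGraph.iso_symm e2) ?_
      have hp := ih.iso e1
      cases hr with
      | ai a => exact hp.ai
      | ss A B S _ _ => exact hp.ss
      | p n P e M N _ h4 hM => exact SProv.p n P e M N h4 hM hp

theorem SProv.of_provable {G : LGraph} (h : Provable GSRule G) : SProv G :=
  SProv.of_deriv h ⟨fun v => v.elim, ⟨fun v => v.elim, fun v => v.elim⟩,
    Pr.empty _ (by rintro x ⟨v, _⟩; exact v.elim)⟩
end GSP

set_option linter.unusedVariables false
set_option maxHeartbeats 4000000
namespace GSP
open CG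

/-! ## From `Pr` to derivations -/

theorem LGraph.iso_rfl (G : LGraph) : G.iso G := ⟨⟨Equiv.refl _, fun _ _ => Iff.rfl, fun _ => rfl⟩⟩

theorem LGraph.iso_plug {C : LGraph} {R : Set C.V} {p p' : LGraph} (e : p.iso p') :
    (C.plug R p).iso (C.plug R p') := by
  obtain ⟨e⟩ := e
  refine ⟨⟨Equiv.sumCongr (Equiv.refl _) e.toEquiv, ?_, ?_⟩⟩
  · rintro (v | v) (w | w)
    · exact Iff.rfl
    · exact Iff.rfl
    · exact Iff.rfl
    · exact e.adj_iff v w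
  · rintro (v | v)
    · rfl
    · exact e.label_eq v

theorem LGraph.plug_empty (C : LGraph) (R : Set C.V) : C.iso (C.plug R LGraph.empty) := by
  refine ⟨⟨(Equiv.sumEmpty C.V Empty).symm, ?_, ?_⟩⟩
  · intro v w; exact Iff.rfl
  · intro v; rfl

theorem LGraph.empty_plug (X : LGraph) (R : Set LGraph.empty.V) :
    X.iso (LGraph.empty.plug R X) := by
  refine ⟨⟨(Equiv.emptySum Empty X.V).symm, ?_, ?_⟩⟩
  · intro v w; exact Iff.rfl
  · intro v; rfl

def plugSet (C : LGraph) (R : Set C.V) (C' : LGraph) (R' : Set C'.V) : Set (C.plug R C').V :=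
  fun u => match u with
    | .inl v => v ∈ R
    | .inr v => v ∈ R'

theorem LGraph.plug_plug (C : LGraph) (R : Set C.V) (C' : LGraph) (R' : Set C'.V) (p : LGraph) :
    (C.plug R (C'.plug R' p)).iso ((C.plug R C').plug (plugSet C R C' R') p) := by
  refine ⟨⟨(Equiv.sumAssoc C.V C'.V p.V).symm, ?_, ?_⟩⟩
  · rintro (v | v | v) (w | w | w) <;> exact Iff.rfl
  · rintro (v | v | v) <;> rfl

theorem Deriv.ctx {C : LGraph} {R : Set C.V} {p c : LGraph} (h : Deriv GSRule p c) :
    Deriv GSRule (C.plug R p) (C.plug R c) := by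
  induction h with
  | refl => exact Relation.ReflTransGen.refl
  | tail _ st ih =>
    refine ih.tail ?_
    rcases st with st | ⟨C', R', p', c', hr, e1, e2⟩
    · exact Or.inl (LGraph.iso_plug st)
    · refine Or.inr ⟨_, plugSet C R C' R', p', c', hr, ?_, ?_⟩
      · exact LGraph.iso_trans (LGraph.iso_plug e1) (LGraph.plug_plug _ _ _ _ _)
      · exact LGraph.iso_trans (LGraph.iso_plug e2) (LGraph.plug_plug _ _ _ _ _)

theorem Deriv.of_iso {G G' : LGraph} (h : G.iso G') : Deriv GSRule G G' :=
  Relation.ReflTransGen.single (Or.inl h)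

theorem Provable.iso {G G' : LGraph} (h : Provable GSRule G) (e : G.iso G') :
    Provable GSRule G' := Relation.ReflTransGen.tail h (Or.inl e)

theorem Provable.rule {G G' p c : LGraph} (C : LGraph) (R : Set C.V) (h : Provable GSRule G)
    (hr : GSRule p c) (e1 : G.iso (C.plug R p)) (e2 : G'.iso (C.plug R c)) :
    Provable GSRule G' := Relation.ReflTransGen.tail h (Or.inr ⟨C, R, p, c, hr, e1, e2⟩)

theorem Provable.plug {C : LGraph} {R : Set C.V} {X : LGraph} (h : Provable GSRule C)
    (hX : Provable GSRule X) : Provable GSRule (C.plug R X) :=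
  Relation.ReflTransGen.trans (h.iso (LGraph.plug_empty C R)) (Deriv.ctx hX)

theorem Provable.bigTensor : ∀ (n : ℕ) (F : Fin n → LGraph), (∀ i, Provable GSRule (F i)) →
    Provable GSRule (bigTensor n F)
  | 0, _, _ => Relation.ReflTransGen.refl
  | n + 1, F, h => by
    have h1 := Provable.plug (R := Set.univ) (h 0)
      (Provable.bigTensor n (fun i => F i.succ) fun i => h i.succ)
    refine h1.iso ⟨⟨Equiv.refl _, ?_, ?_⟩⟩
    · rintro (v | v) (w | w)
      · exact Iff.rfl
      · exact ⟨fun _ => trivial, fun _ => trivial⟩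
      · exact ⟨fun _ => trivial, fun _ => trivial⟩
      · exact Iff.rfl
    · intro v; rfl

noncomputable def toL (H : CG) : LGraph where
  V := {x // H.V x}
  fintype := H.fin.fintype
  adj v w := H.E v.1 w.1
  symm h := H.symm _ _ h
  irrefl v h := H.irr _ h
  label v := v.1.2

theorem toL_iso {H : CG} {G : LGraph} (f : G.V → Pt) (inj : Function.Injective f)
    (lab : ∀ v, (f v).2 = G.label v) (hV : ∀ x, H.V x ↔ ∃ v, f v = x)
    (hE : ∀ v w, H.E (f v) (f w) ↔ G.adj v w) : (toL H).iso G := by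
  let g : G.V → {x // H.V x} := fun v => ⟨f v, (hV _).2 ⟨v, rfl⟩⟩
  have hg : Function.Bijective g := by
    constructor
    · intro a b h; exact inj (congrArg Subtype.val h)
    · rintro ⟨x, hx⟩
      obtain ⟨v, rfl⟩ := (hV x).1 hx
      exact ⟨v, rfl⟩
  refine LGraph.iso_symm ⟨⟨Equiv.ofBijective g hg, ?_, ?_⟩⟩
  · intro v w; exact (hE v w).symm
  · intro v; exact lab v

theorem gs_ai {H : CG} {x y : Pt} (hn : x ≠ y) (hl : y.2 = dualAtom x.2)
    (hV : ∀ z, H.V z ↔ z = x ∨ z = y) (hE : ∀ z w, ¬ H.E z w) : Provable GSRule (toL H) := by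
  refine Provable.rule LGraph.empty ∅ Relation.ReflTransGen.refl (GSRule.ai x.2)
    (LGraph.empty_plug _ _) ?_
  let f : (LGraph.empty.plug ∅ ((LGraph.single (dualAtom x.2)).par (LGraph.single x.2))).V → Pt :=
    fun u => match u with
      | .inl v => v.elim
      | .inr (.inl _) => y
      | .inr (.inr _) => x
  refine toL_iso f ?_ ?_ ?_ ?_
  · rintro (v | v | v) (w | w | w) h
    · exact v.elim
    · exact v.elim
    · exact v.elim
    · exact w.elim
    · rfl
    · exact absurd h.symm hn
    · exact w.elim
    · exact absurd h hn
    · rfl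
  · rintro (v | v | v)
    · exact v.elim
    · exact hl
    · rfl
  · intro z
    rw [hV]
    constructor
    · rintro (rfl | rfl)
      · exact ⟨.inr (.inr ()), rfl⟩
      · exact ⟨.inr (.inl ()), rfl⟩
    · rintro ⟨v | v | v, rfl⟩
      · exact v.elim
      · exact Or.inr rfl
      · exact Or.inl rfl
  · rintro (v | v | v) (w | w | w) <;> first | exact v.elim | exact w.elim | exact iff_of_false (hE _ _) id

theorem gs_ins {H : CG} {Q : Pt → Prop} (hm : H.Mod Q)
    (h1 : Provable GSRule (toL (H.res fun x => ¬ Q x))) (h2 : Provable GSRule (toL (H.res Q))) :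
    Provable GSRule (toL H) := by
  let C := toL (H.res fun x => ¬ Q x)
  let R : Set C.V := {v | ∃ q, Q q ∧ H.E v.1 q}
  refine (Provable.plug (C := C) (R := R) h1 h2).iso (LGraph.iso_symm ?_)
  let f : (C.plug R (toL (H.res Q))).V → Pt := fun u => match u with
    | .inl v => v.1
    | .inr v => v.1
  refine toL_iso f ?_ ?_ ?_ ?_
  · rintro (⟨v, hv⟩ | ⟨v, hv⟩) (⟨w, hw⟩ | ⟨w, hw⟩) (h : v = w)
    · subst h; rfl
    · subst h; exact absurd hw.2 hv.2
    · subst h; exact absurd hv.2 hw.2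
    · subst h; rfl
  · rintro (v | v) <;> rfl
  · intro x
    constructor
    · intro hx
      by_cases hq : Q x
      · exact ⟨.inr ⟨x, hx, hq⟩, rfl⟩
      · exact ⟨.inl ⟨x, hx, hq⟩, rfl⟩
    · rintro ⟨⟨v, hv⟩ | ⟨v, hv⟩, rfl⟩
      · exact hv.1
      · exact hv.1
  · rintro (⟨v, hv⟩ | ⟨v, hv⟩) (⟨w, hw⟩ | ⟨w, hw⟩)
    · exact ⟨fun h => ⟨h, hv.2, hw.2⟩, fun h => h.1⟩
    · exact ⟨fun h => ⟨w, hw.2, h⟩, fun ⟨q, hq, h⟩ => hm.2 _ _ _ hv.1 hv.2 hq hw.2 h⟩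
    · exact ⟨fun h => ⟨v, hv.2, H.symm _ _ h⟩,
        fun ⟨q, hq, h⟩ => H.symm _ _ (hm.2 _ _ _ hw.1 hw.2 hq hv.2 h)⟩
    · exact ⟨fun h => ⟨h, hv.2, hw.2⟩, fun h => h.1⟩

theorem gs_s {H H' : CG} {X W D : Pt → Prop} (hD : H'.Mod D)
    (hXW : H'.Mod (fun x => X x ∨ W x)) (hd : ∀ x, X x → ¬ W x) (hXD : ∀ x, X x → D x)
    (hWD : ∀ x, W x → D x) (hW : ∃ x, W x) (hc : ∀ x y, X x → W y → ¬ H'.E x y)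
    (hV : ∀ x, H.V x ↔ H'.V x)
    (hE : ∀ x y, H.E x y ↔ H'.E x y ∧ ¬ (W x ∧ D y ∧ ¬ X y ∧ ¬ W y) ∧
        ¬ (W y ∧ D x ∧ ¬ X x ∧ ¬ W x)) (hP : Provable GSRule (toL H')) :
    Provable GSRule (toL H) := by
  by_cases hcut : ∃ x w, D x ∧ ¬ X x ∧ ¬ W x ∧ W w ∧ H'.E x w
  swap
  · have : H = H' := by
      refine CG.ext' hV fun x y => ?_
      rw [hE]
      refine ⟨fun h => h.1, fun h => ⟨h, ?_, ?_⟩⟩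
      · rintro ⟨a, b, c, d⟩; exact hcut ⟨y, x, b, c, d, a, H'.symm _ _ h⟩
      · rintro ⟨a, b, c, d⟩; exact hcut ⟨x, y, b, c, d, a, h⟩
    rw [this]; exact hP
  let C := toL (H'.res fun x => ¬ D x)
  let R : Set C.V := {v | ∃ q, D q ∧ H'.E v.1 q}
  let B := toL (H'.res fun x => D x ∧ ¬ W x)
  let A := toL (H'.res W)
  let S : Set B.V := {v | ∃ q, W q ∧ H'.E v.1 q}
  have hBA : ∀ b w, D b → ¬ W b → W w → (H'.E b w ↔ ∃ q, W q ∧ H'.E b q) := by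
    intro b w h1 h2 h3
    refine ⟨fun h => ⟨w, h3, h⟩, ?_⟩
    rintro ⟨q, hq, h⟩
    have hx : ¬ X b := fun hx => hc _ _ hx hq h
    exact hXW.2 b q w (H'.supp _ _ h) (fun h => h.elim hx h2) (Or.inr hq) (Or.inr h3) h
  have hCD : ∀ v d, ¬ D v → D d → (H'.E v d ↔ ∃ q, D q ∧ H'.E v q) := by
    intro b w h1 h2
    refine ⟨fun h => ⟨w, h2, h⟩, ?_⟩
    rintro ⟨q, hq, h⟩
    exact hD.2 b q w (H'.supp _ _ h) h1 hq h2 h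
  let f : C.V ⊕ (B.V ⊕ A.V) → Pt := fun u => match u with
    | .inl v => v.1
    | .inr (.inl v) => v.1
    | .inr (.inr v) => v.1
  have finj : Function.Injective f := by
    rintro (⟨v, hv⟩ | ⟨v, hv⟩ | ⟨v, hv⟩) (⟨w, hw⟩ | ⟨w, hw⟩ | ⟨w, hw⟩) (h : v = w)
    · subst h; rfl
    · subst h; exact absurd hw.2.1 hv.2
    · subst h; exact absurd (hWD _ hw.2) hv.2
    · subst h; exact absurd hv.2.1 hw.2
    · subst h; rfl
    · subst h; exact absurd hw.2 hv.2.2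
    · subst h; exact absurd (hWD _ hv.2) hw.2
    · subst h; exact absurd hv.2 hw.2.2
    · subst h; rfl
  have fV : ∀ x, H'.V x ↔ ∃ v, f v = x := by
    intro x
    constructor
    · intro hx
      by_cases h1 : D x
      · by_cases h2 : W x
        · exact ⟨.inr (.inr ⟨x, hx, h2⟩), rfl⟩
        · exact ⟨.inr (.inl ⟨x, hx, h1, h2⟩), rfl⟩
      · exact ⟨.inl ⟨x, hx, h1⟩, rfl⟩
    · rintro ⟨⟨v, hv⟩ | ⟨v, hv⟩ | ⟨v, hv⟩, rfl⟩
      · exact hv.1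
      · exact hv.1
      · exact hv.1
  refine Provable.rule C R hP (GSRule.ss A B S ?_ ?_) ?_ ?_
  · obtain ⟨w, hw⟩ := hW
    exact ⟨⟨w, hXW.1 _ (Or.inr hw), hw⟩⟩
  · obtain ⟨x, w, h1, h2, h3, h4, h5⟩ := hcut
    intro h
    have : (⟨x, hD.1 _ h1, h1, h3⟩ : B.V) ∈ S := ⟨w, h4, h5⟩
    rw [h] at this
    exact this
  · refine toL_iso (G := C.plug R (B.plug S A)) f finj ?_ fV ?_
    · rintro (v | v | v) <;> rfl
    · rintro (⟨v, hv⟩ | ⟨v, hv⟩ | ⟨v, hv⟩) (⟨w, hw⟩ | ⟨w, hw⟩ | ⟨w, hw⟩)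
      · exact ⟨fun h => ⟨h, hv.2, hw.2⟩, fun h => h.1⟩
      · exact hCD v w hv.2 hw.2.1
      · exact hCD v w hv.2 (hWD _ hw.2)
      · exact ⟨fun h => (hCD w v hw.2 hv.2.1).1 (H'.symm _ _ h),
          fun h => H'.symm _ _ ((hCD w v hw.2 hv.2.1).2 h)⟩
      · exact ⟨fun h => ⟨h, hv.2, hw.2⟩, fun h => h.1⟩
      · exact hBA v w hv.2.1 hv.2.2 hw.2
      · exact ⟨fun h => (hCD w v hw.2 (hWD _ hv.2)).1 (H'.symm _ _ h),
          fun h => H'.symm _ _ ((hCD w v hw.2 (hWD _ hv.2)).2 h)⟩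
      · exact ⟨fun h => (hBA w v hw.2.1 hw.2.2 hv.2).1 (H'.symm _ _ h),
          fun h => H'.symm _ _ ((hBA w v hw.2.1 hw.2.2 hv.2).2 h)⟩
      · exact ⟨fun h => ⟨h, hv.2, hw.2⟩, fun h => h.1⟩
  · have e1 : ∀ v d, ¬ D v → (H.E v d ↔ H'.E v d) := by
      intro v d h1
      rw [hE]
      exact ⟨fun h => h.1, fun h => ⟨h, fun h' => h1 (hWD _ h'.1), fun h' => h1 h'.2.1⟩⟩
    have e2 : ∀ v d, ¬ D d → (H.E v d ↔ H'.E v d) := by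
      intro v d h1
      rw [hE]
      exact ⟨fun h => h.1, fun h => ⟨h, fun h' => h1 h'.2.1, fun h' => h1 (hWD _ h'.1)⟩⟩
    have e3 : ∀ v w, ¬ W v → ¬ W w → (H.E v w ↔ H'.E v w) := by
      intro v d h1 h2
      rw [hE]
      exact ⟨fun h => h.1, fun h => ⟨h, fun h' => h1 h'.1, fun h' => h2 h'.1⟩⟩
    have e4 : ∀ v w, W v → W w → (H.E v w ↔ H'.E v w) := by
      intro v d h1 h2
      rw [hE]
      exact ⟨fun h => h.1, fun h => ⟨h, fun h' => h'.2.2.2 h2, fun h' => h'.2.2.2 h1⟩⟩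
    have e5 : ∀ v w, D v → ¬ W v → W w → ¬ H.E v w := by
      intro v w h1 h2 h3 h
      have h := (hE _ _).1 h
      by_cases hx : X v
      · exact hc _ _ hx h3 h.1
      · exact h.2.2 ⟨h3, h1, hx, h2⟩
    refine toL_iso (G := C.plug R (B.par A)) f finj ?_ (fun x => (hV x).trans (fV x)) ?_
    · rintro (v | v | v) <;> rfl
    · rintro (⟨v, hv⟩ | ⟨v, hv⟩ | ⟨v, hv⟩) (⟨w, hw⟩ | ⟨w, hw⟩ | ⟨w, hw⟩)
      · exact (e1 v w hv.2).trans ⟨fun h => ⟨h, hv.2, hw.2⟩, fun h => h.1⟩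
      · exact (e1 v w hv.2).trans (hCD v w hv.2 hw.2.1)
      · exact (e1 v w hv.2).trans (hCD v w hv.2 (hWD _ hw.2))
      · exact (e2 v w hw.2).trans ⟨fun h => (hCD w v hw.2 hv.2.1).1 (H'.symm _ _ h),
          fun h => H'.symm _ _ ((hCD w v hw.2 hv.2.1).2 h)⟩
      · exact (e3 v w hv.2.2 hw.2.2).trans ⟨fun h => ⟨h, hv.2, hw.2⟩, fun h => h.1⟩
      · exact iff_of_false (e5 v w hv.2.1 hv.2.2 hw.2) id
      · exact (e2 v w hw.2).trans ⟨fun h => (hCD w v hw.2 (hWD _ hv.2)).1 (H'.symm _ _ h),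
          fun h => H'.symm _ _ ((hCD w v hw.2 (hWD _ hv.2)).2 h)⟩
      · exact iff_of_false (fun h => e5 w v hw.2.1 hw.2.2 hv.2 (H.symm _ _ h)) id
      · exact (e4 v w hv.2 hw.2).trans ⟨fun h => ⟨h, hv.2, hw.2⟩, fun h => h.1⟩
end GSP

set_option linter.unusedVariables false
set_option maxHeartbeats 4000000
namespace GSP
open CG

def pG (n : ℕ) (ι : Fin n → ℕ) (p : ℕ → ℕ → Prop) (hp : ∀ i j, p i j → p j i) : LGraph where
  V := Fin n
  adj i j := i ≠ j ∧ p (ι i) (ι j)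
  symm h := ⟨h.1.symm, hp _ _ h.2⟩
  irrefl _ h := h.1 rfl
  label _ := (0, true)

theorem pG_prime {n : ℕ} {ι : Fin n → ℕ} {p : ℕ → ℕ → Prop} {hp : ∀ i j, p i j → p j i}
    {I : Finset ℕ} (hn : I.card = n) (hι : Function.Injective ι) (hI : ∀ i, ι i ∈ I)
    (hs : ∀ k ∈ I, ∃ i, ι i = k) (h : PrimeOn I p) : (pG n ι p hp).Prime := by
  classical
  constructor
  · have : Fintype.card (pG n ι p hp).V = n := Fintype.card_fin n
    rw [this]; have := h.1; omega
  · intro M hM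
    change Set (Fin n) at M
    let J : Finset ℕ := (Finset.univ.filter fun i => i ∈ M).image ι
    have hJ : ∀ i, ι i ∈ J ↔ i ∈ M := by
      intro i
      simp only [J, Finset.mem_image, Finset.mem_filter, Finset.mem_univ, true_and]
      constructor
      · rintro ⟨j, hj, e⟩; rw [← hι e]; exact hj
      · intro hi; exact ⟨i, hi, rfl⟩
    have hJI : J ⊆ I := by
      intro k hk
      simp only [J, Finset.mem_image] at hk
      obtain ⟨i, _, rfl⟩ := hk
      exact hI i
    have hmod : ∀ k ∈ I, k ∉ J → ∀ i ∈ J, ∀ j ∈ J, p k i → p k j := by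
      intro k hk hkJ i hi j hj hki
      obtain ⟨k, rfl⟩ := hs k hk
      obtain ⟨i, rfl⟩ := hs i (hJI hi)
      obtain ⟨j, rfl⟩ := hs j (hJI hj)
      rw [hJ] at hkJ hi hj
      have := (hM k hkJ i hi j hj).1 ⟨fun e => hkJ (e ▸ hi), hki⟩
      exact this.2
    rcases h.2 J hJI hmod with h1 | h1
    · rw [Finset.card_le_one] at h1
      rcases Set.eq_empty_or_nonempty M with h0 | ⟨i, hi⟩
      · exact Or.inl h0
      · refine Or.inr (Or.inl ⟨i, ?_⟩)
        ext j
        constructor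
        · intro hj
          exact hι (h1 _ ((hJ j).2 hj) _ ((hJ i).2 hi))
        · intro hj
          have hj : j = i := hj
          rw [hj]; exact hi
    · refine Or.inr (Or.inr ?_)
      ext i
      refine ⟨fun _ => trivial, fun _ => ?_⟩
      rw [← hJ, h1]; exact hI i

theorem gs_pr {H : CG} {I : Finset ℕ} {p : ℕ → ℕ → Prop} {β : Pt → ℕ} {L : Pt → Prop}
    (hp : PrimeOn I p) (hc : Compo H I p β L)
    (hr : ∀ i ∈ I, ∃ x, H.V x ∧ β x = i ∧ ¬ L x)
    (hb : ∀ i ∈ I, Provable GSRule (toL (H.res fun x => β x = i))) : Provable GSRule (toL H) := by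
  classical
  obtain ⟨n, hn⟩ : ∃ n, I.card = n := ⟨_, rfl⟩
  obtain ⟨ι, hι, hI, hs⟩ : ∃ ι : Fin n → ℕ, Function.Injective ι ∧ (∀ i, ι i ∈ I) ∧
      ∀ k ∈ I, ∃ i, ι i = k := by
    subst hn
    refine ⟨fun i => (I.equivFin.symm i).1, ?_, fun i => (I.equivFin.symm i).2, ?_⟩
    · intro i j h; exact I.equivFin.symm.injective (Subtype.ext h)
    · intro k hk; exact ⟨I.equivFin ⟨k, hk⟩, by simp⟩
  let P := pG n ι p hc.symm
  let M : Fin n → LGraph := fun i => toL (H.res fun x => β x = ι i ∧ ¬ L x)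
  let N : Fin n → LGraph := fun i => toL (H.res fun x => β x = ι i ∧ L x)
  have hprem : Provable GSRule (bigTensor n fun i => (M i).par (N i)) := by
    refine Provable.bigTensor n _ fun i => (hb _ (hI i)).iso ?_
    let f : (M i).V ⊕ (N i).V → Pt := fun u => match u with
      | .inl v => v.1
      | .inr v => v.1
    refine toL_iso (G := (M i).par (N i)) f ?_ ?_ ?_ ?_
    · rintro (⟨v, hv⟩ | ⟨v, hv⟩) (⟨w, hw⟩ | ⟨w, hw⟩) (h : v = w)
      · subst h; rfl
      · subst h; exact absurd hw.2.2 hv.2.2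
      · subst h; exact absurd hv.2.2 hw.2.2
      · subst h; rfl
    · rintro (v | v) <;> rfl
    · intro x
      constructor
      · rintro ⟨hx, h1⟩
        by_cases hq : L x
        · exact ⟨.inr ⟨x, hx, h1, hq⟩, rfl⟩
        · exact ⟨.inl ⟨x, hx, h1, hq⟩, rfl⟩
      · rintro ⟨⟨v, hv⟩ | ⟨v, hv⟩, rfl⟩
        · exact ⟨hv.1, hv.2.1⟩
        · exact ⟨hv.1, hv.2.1⟩
    · rintro (⟨v, hv⟩ | ⟨v, hv⟩) (⟨w, hw⟩ | ⟨w, hw⟩)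
      · exact ⟨fun h => ⟨h.1, hv.2, hw.2⟩, fun h => ⟨h.1, hv.2.1, hw.2.1⟩⟩
      · exact iff_of_false (fun h => hc.cross w v hw.2.2 hv.2.2 (H.symm _ _ h.1)) id
      · exact iff_of_false (fun h => hc.cross v w hv.2.2 hw.2.2 h.1) id
      · exact ⟨fun h => ⟨h.1, hv.2, hw.2⟩, fun h => ⟨h.1, hv.2.1, hw.2.1⟩⟩
  refine Provable.rule LGraph.empty ∅ hprem
    (GSRule.p n P (Equiv.refl _) M N (pG_prime hn hι hI hs hp) (hn ▸ hp.1) ?_)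
    (LGraph.empty_plug _ _) ?_
  · intro i
    obtain ⟨x, h1, h2, h3⟩ := hr _ (hI i)
    exact ⟨⟨x, h1, h2, h3⟩⟩
  refine LGraph.iso_trans ?_ (LGraph.empty_plug _ _)
  let f : (Σ i : Fin n, (M i).V) ⊕ (Σ i : Fin n, (N i).V) → Pt := fun u => match u with
    | .inl z => z.2.1
    | .inr z => z.2.1
  refine toL_iso (G := (P.dual.comp M).par (P.comp N)) f ?_ ?_ ?_ ?_
  · rintro (⟨i, v, hv⟩ | ⟨i, v, hv⟩) (⟨j, w, hw⟩ | ⟨j, w, hw⟩) (h : v = w)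
    · subst h; obtain rfl := hι (hv.2.1.symm.trans hw.2.1); rfl
    · subst h; exact absurd hw.2.2 hv.2.2
    · subst h; exact absurd hv.2.2 hw.2.2
    · subst h; obtain rfl := hι (hv.2.1.symm.trans hw.2.1); rfl
  · rintro (v | v) <;> rfl
  · intro x
    constructor
    · intro hx
      obtain ⟨i, hi⟩ := hs _ (hc.mem x hx)
      by_cases hq : L x
      · exact ⟨.inr ⟨i, x, hx, hi.symm, hq⟩, rfl⟩
      · exact ⟨.inl ⟨i, x, hx, hi.symm, hq⟩, rfl⟩
    · rintro ⟨⟨i, v, hv⟩ | ⟨i, v, hv⟩, rfl⟩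
      · exact hv.1
      · exact hv.1
  · rintro (⟨i, v, hv⟩ | ⟨i, v, hv⟩) (⟨j, w, hw⟩ | ⟨j, w, hw⟩)
    · by_cases hij : i = j
      · subst hij
        refine Iff.trans ?_ (comp_same P.dual M i ⟨v, hv⟩ ⟨w, hw⟩).symm
        exact ⟨fun h => ⟨h, hv.2, hw.2⟩, fun h => h.1⟩
      · refine Iff.trans ?_ (comp_ne P.dual M i j ⟨v, hv⟩ ⟨w, hw⟩ hij).symm
        have hne : β v ≠ β w := by rw [hv.2.1, hw.2.1]; exact fun h => hij (hι h)
        refine (hc.right v w hv.1 hw.1 hne hv.2.2 hw.2.2).trans ?_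
        rw [hv.2.1, hw.2.1]
        exact ⟨fun h => ⟨hij, fun h' => h h'.2⟩, fun h h' => h.2 ⟨hij, h'⟩⟩
    · exact iff_of_false (fun h => hc.cross w v hw.2.2 hv.2.2 (H.symm _ _ h)) id
    · exact iff_of_false (fun h => hc.cross v w hv.2.2 hw.2.2 h) id
    · by_cases hij : i = j
      · subst hij
        refine Iff.trans ?_ (comp_same P N i ⟨v, hv⟩ ⟨w, hw⟩).symm
        exact ⟨fun h => ⟨h, hv.2, hw.2⟩, fun h => h.1⟩
      · refine Iff.trans ?_ (comp_ne P N i j ⟨v, hv⟩ ⟨w, hw⟩ hij).symm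
        have hne : β v ≠ β w := by rw [hv.2.1, hw.2.1]; exact fun h => hij (hι h)
        refine (hc.left v w hv.1 hw.1 hne hv.2.2 hw.2.2).trans ?_
        rw [hv.2.1, hw.2.1]
        exact ⟨fun h => ⟨hij, h⟩, fun h => h.2⟩

theorem Pr.gs {H : CG} (h : Pr H) : Provable GSRule (toL H) := by
  induction h with
  | empty H h =>
    refine Provable.iso Relation.ReflTransGen.refl (LGraph.iso_symm ?_)
    refine toL_iso (fun v => v.elim) (fun v => v.elim) (fun v => v.elim) ?_ (fun v => v.elim)
    intro x
    exact iff_of_false (h x) fun ⟨v, _⟩ => v.elim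
  | ai H x y h1 h2 h3 h4 => exact gs_ai h1 h2 h3 h4
  | s H H' X W D a b c d e f g i j k _ ih => exact gs_s a b c d e g i j k ih
  | ins H Q hm _ _ ih1 ih2 => exact gs_ins hm ih1 ih2
  | pr H I p β L hp hc _ hr _ ih => exact gs_pr hp hc hr ih

noncomputable def delV (G : LGraph) (g : G.V) : LGraph where
  V := {x // x ≠ g}
  fintype := by classical exact inferInstance
  adj v w := G.adj v.1 w.1
  symm h := G.symm h
  irrefl v h := G.irrefl _ h
  label v := G.label v.1

theorem delV_iso (G : LGraph) (g : G.V) :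
    ((delV G g).plug {x | G.adj x.1 g} (LGraph.single (G.label g))).iso G := by
  let f : {x // x ≠ g} ⊕ Unit → G.V := fun u => match u with
    | .inl v => v.1
    | .inr _ => g
  have hf : Function.Bijective f := by
    constructor
    · rintro (⟨v, hv⟩ | v) (⟨w, hw⟩ | w) h
      · have h : v = w := h
        subst h; rfl
      · exact absurd h hv
      · exact absurd h.symm hw
      · rfl
    · intro v
      by_cases h : v = g
      · exact ⟨.inr (), h.symm⟩
      · exact ⟨.inl ⟨v, h⟩, rfl⟩
  refine ⟨⟨Equiv.ofBijective f hf, ?_, ?_⟩⟩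
  · rintro (v | v) (w | w)
    · exact Iff.rfl
    · exact Iff.rfl
    · exact ⟨fun h => G.symm h, fun h => G.symm h⟩
    · exact iff_of_false id (G.irrefl g)
  · rintro (v | v) <;> rfl

theorem atomic_splitting_aux (G : LGraph) (a : Atom)
    (h : Provable GSRule (G.par (LGraph.single a))) :
    ∃ (C : LGraph) (R : Set C.V),
      Deriv GSRule (C.plug R (LGraph.single (dualAtom a))) G ∧
      Provable GSRule C := by
  obtain ⟨f, hf, hP⟩ := SProv.of_provable h
  obtain ⟨w, h1, ⟨u, rfl⟩, h3, h4⟩ := W_lemma (fun a => by simp [dualAtom]) hP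
    (f (.inr ())) ⟨_, rfl⟩
  rcases u with g | g
  swap
  · exact absurd rfl h1
  have hlab : G.label g = dualAtom a :=
    (hf.lab (.inl g)).symm.trans (h3.trans (congrArg dualAtom (hf.lab (.inr ()))))
  refine ⟨delV G g, {x | G.adj x.1 g}, ?_, h4.gs.iso ?_⟩
  · rw [← hlab]; exact Deriv.of_iso (delV_iso G g)
  · refine toL_iso (G := delV G g) (fun v => f (.inl v.1)) ?_ ?_ ?_ ?_
    · intro v w e; exact Subtype.ext (Sum.inl_injective (hf.inj e))
    · intro v; exact hf.lab (.inl v.1)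
    · intro x
      constructor
      · rintro ⟨⟨v | v, rfl⟩, h5, h6⟩
        · exact ⟨⟨v, fun e => h6 (by rw [e])⟩, rfl⟩
        · exact absurd rfl h5
      · rintro ⟨v, rfl⟩
        refine ⟨⟨_, rfl⟩, fun e => ?_, fun e => ?_⟩
        · exact absurd (hf.inj e) Sum.inl_ne_inr
        · exact v.2 (Sum.inl_injective (hf.inj e))
    · intro v w
      constructor
      · intro e; exact (im_E (h := hf) (.inl v.1) (.inl w.1)).1 e.1
      · intro e
        refine ⟨(im_E (h := hf) (.inl v.1) (.inl w.1)).2 e, ⟨fun e => ?_, fun e => ?_⟩, ⟨fun e => ?_, fun e => ?_⟩⟩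
        · exact absurd (hf.inj e) Sum.inl_ne_inr
        · exact v.2 (Sum.inl_injective (hf.inj e))
        · exact absurd (hf.inj e) Sum.inl_ne_inr
        · exact w.2 (Sum.inl_injective (hf.inj e))
end GSP

namespace GSP
open LGraph

/-- **Atomic splitting.** If `G ⅋ a` is provable in GS (where `a`
denotes the single-vertex graph labelled `a`), then there exists a context `C[·]_R`
such that there is a GS derivation from `C[ā]_R` to `G` and `C` is provable in GS. -/
theorem atomic_splitting (G : LGraph) (a : Atom)
    (h : Provable GSRule (G.par (single a))) :
    ∃ (C : LGraph) (R : Set C.V),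
      Deriv GSRule (C.plug R (single (dualAtom a))) G ∧
      Provable GSRule C := atomic_splitting_aux G a h

end GSP
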